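/- (Bochner–Riesz summability for P(D).) Assume n > m, let 1 ≤ p < min(2(n+1)/(n+3), n/m), let α > n(1/p − 1/2) − 1/2, and let p < r < p' (where 1/p + 1/p' = 1). Then there is a constant C such that for every R > 0 and every Schwartz function f, the Bochner–Riesz mean of order α, given by the Fourier multiplier with symbol ξ ↦ (1 − P(ξ)/R)_+^α, satisfies ‖𝓕⁻¹((1 − P(·)/R)_+^α · f̂)‖_{L^r} ≤ C ‖f‖_{L^r}. -/

import Mathlib

open MeasureTheory Complex
open scoped ENNReal RealInnerProductSpace

noncomputable section

/-- The Fourier transform `f̂(ξ) = ∫ e^{−ix·ξ} f(x) dx`. -/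
def FT {n : ℕ} (f : EuclideanSpace ℝ (Fin n) → ℂ) (ξ : EuclideanSpace ℝ (Fin n)) : ℂ :=
  ∫ x, Complex.exp (-Complex.I * (⟪x, ξ⟫ : ℂ)) * f x

/-- The inverse Fourier transform `𝓕⁻¹g(x) = (2π)^{−n} ∫ e^{ix·ξ} g(ξ) dξ`. -/
def IFT {n : ℕ} (g : EuclideanSpace ℝ (Fin n) → ℂ) (x : EuclideanSpace ℝ (Fin n)) : ℂ :=
  (((2 * Real.pi) ^ n : ℝ) : ℂ)⁻¹ * ∫ ξ, Complex.exp (Complex.I * (⟪x, ξ⟫ : ℂ)) * g ξ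

/-- The determinant of the Hessian matrix `(∂²f/∂ξᵢ∂ξⱼ)` of `f` at `ξ`. -/
def HessDet {n : ℕ} (f : EuclideanSpace ℝ (Fin n) → ℝ) (ξ : EuclideanSpace ℝ (Fin n)) : ℝ :=
  Matrix.det (Matrix.of fun i j : Fin n =>
    fderiv ℝ (fun y => fderiv ℝ f y (EuclideanSpace.single j 1)) ξ (EuclideanSpace.single i 1))

/-- Analytic family through `c`. -/
def rtFam (s : ℂ → ℂ) (c : ℂ) (z : ℂ) : ℂ :=
  if c = 0 then 0 else (c / (‖c‖ : ℂ)) * Complex.exp ((Real.log ‖c‖ : ℂ) * s z)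

lemma rtFam_norm (s : ℂ → ℂ) (c z : ℂ) (hs : 0 < (s z).re) :
    ‖rtFam s c z‖ = ‖c‖ ^ (s z).re := by
  unfold rtFam
  split_ifs with h
  · simp [h, Real.zero_rpow hs.ne']
  · have hc : 0 < ‖c‖ := norm_pos_iff.mpr h
    rw [norm_mul, norm_div, Complex.norm_real, norm_norm, div_self hc.ne', one_mul,
      Complex.norm_exp, Complex.re_ofReal_mul, Real.rpow_def_of_pos hc]

lemma rtFam_self (s : ℂ → ℂ) (c z : ℂ) (hs : s z = 1) : rtFam s c z = c := by
  unfold rtFam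
  split_ifs with h
  · exact h.symm
  · have hc : 0 < ‖c‖ := norm_pos_iff.mpr h
    rw [hs, mul_one, ← Complex.ofReal_exp, Real.exp_log hc, div_mul_cancel₀]
    exact_mod_cast hc.ne'

lemma rtFam_diff (s : ℂ → ℂ) (hs : Differentiable ℂ s) (c : ℂ) :
    Differentiable ℂ (rtFam s c) := by
  unfold rtFam
  split_ifs with h
  · exact differentiable_const 0
  · fun_prop

lemma rtFam_bdd (s : ℂ → ℂ) (S : ℝ) (c z : ℂ) (hs : 0 < (s z).re) (hS : (s z).re ≤ S) :
    ‖rtFam s c z‖ ≤ (1 + ‖c‖) ^ S := by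
  rw [rtFam_norm s c z hs]
  calc ‖c‖ ^ (s z).re ≤ (1 + ‖c‖) ^ (s z).re :=
        Real.rpow_le_rpow (norm_nonneg _) (by linarith) hs.le
    _ ≤ (1 + ‖c‖) ^ S := Real.rpow_le_rpow_of_exponent_le (by linarith [norm_nonneg c]) hS

/-- Riesz–Thorin for finite matrices. -/
theorem rt_finite {ι κ : Type*} [Fintype ι] [Fintype κ] (β : ι → κ → ℂ) (u : ι → ℝ) (v : κ → ℝ)
    (hu : ∀ i, 0 ≤ u i) (hv : ∀ j, 0 ≤ v j)
    (a0 a1 b0 b1 θ A0 A1 : ℝ) (ha0 : 0 < a0) (ha1 : 0 < a1) (hb0 : 0 < b0) (hb1 : 0 < b1)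
    (hθ0 : 0 < θ) (hθ1 : θ < 1) (hA0 : 0 ≤ A0) (hA1 : 0 ≤ A1)
    (h0 : ∀ (c : ι → ℂ) (d : κ → ℂ), ‖∑ i, ∑ j, β i j * c i * d j‖ ≤
      A0 * (∑ i, ‖c i‖ ^ (1 / a0) * u i) ^ a0 * (∑ j, ‖d j‖ ^ (1 / b0) * v j) ^ b0)
    (h1 : ∀ (c : ι → ℂ) (d : κ → ℂ), ‖∑ i, ∑ j, β i j * c i * d j‖ ≤
      A1 * (∑ i, ‖c i‖ ^ (1 / a1) * u i) ^ a1 * (∑ j, ‖d j‖ ^ (1 / b1) * v j) ^ b1)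
    (a b : ℝ) (ha : a = (1 - θ) * a0 + θ * a1) (hb : b = (1 - θ) * b0 + θ * b1)
    (c : ι → ℂ) (d : κ → ℂ) :
    ‖∑ i, ∑ j, β i j * c i * d j‖ ≤
      A0 ^ (1 - θ) * A1 ^ θ * (∑ i, ‖c i‖ ^ (1 / a) * u i) ^ a *
        (∑ j, ‖d j‖ ^ (1 / b) * v j) ^ b := by
  have hθ1' : 0 < 1 - θ := by linarith
  have hap : 0 < a := by rw [ha]; positivity
  have hbp : 0 < b := by rw [hb]; positivity
  set s : ℂ → ℂ := fun z => ((a0 : ℂ) * (1 - z) + a1 * z) / a with hs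
  set t : ℂ → ℂ := fun z => ((b0 : ℂ) * (1 - z) + b1 * z) / b with ht
  have hsd : Differentiable ℂ s := by rw [hs]; fun_prop
  have htd : Differentiable ℂ t := by rw [ht]; fun_prop
  have hsre : ∀ z, (s z).re = (a0 * (1 - z.re) + a1 * z.re) / a := by
    intro z; simp [hs, Complex.div_ofReal_re]
  have htre : ∀ z, (t z).re = (b0 * (1 - z.re) + b1 * z.re) / b := by
    intro z; simp [ht, Complex.div_ofReal_re]
  have hpos : ∀ x y w : ℝ, 0 < x → 0 < y → 0 ≤ w → w ≤ 1 → 0 < x * (1 - w) + y * w := by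
    intro x y w hx hy hw0 hw1
    rcases eq_or_lt_of_le hw0 with h | h
    · rw [← h]; simpa using hx
    · have := mul_nonneg hx.le (sub_nonneg.2 hw1)
      have := mul_pos hy h
      linarith
  have hle : ∀ x y w : ℝ, 0 < x → 0 < y → 0 ≤ w → w ≤ 1 → x * (1 - w) + y * w ≤ x + y := by
    intro x y w hx hy hw0 hw1
    nlinarith
  set N := ∑ i, ‖c i‖ ^ (1 / a) * u i with hN
  set N' := ∑ j, ‖d j‖ ^ (1 / b) * v j with hN'
  have hN0 : 0 ≤ N := Finset.sum_nonneg fun i _ => mul_nonneg (by positivity) (hu i)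
  have hN'0 : 0 ≤ N' := Finset.sum_nonneg fun i _ => mul_nonneg (by positivity) (hv i)
  let F : ℂ → ℂ := fun z => ∑ i, ∑ j, β i j * rtFam s (c i) z * rtFam t (d j) z
  have hF : Differentiable ℂ F := by
    refine Differentiable.fun_sum fun i _ => Differentiable.fun_sum fun j _ => ?_
    exact ((differentiable_const _).mul (rtFam_diff s hsd _)).mul (rtFam_diff t htd _)
  have hz : (θ : ℂ) ∈ Complex.HadamardThreeLines.verticalClosedStrip 0 1 := by
    simp [Complex.HadamardThreeLines.verticalClosedStrip, hθ0.le, hθ1.le]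
  have hB : BddAbove ((norm ∘ F) '' Complex.HadamardThreeLines.verticalClosedStrip 0 1) := by
    refine ⟨∑ i, ∑ j, ‖β i j‖ * (1 + ‖c i‖) ^ ((a0 + a1) / a) * (1 + ‖d j‖) ^ ((b0 + b1) / b), ?_⟩
    rintro _ ⟨z, hz, rfl⟩
    simp only [Complex.HadamardThreeLines.verticalClosedStrip, Set.mem_preimage, Set.mem_Icc] at hz
    refine (norm_sum_le _ _).trans (Finset.sum_le_sum fun i _ => ?_)
    refine (norm_sum_le _ _).trans (Finset.sum_le_sum fun j _ => ?_)
    rw [norm_mul, norm_mul]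
    have e1 := rtFam_bdd s ((a0 + a1) / a) (c i) z
      (by rw [hsre]; exact div_pos (hpos _ _ _ ha0 ha1 hz.1 hz.2) hap)
      (by rw [hsre]; exact div_le_div_of_nonneg_right (hle _ _ _ ha0 ha1 hz.1 hz.2) hap.le)
    have e2 := rtFam_bdd t ((b0 + b1) / b) (d j) z
      (by rw [htre]; exact div_pos (hpos _ _ _ hb0 hb1 hz.1 hz.2) hbp)
      (by rw [htre]; exact div_le_div_of_nonneg_right (hle _ _ _ hb0 hb1 hz.1 hz.2) hbp.le)
    gcongr
  have key : ∀ (z : ℂ) (x y : ℝ), 0 < x → 0 < y → (s z).re = x / a → (t z).re = y / b →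
      (∑ i, ‖rtFam s (c i) z‖ ^ (1 / x) * u i) = N ∧
      (∑ j, ‖rtFam t (d j) z‖ ^ (1 / y) * v j) = N' := by
    intro z x y hx hy h1 h2
    constructor
    · refine Finset.sum_congr rfl fun i _ => ?_
      rw [rtFam_norm _ _ _ (by rw [h1]; positivity), h1, ← Real.rpow_mul (norm_nonneg _)]
      congr 2; field_simp
    · refine Finset.sum_congr rfl fun i _ => ?_
      rw [rtFam_norm _ _ _ (by rw [h2]; positivity), h2, ← Real.rpow_mul (norm_nonneg _)]
      congr 2; field_simp
  have main := Complex.HadamardThreeLines.norm_le_interp_of_mem_verticalClosedStrip₀₁' F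
    (a := A0 * N ^ a0 * N' ^ b0) (b := A1 * N ^ a1 * N' ^ b1) hz hF.diffContOnCl hB
    (by
      intro z hz
      have hz : z.re = 0 := hz
      obtain ⟨k1, k2⟩ := key z a0 b0 ha0 hb0 (by rw [hsre, hz]; ring) (by rw [htre, hz]; ring)
      have := h0 (fun i => rtFam s (c i) z) (fun j => rtFam t (d j) z)
      rwa [k1, k2] at this)
    (by
      intro z hz
      have hz : z.re = 1 := hz
      obtain ⟨k1, k2⟩ := key z a1 b1 ha1 hb1 (by rw [hsre, hz]; ring) (by rw [htre, hz]; ring)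
      have := h1 (fun i => rtFam s (c i) z) (fun j => rtFam t (d j) z)
      rwa [k1, k2] at this)
  have hFθ : F θ = ∑ i, ∑ j, β i j * c i * d j := by
    have es : s θ = 1 := by
      simp only [hs]
      rw [div_eq_one_iff_eq (by exact_mod_cast hap.ne'), ha]; push_cast; ring
    have et : t θ = 1 := by
      simp only [ht]
      rw [div_eq_one_iff_eq (by exact_mod_cast hbp.ne'), hb]; push_cast; ring
    simp only [F, rtFam_self s _ _ es, rtFam_self t _ _ et]
  rw [hFθ, Complex.ofReal_re] at main
  refine main.trans (le_of_eq ?_)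
  rw [Real.mul_rpow (by positivity) (by positivity), Real.mul_rpow (by positivity) (by positivity),
    Real.mul_rpow (by positivity) (by positivity), Real.mul_rpow (by positivity) (by positivity),
    ← Real.rpow_mul hN0, ← Real.rpow_mul hN0, ← Real.rpow_mul hN'0, ← Real.rpow_mul hN'0]
  have e1 : N ^ a = N ^ (a0 * (1 - θ)) * N ^ (a1 * θ) := by
    rw [← Real.rpow_add_of_nonneg hN0 (by positivity) (by positivity)]; congr 1; rw [ha]; ring
  have e2 : N' ^ b = N' ^ (b0 * (1 - θ)) * N' ^ (b1 * θ) := by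
    rw [← Real.rpow_add_of_nonneg hN'0 (by positivity) (by positivity)]; congr 1; rw [hb]; ring
  rw [e1, e2]; ring

abbrev Eu (n : ℕ) := EuclideanSpace ℝ (Fin n)

/-- Bounded integrable measurable functions. -/
structure Good {n : ℕ} (f : Eu n → ℂ) : Prop where
  meas : Measurable f
  int : Integrable f
  bdd : ∃ C : ℝ, ∀ x, ‖f x‖ ≤ C

def nrm {n : ℕ} (p : ℝ) (f : Eu n → ℂ) : ℝ := (∫ x, ‖f x‖ ^ p) ^ (1 / p)

def BM {n : ℕ} (M f h : Eu n → ℂ) : ℂ := ∫ ξ, M ξ * FT f ξ * FT h (-ξ)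

lemma nrm_nonneg {n : ℕ} (p : ℝ) (f : Eu n → ℂ) : 0 ≤ nrm p f := by
  unfold nrm; positivity

lemma Good.rpow_int {n : ℕ} {f : Eu n → ℂ} (hf : Good f) {p : ℝ} (hp : 1 ≤ p) :
    Integrable (fun x => ‖f x‖ ^ p) := by
  obtain ⟨C, hC⟩ := hf.bdd
  refine Integrable.mono' (g := fun x => C ^ (p - 1) * ‖f x‖) (hf.int.norm.const_mul _)
    (hf.meas.norm.pow_const p).aestronglyMeasurable (Filter.Eventually.of_forall fun x => ?_)
  rw [Real.norm_of_nonneg (by positivity)]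
  have : ‖f x‖ ^ p = ‖f x‖ ^ (p - 1) * ‖f x‖ := by
    rcases eq_or_lt_of_le (norm_nonneg (f x)) with h | h
    · rw [← h, mul_zero, Real.zero_rpow (by linarith)]
    · rw [← Real.rpow_add_one h.ne']; simp
  rw [this]
  gcongr
  · exact hC x

lemma Good.indicator {n : ℕ} {f : Eu n → ℂ} (hf : Good f) {s : Set (Eu n)} (hs : MeasurableSet s) :
    Good (s.indicator f) := by
  obtain ⟨C, hC⟩ := hf.bdd
  refine ⟨hf.meas.indicator hs, hf.int.indicator hs, C, fun x => ?_⟩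
  exact (norm_indicator_le_norm_self f x).trans (hC x)

lemma Good.star {n : ℕ} {f : Eu n → ℂ} (hf : Good f) :
    Good (fun x => (starRingEnd ℂ) (f x)) := by
  obtain ⟨C, hC⟩ := hf.bdd
  refine ⟨?_, ?_, C, fun x => by simpa using hC x⟩
  · exact Complex.continuous_conj.measurable.comp hf.meas
  · exact (integrable_norm_iff (Complex.continuous_conj.measurable.comp
      hf.meas).aestronglyMeasurable).1 (by simpa using hf.int.norm)

lemma FT_norm_le {n : ℕ} (f : Eu n → ℂ) (ξ : Eu n) : ‖FT f ξ‖ ≤ ∫ x, ‖f x‖ := by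
  unfold FT
  refine (norm_integral_le_integral_norm _).trans (le_of_eq ?_)
  congr 1; ext x
  rw [norm_mul]
  have : -I * (⟪x, ξ⟫ : ℂ) = ((-⟪x, ξ⟫ : ℝ) : ℂ) * I := by push_cast; ring
  rw [this, Complex.norm_exp_ofReal_mul_I, one_mul]

lemma norm_expI (t : ℝ) : ‖Complex.exp (I * (t : ℂ))‖ = 1 := by
  rw [mul_comm, Complex.norm_exp_ofReal_mul_I]

lemma norm_expnI (t : ℝ) : ‖Complex.exp (-I * (t : ℂ))‖ = 1 := by
  have : -I * (t : ℂ) = ((-t : ℝ) : ℂ) * I := by push_cast; ring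
  rw [this, Complex.norm_exp_ofReal_mul_I]

lemma FT_integrand_int {n : ℕ} {f : Eu n → ℂ} (hf : Integrable f) (ξ : Eu n) :
    Integrable (fun x => Complex.exp (-Complex.I * (⟪x, ξ⟫ : ℂ)) * f x) := by
  refine hf.bdd_mul (c := 1) ?_ (Filter.Eventually.of_forall fun x => (norm_expnI _).le)
  exact Continuous.aestronglyMeasurable (by fun_prop)

lemma FT_cont {n : ℕ} {f : Eu n → ℂ} (hf : Integrable f) : Continuous (FT f) := by
  unfold FT
  refine continuous_of_dominated (bound := fun x => ‖f x‖)
    (fun ξ => (FT_integrand_int hf ξ).aestronglyMeasurable) ?_ hf.norm ?_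
  · intro ξ; filter_upwards with x
    rw [norm_mul, norm_expnI, one_mul]
  · filter_upwards with x
    fun_prop

lemma BM_integrable {n : ℕ} {M f h : Eu n → ℂ} (hM : Integrable M) (hf : Integrable f)
    (hh : Integrable h) : Integrable (fun ξ => M ξ * FT f ξ * FT h (-ξ)) := by
  have h1 : Integrable (fun ξ => M ξ * FT f ξ) :=
    hM.mul_bdd (c := ∫ x, ‖f x‖) (FT_cont hf).aestronglyMeasurable
      (Filter.Eventually.of_forall fun ξ => FT_norm_le f ξ)
  exact h1.mul_bdd (c := ∫ x, ‖h x‖) ((FT_cont hh).comp continuous_neg).aestronglyMeasurable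
      (Filter.Eventually.of_forall fun ξ => FT_norm_le h _)

/-- step functions -/
def stepF {n : ℕ} {ι : Type*} [Fintype ι] (S : ι → Set (Eu n)) (c : ι → ℂ) (x : Eu n) : ℂ :=
  ∑ i, (S i).indicator (fun _ => c i) x

lemma stepF_good {n : ℕ} {ι : Type*} [Fintype ι] {S : ι → Set (Eu n)} (hS : ∀ i, MeasurableSet (S i))
    (hv : ∀ i, volume (S i) ≠ ⊤) (c : ι → ℂ) : Good (stepF S c) := by
  unfold stepF
  refine ⟨?_, ?_, ∑ i, ‖c i‖, fun x => ?_⟩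
  · exact Finset.measurable_fun_sum _ fun i _ => measurable_const.indicator (hS i)
  · refine integrable_finsetSum _ fun i _ => ?_
    exact (integrable_indicator_iff (hS i)).2 (integrableOn_const (hv i))
  · refine (norm_sum_le _ _).trans (Finset.sum_le_sum fun i _ => ?_)
    exact norm_indicator_le_norm_self (fun _ => c i) x

lemma stepF_nrm {n : ℕ} {ι : Type*} [Fintype ι] {S : ι → Set (Eu n)} (hS : ∀ i, MeasurableSet (S i))
    (hv : ∀ i, volume (S i) ≠ ⊤) (hd : Pairwise (Function.onFun Disjoint S)) (c : ι → ℂ)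
    {p : ℝ} (hp : 0 < p) :
    nrm p (stepF S c) = (∑ i, ‖c i‖ ^ p * volume.real (S i)) ^ (1 / p) := by
  classical
  unfold nrm
  congr 1
  have key : ∀ x, ‖stepF S c x‖ ^ p = ∑ i, (S i).indicator (fun _ => ‖c i‖ ^ p) x := by
    intro x
    unfold stepF
    by_cases hx : ∃ k, x ∈ S k
    · obtain ⟨k, hk⟩ := hx
      have hn : ∀ i, i ≠ k → x ∉ S i := fun i hi hxi => (hd hi).le_bot ⟨hxi, hk⟩
      rw [Finset.sum_eq_single k (fun i _ hi => by simp [hn i hi]) (by simp),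
        Finset.sum_eq_single k (fun i _ hi => by simp [hn i hi]) (by simp)]
      simp [hk]
    · push Not at hx
      rw [Finset.sum_eq_zero (fun i _ => by simp [hx i]),
        Finset.sum_eq_zero (fun i _ => by simp [hx i])]
      simp [Real.zero_rpow hp.ne']
  simp_rw [key]
  rw [integral_finsetSum]
  · refine Finset.sum_congr rfl fun i _ => ?_
    rw [integral_indicator_const _ (hS i), smul_eq_mul, mul_comm]
  · intro i _
    exact (integrable_indicator_iff (hS i)).2 (integrableOn_const (hv i))

lemma stepF_FT {n : ℕ} {ι : Type*} [Fintype ι] {S : ι → Set (Eu n)} (hS : ∀ i, MeasurableSet (S i))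
    (hv : ∀ i, volume (S i) ≠ ⊤) (c : ι → ℂ) (ξ : Eu n) :
    FT (stepF S c) ξ = ∑ i, c i * FT ((S i).indicator (fun _ => 1)) ξ := by
  unfold FT stepF
  have : ∀ i x, (S i).indicator (fun _ => c i) x = c i * (S i).indicator (fun _ => (1:ℂ)) x := by
    intro i x; by_cases h : x ∈ S i <;> simp [h]
  simp_rw [this, Finset.mul_sum]
  rw [integral_finsetSum]
  · refine Finset.sum_congr rfl fun i _ => ?_
    rw [← integral_const_mul]; congr 1; ext x; ring
  · intro i _
    refine FT_integrand_int ?_ ξ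
    exact ((integrable_indicator_iff (hS i)).2 (integrableOn_const (hv i))).const_mul _

lemma stepF_BM {n : ℕ} {ι κ : Type*} [Fintype ι] [Fintype κ] {S : ι → Set (Eu n)}
    {T : κ → Set (Eu n)} {M : Eu n → ℂ} (hM : Integrable M)
    (hS : ∀ i, MeasurableSet (S i)) (hv : ∀ i, volume (S i) ≠ ⊤)
    (hT : ∀ i, MeasurableSet (T i)) (hw : ∀ i, volume (T i) ≠ ⊤) (c : ι → ℂ) (d : κ → ℂ) :
    BM M (stepF S c) (stepF T d) =
      ∑ i, ∑ j, BM M ((S i).indicator fun _ => 1) ((T j).indicator fun _ => 1) * c i * d j := by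
  unfold BM
  simp_rw [stepF_FT hS hv, stepF_FT hT hw, Finset.mul_sum, Finset.sum_mul]
  have hintg : ∀ i j, Integrable (fun ξ => M ξ * FT ((S i).indicator fun _ => 1) ξ *
      FT ((T j).indicator fun _ => 1) (-ξ)) := fun i j =>
    BM_integrable hM ((integrable_indicator_iff (hS i)).2 (integrableOn_const (hv i)))
      ((integrable_indicator_iff (hT j)).2 (integrableOn_const (hw j)))
  have e : ∀ i j ξ, M ξ * (c i * FT ((S i).indicator fun _ => 1) ξ) *
      (d j * FT ((T j).indicator fun _ => 1) (-ξ)) =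
      (M ξ * FT ((S i).indicator fun _ => 1) ξ * FT ((T j).indicator fun _ => 1) (-ξ)) *
        (c i * d j) := by intros; ring
  simp_rw [e]
  rw [integral_finsetSum _ fun j _ => integrable_finsetSum _ fun i _ => (hintg i j).mul_const _,
    Finset.sum_comm]
  refine Finset.sum_congr rfl fun j _ => ?_
  rw [integral_finsetSum _ fun i _ => (hintg _ _).mul_const _]
  refine Finset.sum_congr rfl fun i _ => ?_
  rw [integral_mul_const]; ring

lemma simple_eq_step {n : ℕ} (s : SimpleFunc (Eu n) ℂ) (hs : Integrable s) :
    ∃ (ι : Type) (_ : Fintype ι) (S : ι → Set (Eu n)) (c : ι → ℂ),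
      (∀ i, MeasurableSet (S i)) ∧ (∀ i, volume (S i) ≠ ⊤) ∧
      Pairwise (Function.onFun Disjoint S) ∧ (⇑s = stepF S c) := by
  classical
  refine ⟨↥(s.range.filter (· ≠ 0)), inferInstance, fun c => s ⁻¹' {c.1}, fun c => c.1,
    fun i => s.measurableSet_preimage _, fun i => ?_, ?_, ?_⟩
  · have := (SimpleFunc.integrable_iff.1 hs) i.1 (Finset.mem_filter.1 i.2).2
    exact this.ne
  · intro i j hij
    refine Set.disjoint_left.2 fun x hx hy => hij (Subtype.ext ?_)
    simp at hx hy
    rw [← hx, ← hy]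
  · funext x
    unfold stepF
    by_cases hx : s x = 0
    · rw [hx, Finset.sum_eq_zero]
      intro i _
      have : s x ≠ i.1 := by rw [hx]; exact (Finset.mem_filter.1 i.2).2.symm
      simp [this]
    · rw [Finset.sum_eq_single ⟨s x, Finset.mem_filter.2 ⟨s.mem_range_self x, hx⟩⟩]
      · simp
      · intro i _ hi
        have : s x ≠ i.1 := fun h => hi (Subtype.ext h.symm)
        simp [this]
      · simp

lemma Good.approx {n : ℕ} {f : Eu n → ℂ} (hf : Good f) :
    ∃ F : ℕ → SimpleFunc (Eu n) ℂ, (∀ j x, ‖F j x‖ ≤ 2 * ‖f x‖) ∧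
      (∀ x, Filter.Tendsto (fun j => F j x) Filter.atTop (nhds (f x))) := by
  refine ⟨SimpleFunc.approxOn f hf.meas Set.univ 0 (Set.mem_univ _), fun j x => ?_, fun x => ?_⟩
  · have := SimpleFunc.norm_approxOn_zero_le hf.meas (Set.mem_univ (0:ℂ)) x j
    linarith
  · exact SimpleFunc.tendsto_approxOn hf.meas _ (by simp)

lemma simple_int_of_le {n : ℕ} {f : Eu n → ℂ} (hf : Good f) (s : SimpleFunc (Eu n) ℂ)
    (h : ∀ x, ‖s x‖ ≤ 2 * ‖f x‖) : Integrable s :=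
  Integrable.mono' (hf.int.norm.const_mul 2) s.aestronglyMeasurable
    (Filter.Eventually.of_forall h)

lemma nrm_tendsto {n : ℕ} {f : Eu n → ℂ} (hf : Good f) {F : ℕ → SimpleFunc (Eu n) ℂ}
    (h1 : ∀ j x, ‖F j x‖ ≤ 2 * ‖f x‖)
    (h2 : ∀ x, Filter.Tendsto (fun j => F j x) Filter.atTop (nhds (f x))) {p : ℝ} (hp : 1 ≤ p) :
    Filter.Tendsto (fun j => nrm p (F j)) Filter.atTop (nhds (nrm p f)) := by
  unfold nrm
  refine Filter.Tendsto.rpow_const ?_ (Or.inr (by positivity))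
  refine tendsto_integral_of_dominated_convergence (fun x => 2 ^ p * ‖f x‖ ^ p) ?_
    ((hf.rpow_int hp).const_mul _) ?_ ?_
  · intro j; exact ((F j).measurable.norm.pow_const p).aestronglyMeasurable
  · intro j; filter_upwards with x
    rw [Real.norm_of_nonneg (by positivity), ← Real.mul_rpow (by norm_num) (norm_nonneg _)]
    exact Real.rpow_le_rpow (norm_nonneg _) (h1 j x) (by linarith)
  · filter_upwards with x
    exact ((h2 x).norm).rpow_const (Or.inr (by linarith))

lemma FT_tendsto {n : ℕ} {f : Eu n → ℂ} (hf : Good f) {F : ℕ → SimpleFunc (Eu n) ℂ}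
    (h1 : ∀ j x, ‖F j x‖ ≤ 2 * ‖f x‖)
    (h2 : ∀ x, Filter.Tendsto (fun j => F j x) Filter.atTop (nhds (f x))) (ξ : Eu n) :
    Filter.Tendsto (fun j => FT (F j) ξ) Filter.atTop (nhds (FT f ξ)) := by
  unfold FT
  refine tendsto_integral_of_dominated_convergence (fun x => 2 * ‖f x‖) ?_
    (hf.int.norm.const_mul _) ?_ ?_
  · intro j
    exact (FT_integrand_int (simple_int_of_le hf _ (h1 j)) ξ).aestronglyMeasurable
  · intro j; filter_upwards with x
    rw [norm_mul, norm_expnI, one_mul]; exact h1 j x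
  · filter_upwards with x
    exact (h2 x).const_mul _

lemma BM_tendsto {n : ℕ} {M f h : Eu n → ℂ} (hM : Integrable M) (hf : Good f) (hh : Good h)
    {F H : ℕ → SimpleFunc (Eu n) ℂ}
    (h1 : ∀ j x, ‖F j x‖ ≤ 2 * ‖f x‖)
    (h2 : ∀ x, Filter.Tendsto (fun j => F j x) Filter.atTop (nhds (f x)))
    (h3 : ∀ j x, ‖H j x‖ ≤ 2 * ‖h x‖)
    (h4 : ∀ x, Filter.Tendsto (fun j => H j x) Filter.atTop (nhds (h x))) :
    Filter.Tendsto (fun j => BM M (F j) (H j)) Filter.atTop (nhds (BM M f h)) := by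
  have hle : ∀ {g : Eu n → ℂ} (hg : Good g) (s : SimpleFunc (Eu n) ℂ),
      (∀ x, ‖s x‖ ≤ 2 * ‖g x‖) → ∀ ξ, ‖FT s ξ‖ ≤ 2 * ∫ x, ‖g x‖ := by
    intro g hg s hs ξ
    refine (FT_norm_le _ _).trans ?_
    rw [← integral_const_mul]
    exact integral_mono (simple_int_of_le hg s hs).norm (hg.int.norm.const_mul 2) hs
  unfold BM
  refine tendsto_integral_of_dominated_convergence
    (fun ξ => ‖M ξ‖ * (2 * ∫ x, ‖f x‖) * (2 * ∫ x, ‖h x‖)) ?_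
    ((hM.norm.mul_const _).mul_const _) ?_ ?_
  · intro j
    exact (BM_integrable hM (simple_int_of_le hf _ (h1 j))
      (simple_int_of_le hh _ (h3 j))).aestronglyMeasurable
  · intro j; filter_upwards with ξ
    rw [norm_mul, norm_mul]
    gcongr
    · exact hle hf _ (h1 j) ξ
    · exact hle hh _ (h3 j) _
  · filter_upwards with ξ
    exact ((FT_tendsto hf h1 h2 ξ).const_mul _).mul (FT_tendsto hh h3 h4 _)

/-- Riesz–Thorin for the bilinear form `BM M`. -/
theorem rt_BM {n : ℕ} {M : Eu n → ℂ} (hM : Integrable M)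
    (p0 p1 q0 q1 θ A0 A1 p q : ℝ) (hp0 : 1 ≤ p0) (hp1 : 1 ≤ p1) (hq0 : 1 ≤ q0) (hq1 : 1 ≤ q1)
    (hθ0 : 0 < θ) (hθ1 : θ < 1) (hA0 : 0 ≤ A0) (hA1 : 0 ≤ A1) (hp : 1 ≤ p) (hq : 1 ≤ q)
    (hpe : 1 / p = (1 - θ) * (1 / p0) + θ * (1 / p1))
    (hqe : 1 / q = (1 - θ) * (1 / q0) + θ * (1 / q1))
    (h0 : ∀ f h, Good f → Good h → ‖BM M f h‖ ≤ A0 * nrm p0 f * nrm q0 h)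
    (h1 : ∀ f h, Good f → Good h → ‖BM M f h‖ ≤ A1 * nrm p1 f * nrm q1 h)
    (f h : Eu n → ℂ) (hf : Good f) (hh : Good h) :
    ‖BM M f h‖ ≤ A0 ^ (1 - θ) * A1 ^ θ * nrm p f * nrm q h := by
  obtain ⟨F, F1, F2⟩ := hf.approx
  obtain ⟨H, H1, H2⟩ := hh.approx
  refine le_of_tendsto_of_tendsto (BM_tendsto hM hf hh F1 F2 H1 H2).norm
    (((nrm_tendsto hf F1 F2 hp).const_mul _).mul (nrm_tendsto hh H1 H2 hq))
    (Filter.Eventually.of_forall fun j => ?_)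
  obtain ⟨ι, _, S, c, hS, hSv, hSd, hSe⟩ := simple_eq_step (F j) (simple_int_of_le hf _ (F1 j))
  obtain ⟨κ, _, T, d, hT, hTv, hTd, hTe⟩ := simple_eq_step (H j) (simple_int_of_le hh _ (H1 j))
  simp only [hSe, hTe]
  rw [stepF_BM hM hS hSv hT hTv, stepF_nrm hS hSv hSd c (by linarith),
    stepF_nrm hT hTv hTd d (by linarith)]
  have key := rt_finite (fun i j => BM M ((S i).indicator fun _ => 1) ((T j).indicator fun _ => 1))
    (fun i => volume.real (S i)) (fun j => volume.real (T j)) (fun i => by positivity)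
    (fun i => by positivity) (1 / p0) (1 / p1) (1 / q0) (1 / q1) θ A0 A1 (by positivity)
    (by positivity) (by positivity) (by positivity) hθ0 hθ1 hA0 hA1
    (fun c d => by
      have := h0 _ _ (stepF_good hS hSv c) (stepF_good hT hTv d)
      rw [stepF_BM hM hS hSv hT hTv, stepF_nrm hS hSv hSd c (by linarith),
        stepF_nrm hT hTv hTd d (by linarith)] at this
      simpa using this)
    (fun c d => by
      have := h1 _ _ (stepF_good hS hSv c) (stepF_good hT hTv d)
      rw [stepF_BM hM hS hSv hT hTv, stepF_nrm hS hSv hSd c (by linarith),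
        stepF_nrm hT hTv hTd d (by linarith)] at this
      simpa using this)
    (1 / p) (1 / q) hpe hqe c d
  simpa using key

/-- The (unnormalised) kernel of a multiplier. -/
def Kr {n : ℕ} (M : Eu n → ℂ) (u : Eu n) : ℂ := ∫ ξ, Complex.exp (I * (⟪u, ξ⟫ : ℂ)) * M ξ

def KB {n : ℕ} (K f h : Eu n → ℂ) : ℂ :=
  ∫ z : Eu n × Eu n, K (z.2 - z.1) * f z.1 * h z.2

lemma Kr_integrand_int {n : ℕ} {M : Eu n → ℂ} (hM : Integrable M) (u : Eu n) :
    Integrable (fun ξ => Complex.exp (I * (⟪u, ξ⟫ : ℂ)) * M ξ) := by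
  refine hM.bdd_mul (c := 1) ?_ (Filter.Eventually.of_forall fun x => (norm_expI _).le)
  exact Continuous.aestronglyMeasurable (by fun_prop)

lemma Kr_norm_le {n : ℕ} (M : Eu n → ℂ) (u : Eu n) : ‖Kr M u‖ ≤ ∫ ξ, ‖M ξ‖ := by
  unfold Kr
  refine (norm_integral_le_integral_norm _).trans (le_of_eq ?_)
  congr 1; ext x
  rw [norm_mul, norm_expI, one_mul]

lemma Kr_cont {n : ℕ} {M : Eu n → ℂ} (hM : Integrable M) : Continuous (Kr M) := by
  unfold Kr
  refine continuous_of_dominated (bound := fun x => ‖M x‖)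
    (fun ξ => (Kr_integrand_int hM ξ).aestronglyMeasurable) ?_ hM.norm ?_
  · intro ξ; filter_upwards with x
    rw [norm_mul, norm_expI, one_mul]
  · filter_upwards with x
    fun_prop

theorem BM_kernel {n : ℕ} {M f h : Eu n → ℂ} (hM : Integrable M) (hf : Integrable f)
    (hh : Integrable h) : BM M f h = KB (Kr M) f h := by
  unfold BM KB Kr
  have e1 : ∀ ξ, M ξ * FT f ξ * FT h (-ξ) =
      ∫ z : Eu n × Eu n, Complex.exp (I * (⟪z.2 - z.1, ξ⟫ : ℂ)) * M ξ * (f z.1 * h z.2) := by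
    intro ξ
    unfold FT
    rw [mul_assoc, ← integral_prod_mul, ← integral_const_mul]
    congr 1; ext z
    rw [inner_sub_left, inner_neg_right]
    have : Complex.exp (I * (((⟪z.2, ξ⟫ - ⟪z.1, ξ⟫ : ℝ)) : ℂ)) =
        Complex.exp (-I * (⟪z.1, ξ⟫ : ℂ)) * Complex.exp (-I * ((-⟪z.2, ξ⟫ : ℝ) : ℂ)) := by
      rw [← Complex.exp_add]; congr 1; push_cast; ring
    rw [this]; ring
  simp_rw [e1]
  rw [integral_integral_swap]
  · congr 1; ext z
    rw [← integral_mul_const, ← integral_mul_const]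
    congr 1; ext ξ; ring
  · have h1 : Integrable (fun w : Eu n × (Eu n × Eu n) => M w.1 * (f w.2.1 * h w.2.2))
        (volume.prod volume) := hM.mul_prod (hf.mul_prod hh)
    have h2 := h1.bdd_mul (c := 1)
      (f := fun w : Eu n × (Eu n × Eu n) => Complex.exp (I * (⟪w.2.2 - w.2.1, w.1⟫ : ℂ)))
      (Continuous.aestronglyMeasurable (by fun_prop))
      (Filter.Eventually.of_forall fun x => (norm_expI _).le)
    refine h2.congr (Filter.Eventually.of_forall fun w => ?_)
    simp only [Function.uncurry]; ring

lemma KB_integrable {n : ℕ} {K f h : Eu n → ℂ} (hK : Measurable K) {C : ℝ} (hC : ∀ u, ‖K u‖ ≤ C)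
    (hf : Integrable f) (hh : Integrable h) :
    Integrable (fun z : Eu n × Eu n => K (z.2 - z.1) * f z.1 * h z.2) := by
  have h1 : Integrable (fun z : Eu n × Eu n => f z.1 * h z.2) := hf.mul_prod hh
  have h2 := h1.bdd_mul (c := C) (f := fun z : Eu n × Eu n => K (z.2 - z.1))
    (hK.comp (measurable_snd.sub measurable_fst)).aestronglyMeasurable
    (Filter.Eventually.of_forall fun x => hC _)
  refine h2.congr (Filter.Eventually.of_forall fun w => ?_)
  simp only; ring

/-- extended norm -/
def en {n : ℕ} (p : ℝ) (f : Eu n → ℂ) : ℝ≥0∞ := (∫⁻ x, ‖f x‖ₑ ^ p) ^ (1 / p)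

lemma lint_eq {n : ℕ} {f : Eu n → ℂ} (hf : Good f) {p : ℝ} (hp : 1 ≤ p) :
    ∫⁻ x, ‖f x‖ₑ ^ p = ENNReal.ofReal (∫ x, ‖f x‖ ^ p) := by
  rw [ofReal_integral_eq_lintegral_ofReal (hf.rpow_int hp)
    (Filter.Eventually.of_forall fun x => by positivity)]
  congr 1; ext x
  rw [← ENNReal.ofReal_rpow_of_nonneg (norm_nonneg _) (by linarith), ofReal_norm]

lemma en_eq {n : ℕ} {f : Eu n → ℂ} (hf : Good f) {p : ℝ} (hp : 1 ≤ p) :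
    en p f = ENNReal.ofReal (nrm p f) := by
  unfold en nrm
  rw [lint_eq hf hp, ENNReal.ofReal_rpow_of_nonneg (by positivity) (by positivity)]

lemma holder_en {n : ℕ} {f h : Eu n → ℂ} (hf : Measurable f) (hh : Measurable h) {p q : ℝ}
    (hpq : p.HolderConjugate q) : ∫⁻ x, ‖f x‖ₑ * ‖h x‖ₑ ≤ en p f * en q h :=
  ENNReal.lintegral_mul_le_Lp_mul_Lq volume hpq hf.enorm.aemeasurable hh.enorm.aemeasurable

lemma young_en {n : ℕ} {K f h : Eu n → ℂ} (hK : Measurable K) (hf : Measurable f)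
    (hh : Measurable h) {p q : ℝ} (hpq : p.HolderConjugate q) :
    ∫⁻ z : Eu n × Eu n, ‖K (z.2 - z.1)‖ₑ * ‖f z.1‖ₑ * ‖h z.2‖ₑ ≤
      (∫⁻ u, ‖K u‖ₑ) * (en p f * en q h) := by
  have hm : Measurable (fun z : Eu n × Eu n => ‖K (z.2 - z.1)‖ₑ * ‖f z.1‖ₑ * ‖h z.2‖ₑ) := by
    fun_prop
  have e1 : ∫⁻ z : Eu n × Eu n, ‖K (z.2 - z.1)‖ₑ * ‖f z.1‖ₑ * ‖h z.2‖ₑ =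
      ∫⁻ x, ∫⁻ y, ‖K (x - y)‖ₑ * ‖f y‖ₑ * ‖h x‖ₑ := by
    change ∫⁻ z : Eu n × Eu n, _ ∂(volume.prod volume) = _
    rw [lintegral_prod_symm _ hm.aemeasurable]
  have e2 : ∀ x, ∫⁻ y, ‖K (x - y)‖ₑ * ‖f y‖ₑ * ‖h x‖ₑ =
      ∫⁻ u, ‖K u‖ₑ * ‖f (x - u)‖ₑ * ‖h x‖ₑ := by
    intro x
    rw [← lintegral_sub_left_eq_self _ x]
    simp
  rw [e1]
  simp_rw [e2]
  rw [lintegral_lintegral_swap]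
  · have e3 : ∀ u, ∫⁻ x, ‖K u‖ₑ * ‖f (x - u)‖ₑ * ‖h x‖ₑ ≤ ‖K u‖ₑ * (en p f * en q h) := by
      intro u
      have hfu : Measurable (fun x => f (x - u)) := hf.comp (measurable_id.sub_const u)
      simp_rw [mul_assoc]
      rw [lintegral_const_mul _ (by fun_prop)]
      gcongr
      refine (holder_en hfu hh hpq).trans (le_of_eq ?_)
      congr 1
      unfold en
      rw [lintegral_sub_right_eq_self (fun x => ‖f x‖ₑ ^ p) u]
    refine (lintegral_mono e3).trans (le_of_eq ?_)
    rw [lintegral_mul_const _ hK.enorm]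
  · refine Measurable.aemeasurable ?_
    change Measurable fun z : Eu n × Eu n => ‖K z.2‖ₑ * ‖f (z.1 - z.2)‖ₑ * ‖h z.1‖ₑ
    fun_prop

lemma KB_young {n : ℕ} {K f h : Eu n → ℂ} (hK : Measurable K) (hKi : Integrable K) (hf : Good f)
    (hh : Good h) {p q : ℝ} (hpq : p.HolderConjugate q) :
    ‖KB K f h‖ ≤ (∫ u, ‖K u‖) * nrm p f * nrm q h := by
  have h1 : ‖KB K f h‖ₑ ≤ (∫⁻ u, ‖K u‖ₑ) * (en p f * en q h) := by
    refine (enorm_integral_le_lintegral_enorm _).trans (le_trans (le_of_eq ?_)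
      (young_en hK hf.meas hh.meas hpq))
    congr 1; ext z; rw [enorm_mul, enorm_mul]
  rw [en_eq hf hpq.lt.le, en_eq hh hpq.symm.lt.le, ← ofReal_integral_norm_eq_lintegral_enorm hKi,
    ← ENNReal.ofReal_mul (nrm_nonneg _ _), ← ENNReal.ofReal_mul (by positivity), ← ofReal_norm] at h1
  rw [mul_assoc]
  exact (ENNReal.ofReal_le_ofReal_iff (mul_nonneg (by positivity) (mul_nonneg (nrm_nonneg _ _)
    (nrm_nonneg _ _)))).1 h1

lemma FT_star {n : ℕ} (f : Eu n → ℂ) (ξ : Eu n) :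
    FT (fun x => (starRingEnd ℂ) (f x)) (-ξ) = (starRingEnd ℂ) (FT f ξ) := by
  unfold FT
  rw [← integral_conj]
  congr 1; ext x
  rw [map_mul, ← Complex.exp_conj]
  congr 2
  simp

lemma BM_star {n : ℕ} (M f : Eu n → ℂ) :
    BM M f (fun x => (starRingEnd ℂ) (f x)) = ∫ ξ, M ξ * ((‖FT f ξ‖ ^ 2 : ℝ) : ℂ) := by
  unfold BM
  congr 1; ext ξ
  rw [FT_star, mul_assoc, Complex.mul_conj, Complex.normSq_eq_norm_sq]

lemma nrm_star {n : ℕ} (p : ℝ) (f : Eu n → ℂ) :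
    nrm p (fun x => (starRingEnd ℂ) (f x)) = nrm p f := by
  unfold nrm; simp

lemma gauss_bessel {n : ℕ} {f : Eu n → ℂ} (hf : Good f) {b : ℝ} (hb : 0 < b) :
    ∫ ξ, Real.exp (-b * ‖ξ‖ ^ 2) * ‖FT f ξ‖ ^ 2 ≤ (2 * Real.pi) ^ n * nrm 2 f ^ 2 := by
  set M : Eu n → ℂ := fun ξ => Complex.exp (-b * ‖ξ‖ ^ 2) with hMdef
  have hbre : 0 < (b : ℂ).re := by simpa using hb
  have hMi : Integrable M := by
    have := GaussianFourier.integrable_cexp_neg_mul_sq_norm_add hbre 0 (0 : Eu n)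
    simpa [hMdef] using this
  have hMr : ∀ ξ, M ξ = ((Real.exp (-b * ‖ξ‖ ^ 2) : ℝ) : ℂ) := by
    intro ξ; simp [hMdef]
  have hK : ∀ u, Kr M u = (((Real.pi / b) ^ ((n : ℝ) / 2) *
      Real.exp (-(1 / (4 * b)) * ‖u‖ ^ 2) : ℝ) : ℂ) := by
    intro u
    have := GaussianFourier.integral_cexp_neg_mul_sq_norm_add hbre I u
    unfold Kr
    have e : ∀ ξ, Complex.exp (I * (⟪u, ξ⟫ : ℂ)) * M ξ =
        Complex.exp (-b * ‖ξ‖ ^ 2 + I * (⟪u, ξ⟫ : ℂ)) := by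
      intro ξ; simp only [hMdef]; rw [← Complex.exp_add, add_comm]
    simp_rw [e]
    rw [this]
    rw [finrank_euclideanSpace, Fintype.card_fin]
    push_cast
    rw [Complex.ofReal_cpow (by positivity)]
    push_cast
    congr 2
    rw [I_sq]
    have : (b : ℂ) ≠ 0 := by exact_mod_cast hb.ne'
    field_simp
  have hKn : ∀ u, ‖Kr M u‖ = (Real.pi / b) ^ ((n : ℝ) / 2) *
      Real.exp (-(1 / (4 * b)) * ‖u‖ ^ 2) := by
    intro u; rw [hK, Complex.norm_real, Real.norm_of_nonneg (by positivity)]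
  have hc : 0 < 1 / (4 * b) := by positivity
  have hgi : Integrable (fun u : Eu n => Real.exp (-(1 / (4 * b)) * ‖u‖ ^ 2)) := by
    have := (GaussianFourier.integrable_cexp_neg_mul_sq_norm_add (b := ((1 / (4 * b) : ℝ) : ℂ))
      (by rw [Complex.ofReal_re]; exact hc) 0 (0 : Eu n)).norm
    refine this.congr (Filter.Eventually.of_forall fun u => ?_)
    simp only [Complex.norm_exp]
    congr 1
    have : -(((1 / (4 * b) : ℝ)) : ℂ) * (‖u‖ : ℂ) ^ 2 + 0 * ((⟪(0 : Eu n), u⟫ : ℝ) : ℂ) =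
      ((-(1 / (4 * b)) * ‖u‖ ^ 2 : ℝ) : ℂ) := by push_cast; ring
    rw [this, Complex.ofReal_re]
  have hKi : Integrable (Kr M) := by
    refine (integrable_norm_iff (Kr_cont hMi).aestronglyMeasurable).1 ?_
    simp_rw [hKn]
    exact hgi.const_mul _
  have hKint : ∫ u, ‖Kr M u‖ = (2 * Real.pi) ^ n := by
    simp_rw [hKn]
    rw [integral_const_mul, GaussianFourier.integral_rexp_neg_mul_sq_norm hc,
      finrank_euclideanSpace, Fintype.card_fin,
      ← Real.mul_rpow (by positivity) (by positivity)]
    have : Real.pi / b * (Real.pi / (1 / (4 * b))) = (2 * Real.pi) ^ (2 : ℝ) := by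
      rw [Real.rpow_two]
      field_simp; ring
    rw [this, ← Real.rpow_mul (by positivity)]
    rw [← Real.rpow_natCast]; congr 1; ring
  have h22 : (2 : ℝ).HolderConjugate 2 := Real.HolderConjugate.two_two
  have key := KB_young (Kr_cont hMi).measurable hKi hf hf.star h22
  rw [← BM_kernel hMi hf.int hf.star.int, BM_star, nrm_star, hKint] at key
  have e : ∫ ξ, M ξ * ((‖FT f ξ‖ ^ 2 : ℝ) : ℂ) =
      ((∫ ξ, Real.exp (-b * ‖ξ‖ ^ 2) * ‖FT f ξ‖ ^ 2 : ℝ) : ℂ) := by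
    rw [← integral_complex_ofReal]
    congr 1; ext ξ; rw [hMr]; push_cast; ring
  rw [e, Complex.norm_real] at key
  refine (Real.le_norm_self _).trans (key.trans (le_of_eq ?_))
  ring

lemma bessel_lint {n : ℕ} {f : Eu n → ℂ} (hf : Good f) :
    ∫⁻ ξ, ENNReal.ofReal (‖FT f ξ‖ ^ 2) ≤ ENNReal.ofReal ((2 * Real.pi) ^ n * nrm 2 f ^ 2) := by
  have hFc := FT_cont hf.int
  let g : ℕ → Eu n → ℝ≥0∞ := fun j ξ =>
    ENNReal.ofReal (Real.exp (-(1 / ((j : ℝ) + 1)) * ‖ξ‖ ^ 2) * ‖FT f ξ‖ ^ 2)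
  have hlim : ∀ ξ, Filter.Tendsto (fun j => g j ξ) Filter.atTop
      (nhds (ENNReal.ofReal (‖FT f ξ‖ ^ 2))) := by
    intro ξ
    refine ENNReal.tendsto_ofReal ?_
    have h1 : Filter.Tendsto (fun j : ℕ => -(1 / ((j : ℝ) + 1)) * ‖ξ‖ ^ 2) Filter.atTop
        (nhds (-0 * ‖ξ‖ ^ 2)) :=
      (tendsto_one_div_add_atTop_nhds_zero_nat.neg).mul_const _
    have h2 := ((Real.continuous_exp.tendsto _).comp h1).mul_const (‖FT f ξ‖ ^ 2)
    simpa using h2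
  have hm : ∀ j, Measurable (g j) := by
    intro j
    have : Measurable (fun ξ => ‖FT f ξ‖) := hFc.norm.measurable
    refine ENNReal.measurable_ofReal.comp ?_
    exact (by fun_prop : Measurable fun ξ : Eu n =>
      Real.exp (-(1 / ((j : ℝ) + 1)) * ‖ξ‖ ^ 2)).mul (this.pow_const 2)
  calc ∫⁻ ξ, ENNReal.ofReal (‖FT f ξ‖ ^ 2) = ∫⁻ ξ, Filter.liminf (fun j => g j ξ) Filter.atTop := by
        congr 1; ext ξ; exact (hlim ξ).liminf_eq.symm
    _ ≤ Filter.liminf (fun j => ∫⁻ ξ, g j ξ) Filter.atTop := lintegral_liminf_le hm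
    _ ≤ ENNReal.ofReal ((2 * Real.pi) ^ n * nrm 2 f ^ 2) := by
        refine Filter.liminf_le_of_le (by isBoundedDefault) ?_
        intro c hc
        obtain ⟨j, hj⟩ := hc.exists
        refine hj.trans ?_
        have hb : (0:ℝ) < 1 / ((j : ℝ) + 1) := by positivity
        rw [← ofReal_integral_eq_lintegral_ofReal]
        · exact ENNReal.ofReal_le_ofReal (gauss_bessel hf hb)
        · have h1 : Integrable (fun u : Eu n => Real.exp (-(1 / ((j : ℝ) + 1)) * ‖u‖ ^ 2)) := by
            have := (GaussianFourier.integrable_cexp_neg_mul_sq_norm_add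
              (b := ((1 / ((j : ℝ) + 1) : ℝ) : ℂ))
              (by rw [Complex.ofReal_re]; exact hb) 0 (0 : Eu n)).norm
            refine this.congr (Filter.Eventually.of_forall fun u => ?_)
            simp only [Complex.norm_exp]
            congr 1
            have : -(((1 / ((j : ℝ) + 1) : ℝ)) : ℂ) * (‖u‖ : ℂ) ^ 2 +
              0 * ((⟪(0 : Eu n), u⟫ : ℝ) : ℂ) =
              ((-(1 / ((j : ℝ) + 1)) * ‖u‖ ^ 2 : ℝ) : ℂ) := by push_cast; ring
            rw [this, Complex.ofReal_re]
          refine h1.mul_bdd (c := (∫ x, ‖f x‖) ^ 2)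
            (hFc.norm.pow 2).aestronglyMeasurable (Filter.Eventually.of_forall fun ξ => ?_)
          rw [Real.norm_of_nonneg (by positivity)]
          gcongr
          exact FT_norm_le f ξ
        · exact Filter.Eventually.of_forall fun ξ => by positivity

lemma bessel {n : ℕ} {f : Eu n → ℂ} (hf : Good f) :
    Integrable (fun ξ => ‖FT f ξ‖ ^ 2) ∧
    ∫ ξ, ‖FT f ξ‖ ^ 2 ≤ (2 * Real.pi) ^ n * nrm 2 f ^ 2 := by
  have h1 := bessel_lint hf
  have hm : AEStronglyMeasurable (fun ξ => ‖FT f ξ‖ ^ 2) :=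
    ((FT_cont hf.int).norm.pow 2).aestronglyMeasurable
  constructor
  · refine ⟨hm, ?_⟩
    rw [hasFiniteIntegral_iff_ofReal (Filter.Eventually.of_forall fun ξ => by positivity)]
    exact h1.trans_lt ENNReal.ofReal_lt_top
  · rw [integral_eq_lintegral_of_nonneg_ae (Filter.Eventually.of_forall fun ξ => by positivity) hm]
    exact ENNReal.toReal_le_of_le_ofReal (by positivity) h1

/-- Cauchy–Schwarz for `BM`. -/
lemma BM_cs {n : ℕ} {M f h : Eu n → ℂ} (hf : Good f) (hh : Good h) (hMm : Measurable M)
    {D : ℝ} (hD : 0 ≤ D) (hMi : Integrable (fun ξ => ‖M ξ‖ ^ 2 * ‖FT f ξ‖ ^ 2))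
    (hMD : ∫ ξ, ‖M ξ‖ ^ 2 * ‖FT f ξ‖ ^ 2 ≤ D ^ 2) :
    ‖BM M f h‖ ≤ D * ((2 * Real.pi) ^ ((n : ℝ) / 2) * nrm 2 h) := by
  obtain ⟨hi, hb⟩ := bessel hh
  unfold BM
  refine (norm_integral_le_integral_norm _).trans ?_
  have hneg : ∫ ξ, ‖FT h (-ξ)‖ ^ 2 = ∫ ξ, ‖FT h ξ‖ ^ 2 :=
    integral_neg_eq_self (fun ξ => ‖FT h ξ‖ ^ 2) volume
  have hFf := (FT_cont hf.int).measurable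
  have hFh : Measurable fun ξ => FT h (-ξ) := ((FT_cont hh.int).comp continuous_neg).measurable
  have key := integral_mul_norm_le_Lp_mul_Lq (μ := (volume : Measure (Eu n)))
    (f := fun ξ => M ξ * FT f ξ) (g := fun ξ => FT h (-ξ)) Real.HolderConjugate.two_two
    (by
      rw [show ENNReal.ofReal 2 = 2 by norm_num]
      refine (memLp_two_iff_integrable_sq_norm (hMm.mul hFf).aestronglyMeasurable).2 ?_
      refine hMi.congr (Filter.Eventually.of_forall fun ξ => ?_)
      simp only [Pi.mul_apply, norm_mul]; ring)
    (by
      rw [show ENNReal.ofReal 2 = 2 by norm_num]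
      refine (memLp_two_iff_integrable_sq_norm hFh.aestronglyMeasurable).2 ?_
      exact hi.comp_neg)
  simp only [norm_mul, Real.rpow_two] at key ⊢
  refine key.trans ?_
  have e1 : ∫ ξ, (‖M ξ‖ * ‖FT f ξ‖) ^ 2 ≤ D ^ 2 := by
    simp_rw [mul_pow]; exact hMD
  rw [hneg, ← Real.sqrt_eq_rpow, ← Real.sqrt_eq_rpow]
  gcongr
  · exact (Real.sqrt_le_sqrt e1).trans (by rw [Real.sqrt_sq hD])
  · refine (Real.sqrt_le_sqrt hb).trans (le_of_eq ?_)
    rw [Real.sqrt_mul (by positivity), Real.sqrt_sq (nrm_nonneg _ _)]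
    congr 1
    rw [Real.sqrt_eq_rpow, ← Real.rpow_natCast, ← Real.rpow_mul (by positivity)]
    congr 1; ring

lemma BM_L2 {n : ℕ} {M f h : Eu n → ℂ} (hf : Good f) (hh : Good h) (hMm : Measurable M)
    {S : ℝ} (hS0 : 0 ≤ S) (hS : ∀ ξ, ‖M ξ‖ ≤ S) :
    ‖BM M f h‖ ≤ (S * (2 * Real.pi) ^ n) * nrm 2 f * nrm 2 h := by
  obtain ⟨hi, hb⟩ := bessel hf
  have hle : ∀ ξ, ‖M ξ‖ ^ 2 * ‖FT f ξ‖ ^ 2 ≤ S ^ 2 * ‖FT f ξ‖ ^ 2 := fun ξ => by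
    gcongr; exact hS ξ
  have hMi : Integrable (fun ξ => ‖M ξ‖ ^ 2 * ‖FT f ξ‖ ^ 2) := by
    refine (hi.const_mul (S ^ 2)).mono' ?_ (Filter.Eventually.of_forall fun ξ => ?_)
    · exact ((hMm.norm.pow_const 2).mul
        ((FT_cont hf.int).norm.measurable.pow_const 2)).aestronglyMeasurable
    · rw [Real.norm_of_nonneg (by positivity)]; exact hle ξ
  have h2 : ((2 * Real.pi) ^ ((n : ℝ) / 2)) ^ 2 = (2 * Real.pi) ^ n := by
    rw [← Real.rpow_natCast, ← Real.rpow_mul (by positivity), ← Real.rpow_natCast]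
    congr 1; push_cast; ring
  have := BM_cs (D := S * ((2 * Real.pi) ^ ((n : ℝ) / 2) * nrm 2 f)) hf hh hMm
    (mul_nonneg hS0 (mul_nonneg (by positivity) (nrm_nonneg _ _))) hMi
    (by
      refine (integral_mono hMi (hi.const_mul _) hle).trans ?_
      rw [integral_const_mul, mul_pow, mul_pow, h2]
      gcongr)
  refine this.trans (le_of_eq ?_)
  rw [← h2]; ring

lemma nrm_one {n : ℕ} (f : Eu n → ℂ) : nrm 1 f = ∫ x, ‖f x‖ := by
  unfold nrm; simp

lemma BM_L1 {n : ℕ} {M f h : Eu n → ℂ} (hM : Integrable M) (hf : Good f) (hh : Good h)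
    {S : ℝ} (hS : ∀ u, ‖Kr M u‖ ≤ S) :
    ‖BM M f h‖ ≤ S * nrm 1 f * nrm 1 h := by
  rw [BM_kernel hM hf.int hh.int, nrm_one, nrm_one]
  unfold KB
  refine (norm_integral_le_integral_norm _).trans ?_
  have hi := (KB_integrable (Kr_cont hM).measurable hS hf.int hh.int).norm
  have hj : Integrable (fun z : Eu n × Eu n => S * (‖f z.1‖ * ‖h z.2‖)) :=
    (hf.int.norm.mul_prod hh.int.norm).const_mul S
  refine (integral_mono hi hj fun z => ?_).trans (le_of_eq ?_)
  · simp only [norm_mul, mul_assoc]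
    gcongr
    exact hS _
  · rw [integral_const_mul]
    change S * ∫ z : Eu n × Eu n, ‖f z.1‖ * ‖h z.2‖ ∂(volume.prod volume) = _
    rw [integral_prod_mul (fun x => ‖f x‖) (fun x => ‖h x‖)]; ring

lemma en_ball_meas {n : ℕ} {f : Eu n → ℂ} (hf : Measurable f) (p : ℝ) (R : ℝ) :
    Measurable (fun z : Eu n × Eu n => ‖(Metric.closedBall z.1 R).indicator f z.2‖ₑ ^ p) := by
  have hS : MeasurableSet {z : Eu n × Eu n | z.2 ∈ Metric.closedBall z.1 R} := by
    simp only [Metric.mem_closedBall]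
    exact measurableSet_le (by fun_prop) measurable_const
  have : (fun z : Eu n × Eu n => (Metric.closedBall z.1 R).indicator f z.2) =
      {z : Eu n × Eu n | z.2 ∈ Metric.closedBall z.1 R}.indicator (fun z => f z.2) := by
    ext z
    simp [Set.indicator]
  have h2 : Measurable (fun z : Eu n × Eu n => (Metric.closedBall z.1 R).indicator f z.2) := by
    rw [this]; exact (hf.comp measurable_snd).indicator hS
  exact h2.enorm.pow_const p

lemma en_ball {n : ℕ} {f : Eu n → ℂ} (hf : Measurable f) {p : ℝ} (hp : 0 < p) (R : ℝ) :
    ∫⁻ w, (en p ((Metric.closedBall w R).indicator f)) ^ p =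
      volume (Metric.closedBall (0 : Eu n) R) * (en p f) ^ p := by
  unfold en
  simp_rw [← ENNReal.rpow_mul, one_div, inv_mul_cancel₀ hp.ne', ENNReal.rpow_one]
  rw [lintegral_lintegral_swap]
  · have : ∀ y w : Eu n, ‖(Metric.closedBall w R).indicator f y‖ₑ ^ p =
        (Metric.closedBall y R).indicator (fun _ => ‖f y‖ₑ ^ p) w := by
      intro y w
      by_cases h : y ∈ Metric.closedBall w R
      · rw [Set.indicator_of_mem h, Set.indicator_of_mem (Metric.mem_closedBall_comm.1 h)]
      · rw [Set.indicator_of_notMem h, Set.indicator_of_notMem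
          (fun h' => h (Metric.mem_closedBall_comm.1 h'))]
        simp [hp]
    simp_rw [this]
    simp_rw [lintegral_indicator Metric.isClosed_closedBall.measurableSet]
    simp only [lintegral_const, Measure.restrict_apply MeasurableSet.univ, Set.univ_inter]
    have e : ∀ y : Eu n, volume (Metric.closedBall y R) = volume (Metric.closedBall (0 : Eu n) R) := by
      intro y; exact Measure.addHaar_closedBall_center _ _ _
    simp_rw [e]
    rw [lintegral_mul_const _ (by fun_prop), mul_comm]
  · exact (en_ball_meas hf p R).aemeasurable

lemma en_ball_le {n : ℕ} {f h : Eu n → ℂ} (hf : Measurable f) (hh : Measurable h) {p q : ℝ}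
    (hpq : p.HolderConjugate q) {ρ : ℝ} (hρ : 0 < ρ) :
    ∫⁻ w, en p ((Metric.closedBall w (2 * ρ)).indicator f) *
      en q ((Metric.closedBall w ρ).indicator h) ≤
      2 ^ n * volume (Metric.closedBall (0 : Eu n) ρ) * (en p f * en q h) := by
  have hp := hpq.pos
  have hq := hpq.symm.pos
  have hm : ∀ {g : Eu n → ℂ} (_ : Measurable g) (p R : ℝ),
      Measurable (fun w => en p ((Metric.closedBall w R).indicator g)) := by
    intro g hg p R
    exact (Measurable.lintegral_prod_right' (en_ball_meas hg p R)).pow_const _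
  refine (ENNReal.lintegral_mul_le_Lp_mul_Lq volume hpq (hm hf _ _).aemeasurable
    (hm hh _ _).aemeasurable).trans ?_
  rw [en_ball hf hp, en_ball hh hq]
  rw [ENNReal.mul_rpow_of_nonneg _ _ (by positivity), ENNReal.mul_rpow_of_nonneg _ _ (by positivity)]
  rw [← ENNReal.rpow_mul, ← ENNReal.rpow_mul, mul_one_div_cancel hp.ne', mul_one_div_cancel hq.ne',
    ENNReal.rpow_one, ENNReal.rpow_one]
  have hv : volume (Metric.closedBall (0 : Eu n) (2 * ρ)) =
      2 ^ n * volume (Metric.closedBall (0 : Eu n) ρ) := by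
    rw [Measure.addHaar_closedBall_mul _ _ (by norm_num) hρ.le]
    rw [finrank_euclideanSpace, Fintype.card_fin]
    congr 1
    rw [ENNReal.ofReal_pow (by norm_num)]
    norm_num
  set v := volume (Metric.closedBall (0 : Eu n) ρ) with hvd
  have hv0 : v ≠ 0 := (Metric.measure_closedBall_pos _ _ hρ).ne'
  have hvt : v ≠ ⊤ := measure_closedBall_lt_top.ne
  have h2 : (2 ^ n * v : ℝ≥0∞) ^ (1 / p) * v ^ (1 / q) ≤ 2 ^ n * v := by
    rw [ENNReal.mul_rpow_of_nonneg _ _ (by positivity), mul_assoc, ← ENNReal.rpow_add _ _ hv0 hvt]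
    have : 1 / p + 1 / q = 1 := by simpa [one_div] using hpq.inv_add_inv_eq_one
    rw [this, ENNReal.rpow_one]
    gcongr
    have h1 : (1 : ℝ≥0∞) ≤ 2 ^ n := one_le_pow₀ (by norm_num)
    calc ((2 : ℝ≥0∞) ^ n) ^ (1 / p) ≤ (2 ^ n) ^ (1 : ℝ) :=
          ENNReal.rpow_le_rpow_of_exponent_le h1 (by rw [div_le_one hp]; exact hpq.lt.le)
      _ = 2 ^ n := ENNReal.rpow_one _
  rw [hv]
  calc _ = ((2 ^ n * v : ℝ≥0∞) ^ (1 / p) * v ^ (1 / q)) * (en p f * en q h) := by ring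
    _ ≤ _ := by gcongr

lemma nrm_ball_holder {n : ℕ} {h : Eu n → ℂ} (hh : Good h) {q : ℝ} (hq : 2 ≤ q) (w : Eu n) {ρ : ℝ}
     :
    nrm 2 ((Metric.closedBall w ρ).indicator h) ≤
      (volume (Metric.closedBall (0 : Eu n) ρ)).toReal ^ (1 / 2 - 1 / q) *
        nrm q ((Metric.closedBall w ρ).indicator h) := by
  have hS : MeasurableSet (Metric.closedBall w ρ) := Metric.isClosed_closedBall.measurableSet
  have hg := hh.indicator hS
  set g := (Metric.closedBall w ρ).indicator h with hgd
  have hv : volume (Metric.closedBall w ρ) = volume (Metric.closedBall (0 : Eu n) ρ) :=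
    Measure.addHaar_closedBall_center _ _ _
  have hvt : volume (Metric.closedBall (0 : Eu n) ρ) ≠ ⊤ := measure_closedBall_lt_top.ne
  have key := eLpNorm'_le_eLpNorm'_mul_rpow_measure_univ (μ := volume.restrict (Metric.closedBall w ρ))
    (f := g) (p := 2) (q := q) (by norm_num) hq hg.meas.aestronglyMeasurable
  have e : ∀ s : ℝ, 0 < s → eLpNorm' g s (volume.restrict (Metric.closedBall w ρ)) = en s g := by
    intro s hs
    unfold eLpNorm' en
    congr 1
    rw [← lintegral_indicator hS]
    congr 1; ext x
    by_cases hx : x ∈ Metric.closedBall w ρ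
    · rw [Set.indicator_of_mem hx]
    · rw [Set.indicator_of_notMem hx, hgd, Set.indicator_of_notMem hx]; simp [hs]
  rw [e 2 (by norm_num), e q (by linarith), en_eq hg (by norm_num), en_eq hg (by linarith),
    Measure.restrict_apply_univ, hv] at key
  have hnn : 0 ≤ 1 / 2 - 1 / q := by
    have : 1 / q ≤ 1 / 2 := one_div_le_one_div_of_le (by norm_num) hq
    linarith
  rw [← ENNReal.ofReal_toReal hvt, ENNReal.ofReal_rpow_of_nonneg ENNReal.toReal_nonneg hnn,
    ← ENNReal.ofReal_mul (nrm_nonneg _ _)] at key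
  have := (ENNReal.ofReal_le_ofReal_iff (mul_nonneg (nrm_nonneg _ _) (by positivity))).1 key
  rw [mul_comm]; exact this

lemma KB_ind {n : ℕ} {k f h : Eu n → ℂ} {ρ : ℝ} (hk : ∀ u, ρ < ‖u‖ → k u = 0) (w : Eu n) :
    KB k ((Metric.closedBall w (2 * ρ)).indicator f) ((Metric.closedBall w ρ).indicator h) =
    ∫ z : Eu n × Eu n, (k (z.2 - z.1) * f z.1 * h z.2) *
      (Metric.closedBall (0 : Eu n) ρ).indicator 1 (w - z.2) := by
  unfold KB
  congr 1; ext z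
  by_cases h2 : z.2 ∈ Metric.closedBall w ρ
  · have h2' : w - z.2 ∈ Metric.closedBall (0 : Eu n) ρ := by
      rw [mem_closedBall_zero_iff, ← dist_eq_norm, dist_comm]; exact h2
    rw [Set.indicator_of_mem h2, Set.indicator_of_mem h2']
    by_cases h1 : ρ < ‖z.2 - z.1‖
    · simp [hk _ h1]
    · have : z.1 ∈ Metric.closedBall w (2 * ρ) := by
        rw [Metric.mem_closedBall] at h2 ⊢
        have := dist_triangle z.1 z.2 w
        rw [dist_comm z.1 z.2, dist_eq_norm z.2 z.1] at this
        linarith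
      rw [Set.indicator_of_mem this]; simp
  · have h2' : w - z.2 ∉ Metric.closedBall (0 : Eu n) ρ := by
      rw [mem_closedBall_zero_iff, ← dist_eq_norm, dist_comm]; exact h2
    rw [Set.indicator_of_notMem h2, Set.indicator_of_notMem h2']; simp

lemma KB_average {n : ℕ} {k f h : Eu n → ℂ} (hkm : Measurable k) {C : ℝ} (hC : ∀ u, ‖k u‖ ≤ C)
    (hf : Good f) (hh : Good h) {ρ : ℝ} (hk : ∀ u, ρ < ‖u‖ → k u = 0) :
    ∫ w, KB k ((Metric.closedBall w (2 * ρ)).indicator f) ((Metric.closedBall w ρ).indicator h) =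
    ((volume (Metric.closedBall (0 : Eu n) ρ)).toReal : ℂ) * KB k f h := by
  simp_rw [KB_ind hk]
  have hi := KB_integrable hkm hC hf.int hh.int
  have hS : MeasurableSet (Metric.closedBall (0 : Eu n) ρ) := Metric.isClosed_closedBall.measurableSet
  have hind : Integrable ((Metric.closedBall (0 : Eu n) ρ).indicator (1 : Eu n → ℂ)) := by
    refine (integrable_indicator_iff hS).2 ?_
    have : IntegrableOn (fun _ => (1 : ℂ)) (Metric.closedBall (0 : Eu n) ρ) :=
      integrableOn_const (measure_closedBall_lt_top.ne)
    exact this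
  rw [integral_integral_swap]
  · have e : ∀ z : Eu n × Eu n, ∫ w, (k (z.2 - z.1) * f z.1 * h z.2) *
      (Metric.closedBall (0 : Eu n) ρ).indicator (1 : Eu n → ℂ) (w - z.2) =
        ((volume (Metric.closedBall (0 : Eu n) ρ)).toReal : ℂ) * (k (z.2 - z.1) * f z.1 * h z.2) := by
      intro z
      rw [integral_const_mul, integral_sub_right_eq_self
        (fun w => (Metric.closedBall (0 : Eu n) ρ).indicator (1 : Eu n → ℂ) w)]
      have : ∫ x, (Metric.closedBall (0 : Eu n) ρ).indicator (1 : Eu n → ℂ) x =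
          ((volume (Metric.closedBall (0 : Eu n) ρ)).toReal : ℂ) := by
        rw [integral_indicator hS]
        simp [Measure.real]
      rw [this, mul_comm]
    simp_rw [e]
    rw [integral_const_mul]; rfl
  · have h1 : Integrable (fun w : Eu n × (Eu n × Eu n) =>
        (Metric.closedBall (0 : Eu n) ρ).indicator (1 : Eu n → ℂ) w.1 *
        (k (w.2.2 - w.2.1) * f w.2.1 * h w.2.2)) (volume.prod volume) := hind.mul_prod hi
    have hmp : MeasurePreserving (fun w : Eu n × (Eu n × Eu n) => (w.1 - w.2.2, w.2))
        (volume.prod volume) (volume.prod volume) := by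
      have := (MeasurePreserving.skew_product (μa := (volume : Measure (Eu n × Eu n)))
        (μb := volume) (μc := (volume : Measure (Eu n)))
        (μd := (volume : Measure (Eu n)))
        (f := id) (g := fun z w => w - z.2) (MeasurePreserving.id _) (by fun_prop)
        (Filter.Eventually.of_forall fun z => (measurePreserving_sub_right volume z.2).map_eq))
      exact ((Measure.measurePreserving_swap).comp this).comp (Measure.measurePreserving_swap)
    have h2 := hmp.integrable_comp_of_integrable h1
    refine h2.congr (Filter.Eventually.of_forall fun w => ?_)
    simp only [Function.uncurry, Function.comp]; ring

theorem localization {n : ℕ} {M f h : Eu n → ℂ} (hM : Integrable M) (hK : Integrable (Kr M))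
    (hf : Good f) (hh : Good h)
    {p q : ℝ} (hpq : p.HolderConjugate q) (hp2 : p ≤ 2) {ρ A t : ℝ} (hρ : 0 < ρ) (hA : 0 ≤ A)
    (hA2 : ∀ F H, Good F → Good H → ‖BM M F H‖ ≤ A * nrm p F * nrm 2 H)
    (ht : ∫ u in (Metric.closedBall (0 : Eu n) ρ)ᶜ, ‖Kr M u‖ ≤ t) :
    ‖BM M f h‖ ≤ (2 ^ n * (A * (volume (Metric.closedBall (0 : Eu n) ρ)).toReal ^ (1 / p - 1 / 2) + t)
      + t) * nrm p f * nrm q h := by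
  have hS : MeasurableSet (Metric.closedBall (0 : Eu n) ρ) := Metric.isClosed_closedBall.measurableSet
  have hcont := Kr_cont hM
  have hKm : Measurable (Kr M) := hcont.measurable
  set k := (Metric.closedBall (0 : Eu n) ρ).indicator (Kr M) with hkd
  set k' := (Metric.closedBall (0 : Eu n) ρ)ᶜ.indicator (Kr M) with hkd'
  have hkm : Measurable k := hKm.indicator hS
  have hkm' : Measurable k' := hKm.indicator hS.compl
  have hki' : Integrable k' := hK.indicator hS.compl
  have hb : ∀ u, ‖k u‖ ≤ ∫ ξ, ‖M ξ‖ := fun u =>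
    (norm_indicator_le_norm_self _ _).trans (Kr_norm_le M u)
  have hb' : ∀ u, ‖k' u‖ ≤ ∫ ξ, ‖M ξ‖ := fun u =>
    (norm_indicator_le_norm_self _ _).trans (Kr_norm_le M u)
  have hp1 : 1 ≤ p := hpq.lt.le
  have hq1 : 1 ≤ q := hpq.symm.lt.le
  have hinv : 1 / p + 1 / q = 1 := by simpa [one_div] using hpq.inv_add_inv_eq_one
  have hq2 : 2 ≤ q := by
    have h1 : 1 / 2 ≤ 1 / p := one_div_le_one_div_of_le hpq.pos hp2
    have h2 : 1 / q ≤ 1 / 2 := by linarith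
    exact (one_div_le_one_div hpq.symm.pos (by norm_num)).1 h2
  have ht0 : 0 ≤ t := le_trans (by positivity) ht
  have htail : ∀ F H, Good F → Good H → ‖KB k' F H‖ ≤ t * nrm p F * nrm q H := by
    intro F H hF hH
    refine (KB_young hkm' hki' hF hH hpq).trans ?_
    have : ∫ u, ‖k' u‖ ≤ t := by
      refine le_trans (le_of_eq ?_) ht
      rw [← integral_indicator hS.compl]
      congr 1; ext u; rw [hkd', norm_indicator_eq_indicator_norm]
    have h1 := nrm_nonneg p F
    have h2 := nrm_nonneg q H
    gcongr
  have hsplit : ∀ F H, Good F → Good H → BM M F H = KB k F H + KB k' F H := by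
    intro F H hF hH
    rw [BM_kernel hM hF.int hH.int]
    unfold KB
    rw [← integral_add (KB_integrable hkm hb hF.int hH.int) (KB_integrable hkm' hb' hF.int hH.int)]
    congr 1; ext z
    have : Kr M (z.2 - z.1) = k (z.2 - z.1) + k' (z.2 - z.1) := by
      rw [hkd, hkd']
      have := Set.indicator_self_add_compl (Metric.closedBall (0 : Eu n) ρ) (Kr M)
      exact (congrFun this (z.2 - z.1)).symm
    rw [this]; ring
  set v := (volume (Metric.closedBall (0 : Eu n) ρ)).toReal with hv
  have hv0 : 0 < v := ENNReal.toReal_pos (Metric.measure_closedBall_pos _ _ hρ).ne'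
    measure_closedBall_lt_top.ne
  set B := A * v ^ (1 / p - 1 / 2) + t with hB
  have hB0 : 0 ≤ B := by positivity
  have hloc : ∀ w, ‖KB k ((Metric.closedBall w (2 * ρ)).indicator f)
      ((Metric.closedBall w ρ).indicator h)‖ ≤ B * (nrm p ((Metric.closedBall w (2 * ρ)).indicator f) *
      nrm q ((Metric.closedBall w ρ).indicator h)) := by
    intro w
    have hF := hf.indicator (s := Metric.closedBall w (2 * ρ)) Metric.isClosed_closedBall.measurableSet
    have hH := hh.indicator (s := Metric.closedBall w ρ) Metric.isClosed_closedBall.measurableSet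
    have e := hsplit _ _ hF hH
    have e' : KB k ((Metric.closedBall w (2 * ρ)).indicator f)
      ((Metric.closedBall w ρ).indicator h) = BM M ((Metric.closedBall w (2 * ρ)).indicator f)
      ((Metric.closedBall w ρ).indicator h) - KB k' ((Metric.closedBall w (2 * ρ)).indicator f)
      ((Metric.closedBall w ρ).indicator h) := by rw [e]; ring
    rw [e']
    refine (norm_sub_le _ _).trans ?_
    have h1 := hA2 _ _ hF hH
    have h2 := htail _ _ hF hH
    have h3 := nrm_ball_holder hh hq2 w (ρ := ρ)
    have e3 : 1 / 2 - 1 / q = 1 / p - 1 / 2 := by linarith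
    rw [e3, ← hv] at h3
    have h4 := nrm_nonneg p ((Metric.closedBall w (2 * ρ)).indicator f)
    have h5 : A * nrm p ((Metric.closedBall w (2 * ρ)).indicator f) *
        nrm 2 ((Metric.closedBall w ρ).indicator h) ≤
        A * nrm p ((Metric.closedBall w (2 * ρ)).indicator f) * (v ^ (1 / p - 1 / 2) *
        nrm q ((Metric.closedBall w ρ).indicator h)) := by gcongr
    rw [hB]
    linarith
  have havg := KB_average hkm hb hf hh (ρ := ρ) (fun u hu => by
    rw [hkd, Set.indicator_of_notMem]
    rw [mem_closedBall_zero_iff]; linarith)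
  have hmain : ENNReal.ofReal (v * ‖KB k f h‖) ≤
      ENNReal.ofReal (v * (2 ^ n * B * nrm p f * nrm q h)) := by
    have e1 : ENNReal.ofReal (v * ‖KB k f h‖) = ‖(v : ℂ) * KB k f h‖ₑ := by
      rw [← ofReal_norm, norm_mul, Complex.norm_real, Real.norm_of_nonneg hv0.le]
    rw [e1, ← havg]
    refine (enorm_integral_le_lintegral_enorm _).trans ?_
    calc _ ≤ ∫⁻ w, ENNReal.ofReal B * (en p ((Metric.closedBall w (2 * ρ)).indicator f) *
          en q ((Metric.closedBall w ρ).indicator h)) := by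
          refine lintegral_mono fun w => ?_
          rw [en_eq (hf.indicator Metric.isClosed_closedBall.measurableSet) hp1,
            en_eq (hh.indicator Metric.isClosed_closedBall.measurableSet) hq1,
            ← ENNReal.ofReal_mul (nrm_nonneg _ _), ← ENNReal.ofReal_mul hB0, ← ofReal_norm]
          exact ENNReal.ofReal_le_ofReal (hloc w)
      _ = ENNReal.ofReal B * ∫⁻ w, (en p ((Metric.closedBall w (2 * ρ)).indicator f) *
          en q ((Metric.closedBall w ρ).indicator h)) := lintegral_const_mul' _ _ ENNReal.ofReal_ne_top
      _ ≤ ENNReal.ofReal B * (2 ^ n * volume (Metric.closedBall (0 : Eu n) ρ) * (en p f * en q h)) := by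
          gcongr; exact en_ball_le hf.meas hh.meas hpq hρ
      _ = _ := by
          rw [en_eq hf hp1, en_eq hh hq1, ← ENNReal.ofReal_toReal
            (measure_closedBall_lt_top (x := (0 : Eu n)) (r := ρ) (μ := volume)).ne, ← hv]
          have : (2 : ℝ≥0∞) ^ n = ENNReal.ofReal (2 ^ n) := by
            rw [ENNReal.ofReal_pow (by norm_num)]; norm_num
          have h4 := nrm_nonneg p f
          rw [this, ← ENNReal.ofReal_mul (by positivity), ← ENNReal.ofReal_mul h4,
            ← ENNReal.ofReal_mul (by positivity), ← ENNReal.ofReal_mul hB0]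
          congr 1; ring
  have h4 := nrm_nonneg p f
  have h5 := nrm_nonneg q h
  have hmain' := (ENNReal.ofReal_le_ofReal_iff (by positivity)).1 hmain
  have hfin := le_of_mul_le_mul_left hmain' hv0
  rw [hsplit f h hf hh]
  refine (norm_add_le _ _).trans ?_
  have := htail f h hf hh
  nlinarith

open scoped ContDiff in
lemma slice_compact {X V : Type*} [NormedAddCommGroup X] [NormedAddCommGroup V]
    {A : X × V → ℂ} (hc : HasCompactSupport A) (x : X) : HasCompactSupport (fun v => A (x, v)) := by
  refine HasCompactSupport.intro (K := Prod.snd '' tsupport A) (hc.isCompact.image continuous_snd) ?_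
  intro v hv
  by_contra h
  exact hv ⟨(x, v), subset_tsupport _ h, rfl⟩

open scoped ContDiff in
lemma slice_fderiv {X V : Type*} [NormedAddCommGroup X] [NormedSpace ℝ X] [NormedAddCommGroup V]
    [NormedSpace ℝ V] {F : Type*} [NormedAddCommGroup F] [NormedSpace ℝ F]
    {A : X × V → F} (hA : ContDiff ℝ ∞ A) (x : X) (v w : V) :
    fderiv ℝ (fun v => A (x, v)) v w = fderiv ℝ A (x, v) (0, w) := by
  have h1 : HasFDerivAt A (fderiv ℝ A (x, v)) (x, v) :=
    ((hA.differentiable (by simp)) _).hasFDerivAt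
  have h2 := h1.comp v (hasFDerivAt_prodMk_right x v)
  have h3 : fderiv ℝ (fun v => A (x, v)) v = _ := h2.fderiv
  rw [h3]; simp

open scoped ContDiff in
theorem nonstat {X V : Type*} [NormedAddCommGroup X] [NormedSpace ℝ X] [NormedAddCommGroup V]
    [NormedSpace ℝ V] [FiniteDimensional ℝ V] [MeasurableSpace V] [BorelSpace V]
    (μ : Measure V) [μ.IsAddHaarMeasure] {θ : X × V → ℝ} (hθ : ContDiff ℝ ∞ θ) (N : ℕ) :
    ∀ A : X × V → ℂ, ContDiff ℝ ∞ A → HasCompactSupport A →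
    (∀ z ∈ tsupport A, ∃ v, fderiv ℝ θ z (0, v) ≠ 0) →
    ∃ C : ℝ, 0 ≤ C ∧ ∀ x : X, ∀ l : ℝ, 0 < l →
      l ^ N * ‖∫ v, Complex.exp (I * ((l * θ (x, v) : ℝ) : ℂ)) * A (x, v) ∂μ‖ ≤ C := by
  induction N with
  | zero =>
    intro A hA hc _
    obtain ⟨S, hS⟩ := hA.continuous.bounded_above_of_compact_support hc
    set K := Prod.snd '' tsupport A with hK
    have hKc : IsCompact K := hc.isCompact.image continuous_snd
    have hS0 : 0 ≤ max S 0 := le_max_right _ _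
    refine ⟨max S 0 * μ.real K, by positivity, fun x l hl => ?_⟩
    rw [pow_zero, one_mul]
    rw [← setIntegral_eq_integral_of_forall_compl_eq_zero (s := K)]
    · refine norm_setIntegral_le_of_norm_le_const hKc.measure_lt_top (fun v _ => ?_)
      rw [norm_mul, norm_expI, one_mul]
      exact (hS _).trans (le_max_left _ _)
    · intro v hv
      have : A (x, v) = 0 := by
        by_contra h
        exact hv ⟨(x, v), subset_tsupport _ h, rfl⟩
      rw [this, mul_zero]
  | succ N ih =>
    intro A hA hc hnd
    set b := Module.finBasis ℝ V with hb
    have hd : ∀ i, ContDiff ℝ ∞ (fun z => fderiv ℝ θ z (0, b i)) := fun i =>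
      (hθ.fderiv_right (m := ∞) (by simp)).clm_apply contDiff_const
    set G : X × V → ℝ := fun z => ∑ j, (fderiv ℝ θ z (0, b j)) ^ 2 with hG
    have hGs : ContDiff ℝ ∞ G := ContDiff.sum fun j _ => (hd j).pow 2
    have hG0 : ∀ z ∈ tsupport A, G z ≠ 0 := by
      intro z hz h0
      obtain ⟨v, hv⟩ := hnd z hz
      apply hv
      have hz0 : ∀ j, fderiv ℝ θ z (0, b j) = 0 := by
        intro j
        have := (Finset.sum_eq_zero_iff_of_nonneg (fun j _ => sq_nonneg (fderiv ℝ θ z (0, b j)))).1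
          h0 j (Finset.mem_univ j)
        exact pow_eq_zero_iff (two_ne_zero) |>.1 this
      have hL : ((fderiv ℝ θ z).toLinearMap ∘ₗ LinearMap.inr ℝ X V) = 0 := by
        refine b.ext fun j => ?_
        simpa using hz0 j
      have := congrArg (fun L => L v) hL
      simpa using this
    set g : Fin (Module.finrank ℝ V) → X × V → ℂ :=
      fun i z => ((fderiv ℝ θ z (0, b i)) / G z) • A z with hg
    have hgs : ∀ i, ContDiff ℝ ∞ (g i) := by
      intro i
      rw [contDiff_iff_contDiffAt]
      intro z
      by_cases hz : z ∈ tsupport A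
      · exact (((hd i).contDiffAt).div hGs.contDiffAt (hG0 z hz)).smul hA.contDiffAt
      · have h0 := notMem_tsupport_iff_eventuallyEq.1 hz
        have : g i =ᶠ[nhds z] fun _ => 0 := by
          filter_upwards [h0] with y hy
          simp only [hg]; rw [hy]; simp
        exact contDiffAt_const.congr_of_eventuallyEq this
    have hgsupp : ∀ i, tsupport (g i) ⊆ tsupport A := by
      intro i
      exact tsupport_smul_subset_right _ _
    have hgc : ∀ i, HasCompactSupport (g i) := fun i =>
      hc.mono' ((subset_tsupport _).trans (hgsupp i))
    have hgds : ∀ i, ContDiff ℝ ∞ (fun z => fderiv ℝ (g i) z (0, b i)) := fun i =>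
      ((hgs i).fderiv_right (m := ∞) (by simp)).clm_apply contDiff_const
    set A' : X × V → ℂ := fun z => ∑ i, fderiv ℝ (g i) z (0, b i) with hA'
    have hz' : ∀ z, z ∉ tsupport A → ∀ i, fderiv ℝ (g i) z (0, b i) = 0 := by
      intro z hz i
      have : fderiv ℝ (g i) z = 0 := by
        by_contra h
        exact hz (hgsupp i (support_fderiv_subset ℝ h))
      rw [this]; rfl
    have hsub : tsupport A' ⊆ tsupport A := by
      refine closure_minimal ?_ (isClosed_tsupport A)
      intro z hz
      by_contra h
      exact hz (Finset.sum_eq_zero fun i _ => hz' z h i)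
    obtain ⟨C, hC0, hC⟩ := ih A' (ContDiff.sum fun i _ => hgds i)
      (hc.mono' ((subset_tsupport _).trans hsub)) (fun z hz => hnd z (hsub hz))
    refine ⟨C, hC0, fun x l hl => ?_⟩
    refine le_trans (le_of_eq ?_) (hC x l hl)
    rw [pow_succ, mul_assoc]
    congr 1
    set e : X × V → ℂ := fun z => Complex.exp (I * ((l * θ z : ℝ) : ℂ)) with he
    have hes : ContDiff ℝ ∞ e := by
      refine ContDiff.cexp (contDiff_const.mul ?_)
      exact Complex.ofRealCLM.contDiff.comp (contDiff_const.mul hθ)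
    have hed : ∀ z w, fderiv ℝ e z w = I * l * ((fderiv ℝ θ z w : ℝ) : ℂ) * e z := by
      intro z w
      have h1 : HasFDerivAt θ (fderiv ℝ θ z) z := (hθ.differentiable (by simp) z).hasFDerivAt
      have h2 := ((Complex.ofRealCLM.hasFDerivAt.comp z (h1.const_mul l)).const_mul I).cexp
      have h3 : fderiv ℝ e z = _ := h2.fderiv
      rw [h3]
      simp [he]; ring
    have hslice : ∀ {F : X × V → ℂ}, Continuous F → HasCompactSupport F →
        Integrable (fun v => e (x, v) * F (x, v)) μ := by
      intro F hF hFc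
      refine Continuous.integrable_of_hasCompactSupport ?_ ?_
      · exact (hes.continuous.comp (by fun_prop)).mul (hF.comp (by fun_prop))
      · exact (slice_compact hFc x).mul_left
    have hibp : ∀ i, ∫ v, e (x, v) * fderiv ℝ (g i) (x, v) (0, b i) ∂μ =
        - ∫ v, (I * l * ((fderiv ℝ θ (x, v) (0, b i) : ℝ) : ℂ) * e (x, v)) * g i (x, v) ∂μ := by
      intro i
      have key := integral_mul_fderiv_eq_neg_fderiv_mul_of_integrable (μ := μ)
        (f := fun v => e (x, v)) (g := fun v => g i (x, v)) (v := b i) ?_ ?_ ?_ ?_ ?_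
      · simp_rw [slice_fderiv hes, slice_fderiv (hgs i), hed] at key
        exact key
      · simp_rw [slice_fderiv hes, hed]
        have := hslice (F := fun z => I * l * ((fderiv ℝ θ z (0, b i) : ℝ) : ℂ) * g i z)
          ((continuous_const.mul (Complex.continuous_ofReal.comp (hd i).continuous)).mul
          (hgs i).continuous) (hgc i).mul_left
        refine this.congr (Filter.Eventually.of_forall fun v => ?_)
        simp only; ring
      · simp_rw [slice_fderiv (hgs i)]
        refine hslice (F := fun z => fderiv ℝ (g i) z (0, b i)) (hgds i).continuous ?_
        refine HasCompactSupport.intro hc.isCompact (fun z hz => hz' z hz i)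
      · exact hslice (hgs i).continuous (hgc i)
      · intro v _
        exact (hes.differentiable (by simp) _).comp v (by fun_prop)
      · intro v _
        exact ((hgs i).differentiable (by simp) _).comp v (by fun_prop)
    have hdi : ∀ i, Integrable (fun v => e (x, v) * fderiv ℝ (g i) (x, v) (0, b i)) μ := by
      intro i
      refine hslice (F := fun z => fderiv ℝ (g i) z (0, b i)) (hgds i).continuous ?_
      exact HasCompactSupport.intro hc.isCompact (fun z hz => hz' z hz i)
    have hfin : ∫ v, e (x, v) * A' (x, v) ∂μ = -(I * l) * ∫ v, e (x, v) * A (x, v) ∂μ := by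
      simp only [hA', Finset.mul_sum]
      rw [integral_finset_sum _ (fun i _ => hdi i)]
      simp_rw [hibp]
      rw [Finset.sum_neg_distrib, ← integral_finset_sum, ← integral_const_mul, ← integral_neg]
      · congr 1; ext v
        by_cases hz : (x, v) ∈ tsupport A
        · have hGz := hG0 _ hz
          have : ∑ i, I * l * ((fderiv ℝ θ (x, v) (0, b i) : ℝ) : ℂ) * e (x, v) * g i (x, v) =
              I * l * e (x, v) * (∑ i, ((fderiv ℝ θ (x, v) (0, b i) ^ 2 / G (x, v) : ℝ) : ℂ)) *
                A (x, v) := by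
            rw [Finset.mul_sum, Finset.sum_mul]
            refine Finset.sum_congr rfl fun i _ => ?_
            simp only [hg, Complex.real_smul]; push_cast; ring
          rw [this, ← Complex.ofReal_sum, ← Finset.sum_div]
          have h1 : (∑ i, fderiv ℝ θ (x, v) (0, b i) ^ 2) / G (x, v) = 1 := div_self hGz
          rw [h1]; push_cast; ring
        · have h0 : A (x, v) = 0 := image_eq_zero_of_notMem_tsupport hz
          simp [hg, h0]
      · intro i _
        have := hslice (F := fun z => I * l * ((fderiv ℝ θ z (0, b i) : ℝ) : ℂ) * g i z)
          ((continuous_const.mul (Complex.continuous_ofReal.comp (hd i).continuous)).mul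
          (hgs i).continuous) (hgc i).mul_left
        refine this.congr (Filter.Eventually.of_forall fun v => ?_)
        simp only; ring
    change l * ‖∫ v, e (x, v) * A (x, v) ∂μ‖ = ‖∫ v, e (x, v) * A' (x, v) ∂μ‖
    rw [hfin, norm_mul, norm_neg, norm_mul, Complex.norm_I, one_mul, Complex.norm_real,
      Real.norm_of_nonneg hl.le]

lemma sq_integral_le {V : Type*} [NormedAddCommGroup V]
    [NormedSpace ℝ V] [FiniteDimensional ℝ V] [MeasurableSpace V] [BorelSpace V]
    (μ : Measure V) [μ.IsAddHaarMeasure] {F : V → ℂ} (hF : Continuous F) (hc : HasCompactSupport F) :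
    ‖∫ z, F z ∂μ‖ ^ 2 ≤ ∫ h, ‖∫ z, F (z + h) * (starRingEnd ℂ) (F z) ∂μ‖ ∂μ := by
  have e1 : (((‖∫ z, F z ∂μ‖ ^ 2 : ℝ)) : ℂ) = ∫ h, ∫ z, F (z + h) * (starRingEnd ℂ) (F z) ∂μ ∂μ := by
    rw [integral_integral_swap]
    · have : ∀ z, ∫ h, F (z + h) * (starRingEnd ℂ) (F z) ∂μ =
          (∫ h, F h ∂μ) * (starRingEnd ℂ) (F z) := by
        intro z
        rw [integral_mul_const, integral_add_left_eq_self (fun h => F h)]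
      simp_rw [this]
      rw [integral_const_mul, integral_conj, Complex.mul_conj, Complex.normSq_eq_norm_sq]
    · refine Continuous.integrable_of_hasCompactSupport ?_ ?_
      · have h1 := Complex.continuous_conj
        simp only [Function.uncurry_def]
        fun_prop
      · set K := tsupport F with hK
        have hKc : IsCompact K := hc
        refine HasCompactSupport.intro
          (K := (fun y : V × V => (y.1 - y.2, y.2)) '' (K ×ˢ K)) ?_ ?_
        · exact (hKc.prod hKc).image (by fun_prop)
        · intro y hy
          by_contra h
          simp only [Function.uncurry_def] at h
          have h1 := left_ne_zero_of_mul h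
          have h2 := right_ne_zero_of_mul h
          have h2' : F y.2 ≠ 0 := by simpa using h2
          exact hy ⟨(y.2 + y.1, y.2), ⟨subset_tsupport _ h1, subset_tsupport _ h2'⟩, by simp⟩
  have e2 : ‖∫ z, F z ∂μ‖ ^ 2 = ‖∫ h, ∫ z, F (z + h) * (starRingEnd ℂ) (F z) ∂μ ∂μ‖ := by
    rw [← e1, Complex.norm_real, Real.norm_of_nonneg (by positivity)]
  rw [e2]
  exact norm_integral_le_integral_norm _

lemma scaled_decay {V : Type*} [NormedAddCommGroup V]
    [NormedSpace ℝ V] [FiniteDimensional ℝ V] [MeasurableSpace V] [BorelSpace V]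
    (μ : Measure V) [μ.IsAddHaarMeasure] {L : ℝ} (hL : 0 < L) :
    Integrable (fun h : V => (1 + L * ‖h‖) ^ (-((Module.finrank ℝ V : ℝ) + 1))) μ ∧
    ∫ h : V, (1 + L * ‖h‖) ^ (-((Module.finrank ℝ V : ℝ) + 1)) ∂μ =
      (L ^ Module.finrank ℝ V)⁻¹ * ∫ h : V, (1 + ‖h‖) ^ (-((Module.finrank ℝ V : ℝ) + 1)) ∂μ := by
  have h1 : Integrable (fun h : V => (1 + ‖h‖) ^ (-((Module.finrank ℝ V : ℝ) + 1))) μ :=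
    integrable_one_add_norm (by linarith)
  have e : ∀ h : V, (1 + L * ‖h‖) = 1 + ‖L • h‖ := by
    intro h; rw [norm_smul, Real.norm_of_nonneg hL.le]
  simp_rw [e]
  refine ⟨h1.comp_smul hL.ne', ?_⟩
  rw [Measure.integral_comp_smul μ (fun h => (1 + ‖h‖) ^ (-((Module.finrank ℝ V : ℝ) + 1))) L]
  rw [abs_of_pos (by positivity), smul_eq_mul]

lemma decay_combine {x J C0 C1 : ℝ} {D : ℕ} (hx : 0 ≤ x) (h0 : J ≤ C0) (hJ : 0 ≤ J)
    (h1 : x ^ (D + 1) * J ≤ C1) :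
    J ≤ (2 ^ (D + 1) * (C0 + C1)) * (1 + x) ^ (-((D : ℝ) + 1)) := by
  have hx1 : 0 < 1 + x := by linarith
  rw [Real.rpow_neg hx1.le, ← div_eq_mul_inv, le_div_iff₀ (by positivity)]
  have : (1 + x) ^ ((D : ℝ) + 1) = (1 + x) ^ (D + 1) := by
    rw [← Real.rpow_natCast]; push_cast; rfl
  rw [this]
  have h2 : (1 + x) ^ (D + 1) ≤ 2 ^ (D + 1) * (1 + x ^ (D + 1)) := by
    rcases le_total x 1 with h | h
    · calc (1 + x) ^ (D + 1) ≤ 2 ^ (D + 1) := by gcongr; linarith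
        _ ≤ _ := by
          have : 0 ≤ x ^ (D + 1) := by positivity
          have h2 : (0 : ℝ) < 2 ^ (D + 1) := by positivity
          nlinarith
    · calc (1 + x) ^ (D + 1) ≤ (2 * x) ^ (D + 1) := by gcongr; linarith
        _ = 2 ^ (D + 1) * x ^ (D + 1) := mul_pow _ _ _
        _ ≤ _ := by gcongr; linarith
  calc J * (1 + x) ^ (D + 1) ≤ J * (2 ^ (D + 1) * (1 + x ^ (D + 1))) := by gcongr
    _ = 2 ^ (D + 1) * (J + x ^ (D + 1) * J) := by ring
    _ ≤ _ := by gcongr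

open scoped ContDiff in
theorem statphase {V : Type*} [NormedAddCommGroup V] [Nontrivial V]
    [NormedSpace ℝ V] [FiniteDimensional ℝ V] [MeasurableSpace V] [BorelSpace V]
    (μ : Measure V) [μ.IsAddHaarMeasure] {Φ : V → ℝ} (hΦ : ContDiff ℝ ∞ Φ)
    {q : ℝ × V × V → ℝ} (hq : ContDiff ℝ ∞ q)
    (hqe : ∀ ρ om z, Φ (z + ρ • om) - Φ z = ρ * q (ρ, om, z))
    {a : V → ℂ} (ha : ContDiff ℝ ∞ a) (hac : HasCompactSupport a)
    (hnd : ∀ z ∈ tsupport a, ∀ om : V, om ≠ 0 → ∃ v, fderiv ℝ q (0, om, z) (0, 0, v) ≠ 0) :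
    ∃ C : ℝ, 0 ≤ C ∧ ∀ L : ℝ, 0 < L → ∀ l : V →L[ℝ] ℝ,
      ‖∫ z, Complex.exp (I * ((L * Φ z + l z : ℝ) : ℂ)) * a z ∂μ‖ ≤
        C * L ^ (-(Module.finrank ℝ V : ℝ) / 2) := by
  set D := Module.finrank ℝ V with hD
  have : ProperSpace V := FiniteDimensional.proper ℝ V
  -- the nondegenerate region
  set U : Set (ℝ × V × V) := {y | ∃ v, fderiv ℝ q y (0, 0, v) ≠ 0} with hU
  have hUo : IsOpen U := by
    have : U = ⋃ v : V, {y | fderiv ℝ q y (0, 0, v) ≠ 0} := by ext y; simp [hU]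
    rw [this]
    refine isOpen_iUnion fun v => ?_
    have hcont : Continuous fun y => fderiv ℝ q y (0, 0, v) :=
      (hq.continuous_fderiv (by simp)).clm_apply continuous_const
    exact isOpen_ne_fun hcont continuous_const
  set S : Set V := Metric.closedBall 0 2 \ Metric.ball 0 (1 / 4) with hS
  have hSc : IsCompact S := (isCompact_closedBall 0 2).diff Metric.isOpen_ball
  set K0 : Set (ℝ × V × V) := {0} ×ˢ (S ×ˢ tsupport a) with hK0
  have hK0c : IsCompact K0 := isCompact_singleton.prod (hSc.prod hac)
  have hK0U : K0 ⊆ U := by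
    rintro ⟨ρ, om, z⟩ ⟨h1, h2, h3⟩
    simp only [Set.mem_singleton_iff] at h1
    subst h1
    refine hnd z h3 om ?_
    rintro rfl
    apply h2.2
    simp
  obtain ⟨δ, hδ, hδU⟩ := hK0c.exists_cthickening_subset_open hUo hK0U
  have hin : ∀ ρ om z, |ρ| ≤ δ → om ∈ S → z ∈ tsupport a → (ρ, om, z) ∈ U := by
    intro ρ om z h1 h2 h3
    apply hδU
    refine Metric.mem_cthickening_of_dist_le _ ((0 : ℝ), om, z) δ _ ⟨rfl, h2, h3⟩ ?_
    rw [dist_prod_same_right]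
    simpa using h1
  -- cutoffs
  set δ1 := δ / 16 with hδ1
  have hδ1p : 0 < δ1 := by positivity
  let ψ : ContDiffBump (0 : V) := ⟨δ1 / 2, δ1, by positivity, by linarith⟩
  let κ1 : ContDiffBump (0 : V) := ⟨1, 2, by norm_num, by norm_num⟩
  let κ2 : ContDiffBump (0 : V) := ⟨1 / 4, 1 / 2, by norm_num, by norm_num⟩
  have hψs : ContDiff ℝ ∞ (ψ : V → ℝ) := ψ.contDiff
  have hκ1s : ContDiff ℝ ∞ (κ1 : V → ℝ) := κ1.contDiff
  have hκ2s : ContDiff ℝ ∞ (κ2 : V → ℝ) := κ2.contDiff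
  have hψ0 : ∀ y, δ1 < ‖y‖ → ψ y = 0 := fun y hy => ψ.zero_of_le_dist (by
    rw [dist_zero_right]; exact hy.le)
  set κ : V → ℝ := fun om => κ1 om * (1 - κ2 om) with hκ
  have hκone : ∀ om, ‖om‖ = 1 → κ om = 1 := by
    intro om hom
    have h1 : κ1 om = 1 := κ1.one_of_mem_closedBall (by
      rw [mem_closedBall_zero_iff, hom])
    have h2 : κ2 om = 0 := κ2.zero_of_le_dist (by
      rw [dist_zero_right, hom]; change (1 / 2 : ℝ) ≤ 1; norm_num)
    simp [hκ, h1, h2]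
  have hκS : ∀ om, κ om ≠ 0 → om ∈ S := by
    intro om hom
    refine ⟨?_, ?_⟩
    · by_contra h
      rw [mem_closedBall_zero_iff, not_le] at h
      apply hom
      have h1 : κ1 om = 0 := κ1.zero_of_le_dist (by rw [dist_zero_right]; exact h.le)
      simp [hκ, h1]
    · intro h
      apply hom
      have h1 : κ2 om = 1 := κ2.one_of_mem_closedBall (Metric.ball_subset_closedBall h)
      simp [hκ, h1]
  -- localized amplitudes
  set b : V → V → ℂ := fun w z => ((ψ (z - w) : ℝ) : ℂ) * a z with hb
  set A : (ℝ × V × V) × V → ℂ := fun y =>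
    ((κ y.1.2.1 : ℝ) : ℂ) * (b y.1.2.2 (y.2 + y.1.1 • y.1.2.1) *
      (starRingEnd ℂ) (b y.1.2.2 y.2)) with hAdef
  have hbs : ContDiff ℝ ∞ (fun y : V × V => b y.1 y.2) := by
    refine ContDiff.mul (Complex.ofRealCLM.contDiff.comp (hψs.comp (contDiff_snd.sub contDiff_fst)))
      (ha.comp contDiff_snd)
  have hAs : ContDiff ℝ ∞ A := by
    refine ContDiff.mul ?_ (ContDiff.mul ?_ ?_)
    · refine Complex.ofRealCLM.contDiff.comp ?_
      refine (ContDiff.mul hκ1s (contDiff_const.sub hκ2s)).comp ?_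
      fun_prop
    · exact hbs.comp (f := fun y : (ℝ × V × V) × V => (y.1.2.2, y.2 + y.1.1 • y.1.2.1))
        (by fun_prop)
    · refine Complex.conjCLE.contDiff.comp ?_
      exact hbs.comp (f := fun y : (ℝ × V × V) × V => (y.1.2.2, y.2)) (by fun_prop)
  have hbne : ∀ w z, b w z ≠ 0 → ‖z - w‖ ≤ δ1 ∧ a z ≠ 0 := by
    intro w z h
    refine ⟨?_, right_ne_zero_of_mul h⟩
    by_contra h'
    rw [not_le] at h'
    apply h
    simp [hb, hψ0 _ h']
  have hAne : ∀ y, A y ≠ 0 → |y.1.1| ≤ δ ∧ y.1.2.1 ∈ S ∧ ‖y.2 - y.1.2.2‖ ≤ δ1 ∧ a y.2 ≠ 0 := by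
    rintro ⟨⟨ρ, om, w⟩, z⟩ h
    simp only [hAdef] at h ⊢
    have h1 : κ om ≠ 0 := by
      have := left_ne_zero_of_mul h
      exact_mod_cast this
    have h2 := hbne _ _ (left_ne_zero_of_mul (right_ne_zero_of_mul h))
    have h3' := right_ne_zero_of_mul (right_ne_zero_of_mul h)
    have h3 := hbne w z (by simpa using h3')
    have homS := hκS om h1
    refine ⟨?_, homS, h3.1, h3.2⟩
    have h4 : ‖ρ • om‖ ≤ 2 * δ1 := by
      have : ρ • om = (z + ρ • om - w) - (z - w) := by abel
      rw [this]
      refine (norm_sub_le _ _).trans ?_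
      linarith [h2.1, h3.1]
    rw [norm_smul, Real.norm_eq_abs] at h4
    have h5 : 1 / 4 ≤ ‖om‖ := by
      have := homS.2
      rw [mem_ball_zero_iff, not_lt] at this
      exact this
    have h6 : 0 ≤ |ρ| := abs_nonneg _
    nlinarith
  obtain ⟨R, hR⟩ := hac.isCompact.isBounded.subset_closedBall (0 : V)
  have hRa : ∀ z, a z ≠ 0 → ‖z‖ ≤ R := by
    intro z hz
    have := hR (subset_tsupport _ hz)
    rwa [mem_closedBall_zero_iff] at this
  have hAc : HasCompactSupport A := by
    refine HasCompactSupport.intro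
      (K := (Metric.closedBall 0 δ ×ˢ (S ×ˢ Metric.closedBall 0 (R + δ1))) ×ˢ tsupport a) ?_ ?_
    · exact ((isCompact_closedBall _ _).prod (hSc.prod (isCompact_closedBall _ _))).prod hac
    · intro y hy
      by_contra h
      obtain ⟨h1, h2, h3, h4⟩ := hAne y h
      refine hy ⟨⟨?_, h2, ?_⟩, subset_tsupport _ h4⟩
      · rw [mem_closedBall_zero_iff]; exact h1
      · rw [mem_closedBall_zero_iff]
        have : y.1.2.2 = y.2 - (y.2 - y.1.2.2) := by abel
        rw [this]
        refine (norm_sub_le _ _).trans (add_le_add (hRa _ h4) h3)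
  set θ : (ℝ × V × V) × V → ℝ := fun y => q (y.1.1, y.1.2.1, y.2) with hθ
  have hθs : ContDiff ℝ ∞ θ := hq.comp (f := fun y : (ℝ × V × V) × V => (y.1.1, y.1.2.1, y.2))
    (by fun_prop)
  have hAnd : ∀ y ∈ tsupport A, ∃ v, fderiv ℝ θ y (0, v) ≠ 0 := by
    intro y hy
    set T : Set ((ℝ × V × V) × V) := {y | |y.1.1| ≤ δ ∧ y.1.2.1 ∈ S ∧ y.2 ∈ tsupport a} with hT
    have hTc : IsClosed T := by
      refine IsClosed.inter ?_ (IsClosed.inter ?_ ?_)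
      · exact isClosed_le (f := fun y : (ℝ × V × V) × V => |y.1.1|) (by fun_prop) continuous_const
      · exact hSc.isClosed.preimage (f := fun y : (ℝ × V × V) × V => y.1.2.1) (by fun_prop)
      · exact (isClosed_tsupport a).preimage continuous_snd
    have hsub : tsupport A ⊆ T := closure_minimal (fun y hy => by
      obtain ⟨h1, h2, h3, h4⟩ := hAne y hy
      exact ⟨h1, h2, subset_tsupport _ h4⟩) hTc
    obtain ⟨h1, h2, h3⟩ := hsub hy
    obtain ⟨v, hv⟩ := hin _ _ _ h1 h2 h3
    refine ⟨v, ?_⟩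
    rw [← slice_fderiv hθs]
    have h5 := slice_fderiv (X := ℝ) (V := V × V) (A := q) hq y.1.1 (y.1.2.1, y.2) (0, v)
    have h6 := slice_fderiv (X := V) (V := V) (A := fun u => q (y.1.1, u))
      (hq.comp (f := fun u : V × V => (y.1.1, u)) (by fun_prop)) y.1.2.1 y.2 v
    rw [← h5, ← h6] at hv
    exact hv
  obtain ⟨C0, hC00, hC0⟩ := nonstat μ hθs 0 A hAs hAc hAnd
  obtain ⟨C1, hC10, hC1⟩ := nonstat μ hθs (D + 1) A hAs hAc hAnd
  set CJ := 2 ^ (D + 1) * (C0 + C1) with hCJ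
  set E := ∫ h : V, (1 + ‖h‖) ^ (-((D : ℝ) + 1)) ∂μ with hE
  have hE0 : 0 ≤ E := integral_nonneg fun h => by positivity
  -- bound of the localized integrals
  have hloc : ∀ L : ℝ, 0 < L → ∀ l : V →L[ℝ] ℝ, ∀ w,
      ‖∫ z, Complex.exp (I * ((L * Φ z + l z : ℝ) : ℂ)) * b w z ∂μ‖ ≤
        Real.sqrt (CJ * E) * L ^ (-(D : ℝ) / 2) := by
    intro L hL l w
    set F : V → ℂ := fun z => Complex.exp (I * ((L * Φ z + l z : ℝ) : ℂ)) * b w z with hF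
    have hbw : Continuous (b w) := hbs.continuous.comp (f := fun z : V => (w, z)) (by fun_prop)
    have hΦc := hΦ.continuous
    have hFc : Continuous F := by fun_prop
    have hbc : HasCompactSupport (b w) := hac.mul_left
    have hFs : HasCompactSupport F := hbc.mul_left
    have hsq := sq_integral_le μ hFc hFs
    have hJ : ∀ h : V, h ≠ 0 → ‖∫ z, F (z + h) * (starRingEnd ℂ) (F z) ∂μ‖ ≤
        CJ * (1 + L * ‖h‖) ^ (-((D : ℝ) + 1)) := by
      intro h hh
      have hhn : 0 < ‖h‖ := norm_pos_iff.2 hh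
      set om := ‖h‖⁻¹ • h with hom
      have hom1 : ‖om‖ = 1 := by
        rw [hom, norm_smul, norm_inv, norm_norm, inv_mul_cancel₀ hhn.ne']
      have hhom : ‖h‖ • om = h := by
        rw [hom, smul_smul, mul_inv_cancel₀ hhn.ne', one_smul]
      have e1 : ‖∫ z, F (z + h) * (starRingEnd ℂ) (F z) ∂μ‖ =
          ‖∫ z, Complex.exp (I * (((L * ‖h‖) * θ ((‖h‖, om, w), z) : ℝ) : ℂ)) *
            A ((‖h‖, om, w), z) ∂μ‖ := by
        have : ∀ z, F (z + h) * (starRingEnd ℂ) (F z) = Complex.exp (I * ((l h : ℝ) : ℂ)) *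
            (Complex.exp (I * (((L * ‖h‖) * θ ((‖h‖, om, w), z) : ℝ) : ℂ)) *
            A ((‖h‖, om, w), z)) := by
          intro z
          have hθe : ‖h‖ * θ ((‖h‖, om, w), z) = Φ (z + h) - Φ z := by
            have := hqe ‖h‖ om z
            rw [hhom] at this
            exact this.symm
          simp only [hAdef, hκone om hom1, hhom, hF]
          rw [mul_assoc L, hθe, map_mul, ← Complex.exp_conj, map_mul, Complex.conj_I,
            Complex.conj_ofReal, map_add]
          have e3 : Complex.exp (I * (l h : ℂ)) * Complex.exp (I * ((L * (Φ (z + h) - Φ z) : ℝ) : ℂ)) =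
              Complex.exp (I * ((L * Φ (z + h) + (l z + l h) : ℝ) : ℂ)) *
                Complex.exp (-I * ((L * Φ z + l z : ℝ) : ℂ)) := by
            rw [← Complex.exp_add, ← Complex.exp_add]; congr 1; push_cast; ring
          rw [← mul_assoc (Complex.exp (I * (l h : ℂ))), e3]
          push_cast; ring
        simp_rw [this]
        rw [integral_const_mul, norm_mul, norm_expI, one_mul]
      rw [e1]
      have hl : 0 < L * ‖h‖ := by positivity
      have g0 := hC0 (‖h‖, om, w) _ hl
      have g1 := hC1 (‖h‖, om, w) _ hl
      rw [pow_zero, one_mul] at g0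
      exact decay_combine hl.le g0 (norm_nonneg _) g1
    obtain ⟨hi, he⟩ := scaled_decay μ (V := V) hL
    have hintg : ∫ h, ‖∫ z, F (z + h) * (starRingEnd ℂ) (F z) ∂μ‖ ∂μ ≤
        CJ * ((L ^ D)⁻¹ * E) := by
      rw [hE, hD, ← he, ← integral_const_mul]
      refine integral_mono_of_nonneg (Filter.Eventually.of_forall fun _ => norm_nonneg _)
        (hi.const_mul CJ) ?_
      have : ∀ᵐ h ∂μ, h ≠ 0 := by
        rw [ae_iff]; simp
      filter_upwards [this] with h hh
      exact hJ h hh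
    have h7 := hsq.trans hintg
    have h8 : ‖∫ z, F z ∂μ‖ ≤ Real.sqrt (CJ * ((L ^ D)⁻¹ * E)) := Real.le_sqrt_of_sq_le h7
    refine h8.trans (le_of_eq ?_)
    have h9 : CJ * ((L ^ D)⁻¹ * E) = (CJ * E) * (L ^ D)⁻¹ := by ring
    rw [h9, Real.sqrt_mul (by positivity)]
    congr 1
    rw [Real.sqrt_eq_rpow, ← Real.rpow_natCast, ← Real.rpow_neg hL.le, ← Real.rpow_mul hL.le]
    congr 1; ring
  -- averaging
  set c := ∫ w, ψ w ∂μ with hc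
  have hc0 : 0 < c := ψ.integral_pos
  set W := Metric.closedBall (0 : V) (R + δ1) with hW
  refine ⟨c⁻¹ * (Real.sqrt (CJ * E) * μ.real W), by positivity, fun L hL l => ?_⟩
  have hΦc := hΦ.continuous
  have havg : (c : ℂ) * ∫ z, Complex.exp (I * ((L * Φ z + l z : ℝ) : ℂ)) * a z ∂μ =
      ∫ w, ∫ z, Complex.exp (I * ((L * Φ z + l z : ℝ) : ℂ)) * b w z ∂μ ∂μ := by
    rw [integral_integral_swap]
    · rw [← integral_const_mul]
      congr 1; ext z
      have : ∀ w, Complex.exp (I * ((L * Φ z + l z : ℝ) : ℂ)) * b w z =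
          ((ψ (z - w) : ℝ) : ℂ) * (Complex.exp (I * ((L * Φ z + l z : ℝ) : ℂ)) * a z) := by
        intro w; simp only [hb]; ring
      simp_rw [this]
      rw [integral_mul_const, integral_complex_ofReal, integral_sub_left_eq_self (fun w => ψ w)]
    · refine Continuous.integrable_of_hasCompactSupport ?_ ?_
      · simp only [Function.uncurry_def]
        have := hbs.continuous
        fun_prop
      · refine HasCompactSupport.intro (K := W ×ˢ tsupport a)
          ((isCompact_closedBall _ _).prod hac) ?_
        intro y hy
        by_contra h
        obtain ⟨h1, h2⟩ := hbne y.1 y.2 (right_ne_zero_of_mul h)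
        refine hy ⟨?_, subset_tsupport _ h2⟩
        rw [hW, mem_closedBall_zero_iff]
        have : y.1 = y.2 - (y.2 - y.1) := by abel
        rw [this]
        exact (norm_sub_le _ _).trans (add_le_add (hRa _ h2) h1)
  have hbd : ‖∫ w, ∫ z, Complex.exp (I * ((L * Φ z + l z : ℝ) : ℂ)) * b w z ∂μ ∂μ‖ ≤
      (Real.sqrt (CJ * E) * L ^ (-(D : ℝ) / 2)) * μ.real W := by
    rw [← setIntegral_eq_integral_of_forall_compl_eq_zero (s := W)]
    · exact norm_setIntegral_le_of_norm_le_const (isCompact_closedBall _ _).measure_lt_top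
        (fun w _ => hloc L hL l w)
    · intro w hw
      refine integral_eq_zero_of_ae (Filter.Eventually.of_forall fun z => ?_)
      by_contra h
      obtain ⟨h1, h2⟩ := hbne w z (right_ne_zero_of_mul h)
      apply hw
      rw [hW, mem_closedBall_zero_iff]
      have : w = z - (z - w) := by abel
      rw [this]
      exact (norm_sub_le _ _).trans (add_le_add (hRa _ h2) h1)
  rw [← havg, norm_mul, Complex.norm_real, Real.norm_of_nonneg hc0.le] at hbd
  have : ‖∫ z, Complex.exp (I * ((L * Φ z + l z : ℝ) : ℂ)) * a z ∂μ‖ ≤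
      c⁻¹ * ((Real.sqrt (CJ * E) * L ^ (-(D : ℝ) / 2)) * μ.real W) := by
    rw [inv_mul_eq_div, le_div_iff₀ hc0, mul_comm]; exact hbd
  refine this.trans (le_of_eq (by ring))

open scoped ContDiff in
/-- The properties of the symbol that are used in the proof. -/
structure PolyHyp (n m : ℕ) (Pf : Eu n → ℝ) : Prop where
  hn : 2 ≤ n
  hm : 2 ≤ m
  smooth : ContDiff ℝ ∞ Pf
  hom : ∀ (t : ℝ) ξ, Pf (t • ξ) = t ^ m * Pf ξ
  pos : ∀ ξ, ξ ≠ 0 → 0 < Pf ξ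
  nd : ∀ ξ, ξ ≠ 0 → HessDet Pf ξ ≠ 0
  quot : ∃ Q : ℝ × Eu n × Eu n → ℝ, ContDiff ℝ ∞ Q ∧
    ∀ ρ v ξ, Pf (ξ + ρ • v) - Pf ξ = ρ * Q (ρ, v, ξ)

open scoped ContDiff in
lemma poly_smooth {n : ℕ} (P : MvPolynomial (Fin n) ℝ) :
    ContDiff ℝ ∞ (fun ξ : Eu n => MvPolynomial.eval (fun i => ξ i) P) := by
  induction P using MvPolynomial.induction_on with
  | C a => simpa using contDiff_const
  | add p q hp hq => simpa using hp.add hq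
  | mul_X p i hp =>
    simp only [map_mul, MvPolynomial.eval_X]
    exact hp.mul (by fun_prop)

open scoped ContDiff in
lemma poly_quot {n : ℕ} (P : MvPolynomial (Fin n) ℝ) :
    ∃ Q : ℝ × Eu n × Eu n → ℝ, ContDiff ℝ ∞ Q ∧
    ∀ ρ v ξ, MvPolynomial.eval (fun i => (ξ + ρ • v) i) P - MvPolynomial.eval (fun i => ξ i) P =
      ρ * Q (ρ, v, ξ) := by
  induction P using MvPolynomial.induction_on with
  | C a => exact ⟨fun _ => 0, contDiff_const, by simp⟩
  | add p q hp hq =>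
    obtain ⟨Q1, h1, h1'⟩ := hp
    obtain ⟨Q2, h2, h2'⟩ := hq
    refine ⟨fun z => Q1 z + Q2 z, h1.add h2, fun ρ v ξ => ?_⟩
    have a1 := h1' ρ v ξ
    have a2 := h2' ρ v ξ
    simp only [map_add]
    linarith
  | mul_X p i hp =>
    obtain ⟨Q1, h1, h1'⟩ := hp
    refine ⟨fun z => Q1 z * (z.2.2 i + z.1 * z.2.1 i) +
      MvPolynomial.eval (fun i => z.2.2 i) p * z.2.1 i, ?_, fun ρ v ξ => ?_⟩
    · refine (h1.mul ?_).add (((poly_smooth p).comp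
        (f := fun z : ℝ × Eu n × Eu n => z.2.2) (by fun_prop)).mul ?_)
      · fun_prop
      · fun_prop
    · have a1 := h1' ρ v ξ
      simp only [map_mul, MvPolynomial.eval_X]
      have e : (ξ + ρ • v) i = ξ i + ρ * v i := by simp
      rw [e]
      have a2 : MvPolynomial.eval (fun i => (ξ + ρ • v) i) p =
        MvPolynomial.eval (fun i => ξ i) p + ρ * Q1 (ρ, v, ξ) := by linarith
      rw [a2]; ring

lemma poly_hom {n m : ℕ} (P : MvPolynomial (Fin n) ℝ) (hP : P.IsHomogeneous m) (t : ℝ) (ξ : Eu n) :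
    MvPolynomial.eval (fun i => (t • ξ) i) P = t ^ m * MvPolynomial.eval (fun i => ξ i) P := by
  have e : (fun i => (t • ξ) i) = fun i => t * ξ i := by ext i; simp
  rw [e]
  simp only [MvPolynomial.eval_eq]
  rw [Finset.mul_sum]
  refine Finset.sum_congr rfl fun d hd => ?_
  have hdeg : ∑ i, d i = m := by
    have := hP (MvPolynomial.mem_support_iff.1 hd)
    rw [← this]
    simp [Finsupp.weight_apply, Finsupp.sum_fintype]
  simp_rw [mul_pow]
  have e2 : ∏ i ∈ d.support, (t ^ d i * ξ i ^ d i) = t ^ m * ∏ i ∈ d.support, ξ i ^ d i := by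
    rw [Finset.prod_mul_distrib, Finset.prod_pow_eq_pow_sum, ← hdeg]
    congr 2
    exact Finset.sum_subset (Finset.subset_univ _) (fun i _ hi => by simpa using hi)
  rw [e2]; ring

theorem polyHyp_of {n m : ℕ} (hn : 2 ≤ n) (hm : 2 ≤ m)
    (P : MvPolynomial (Fin n) ℝ) (hhom : P.IsHomogeneous m)
    (Pf : EuclideanSpace ℝ (Fin n) → ℝ)
    (hPf : ∀ ξ, Pf ξ = MvPolynomial.eval (fun i => ξ i) P)
    (hell : ∀ ξ : EuclideanSpace ℝ (Fin n), ξ ≠ 0 → 0 < Pf ξ)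
    (hnd : ∀ ξ : EuclideanSpace ℝ (Fin n), ξ ≠ 0 → HessDet Pf ξ ≠ 0) : PolyHyp n m Pf := by
  have e : Pf = fun ξ : Eu n => MvPolynomial.eval (fun i => ξ i) P := funext hPf
  refine ⟨hn, hm, ?_, ?_, hell, hnd, ?_⟩
  · rw [e]; exact poly_smooth P
  · intro t ξ; rw [hPf, hPf]; exact poly_hom P hhom t ξ
  · obtain ⟨Q, h1, h2⟩ := poly_quot P
    exact ⟨Q, h1, fun ρ v ξ => by rw [hPf, hPf]; exact h2 ρ v ξ⟩

lemma euler {n : ℕ} {F : Eu n → ℝ} {ξ : Eu n} (hF : DifferentiableAt ℝ F ξ) (k : ℕ)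
    (h : ∀ t : ℝ, 0 < t → F (t • ξ) = t ^ k * F ξ) : fderiv ℝ F ξ ξ = k * F ξ := by
  have h1 : HasDerivAt (fun t : ℝ => F (t • ξ)) (fderiv ℝ F ξ ξ) 1 := by
    have h2 : HasDerivAt (fun t : ℝ => t • ξ) ((1 : ℝ) • ξ) 1 := (hasDerivAt_id (1 : ℝ)).smul_const ξ
    have h3 : HasFDerivAt F (fderiv ℝ F ξ) ((1 : ℝ) • ξ) := by rw [one_smul]; exact hF.hasFDerivAt
    have := h3.comp_hasDerivAt (1 : ℝ) h2
    rwa [one_smul] at this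
  have h4 : HasDerivAt (fun t : ℝ => t ^ k * F ξ) ((k * 1 ^ (k - 1)) * F ξ) (1 : ℝ) :=
    (hasDerivAt_pow k 1).mul_const _
  have h5 : (fun t : ℝ => F (t • ξ)) =ᶠ[nhds 1] fun t => t ^ k * F ξ := by
    filter_upwards [lt_mem_nhds (zero_lt_one (α := ℝ))] with t ht
    exact h t ht
  have := h1.unique (h4.congr_of_eventuallyEq h5)
  simpa using this

namespace PolyHyp
variable {n m : ℕ} {Pf : Eu n → ℝ}

lemma diff (hP : PolyHyp n m Pf) : Differentiable ℝ Pf := hP.smooth.differentiable (by simp)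

open scoped ContDiff in
lemma fd_smooth (hP : PolyHyp n m Pf) (v : Eu n) : ContDiff ℝ ∞ (fun y => fderiv ℝ Pf y v) :=
  (hP.smooth.fderiv_right (m := ∞) (by simp)).clm_apply contDiff_const

lemma euler1 (hP : PolyHyp n m Pf) (ξ : Eu n) : fderiv ℝ Pf ξ ξ = m * Pf ξ :=
  euler (hP.diff ξ) m (fun t _ => hP.hom t ξ)

lemma fd_hom (hP : PolyHyp n m Pf) (v ξ : Eu n) {t : ℝ} (ht : 0 < t) :
    fderiv ℝ Pf (t • ξ) v = t ^ (m - 1) * fderiv ℝ Pf ξ v := by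
  have h1 : HasFDerivAt (fun y : Eu n => Pf (t • y)) (t • fderiv ℝ Pf (t • ξ)) ξ := by
    have := ((hP.diff (t • ξ)).hasFDerivAt).comp ξ ((hasFDerivAt_id ξ).const_smul t)
    have e : (fderiv ℝ Pf (t • ξ)).comp (t • ContinuousLinearMap.id ℝ (Eu n)) =
        t • fderiv ℝ Pf (t • ξ) := by ext v; simp
    rw [e] at this
    exact this
  have h2 : HasFDerivAt (fun y : Eu n => Pf (t • y)) (t ^ m • fderiv ℝ Pf ξ) ξ := by
    have e : (fun y : Eu n => Pf (t • y)) = fun y => t ^ m * Pf y := by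
      ext y; exact hP.hom t y
    rw [e]
    exact (hP.diff ξ).hasFDerivAt.const_mul _
  have h3 := congrArg (fun L => L v) (h1.unique h2)
  simp only [smul_apply, smul_eq_mul] at h3
  have h4 : t ^ m = t * t ^ (m - 1) := by
    rw [← pow_succ']; congr 1; have := hP.hm; omega
  rw [h4, mul_assoc] at h3
  exact mul_left_cancel₀ ht.ne' h3

lemma euler2 (hP : PolyHyp n m Pf) (v ξ : Eu n) :
    fderiv ℝ (fun y => fderiv ℝ Pf y v) ξ ξ = ((m - 1 : ℕ) : ℝ) * fderiv ℝ Pf ξ v :=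
  euler ((hP.fd_smooth v).differentiable (by simp) ξ) _ (fun _ ht => hP.fd_hom v ξ ht)

lemma hess_inj (hP : PolyHyp n m Pf) {ξ v : Eu n} (hξ : ξ ≠ 0)
    (h : ∀ η, fderiv ℝ (fun y => fderiv ℝ Pf y v) ξ η = 0) : v = 0 := by
  have hdet := hP.nd ξ hξ
  unfold HessDet at hdet
  have hv : v = ∑ j, v j • EuclideanSpace.single j (1 : ℝ) := by
    have := (EuclideanSpace.basisFun (Fin n) ℝ).sum_repr v
    simpa using this.symm
  have h0 := Matrix.eq_zero_of_mulVec_eq_zero hdet (v := fun j => v j) (by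
    ext i
    have h1 := h (EuclideanSpace.single i 1)
    have e1 : (fun y => fderiv ℝ Pf y v) =
        fun y => ∑ j, v j * fderiv ℝ Pf y (EuclideanSpace.single j 1) := by
      ext y
      conv_lhs => rw [hv]
      rw [map_sum]
      simp
    rw [e1, fderiv_fun_sum (fun j _ => ((hP.fd_smooth _).differentiable (by simp) ξ).const_mul _)] at h1
    simp only [Matrix.mulVec, dotProduct, Matrix.of_apply, Pi.zero_apply]
    rw [← h1, sum_apply]
    refine Finset.sum_congr rfl fun j _ => ?_
    rw [fderiv_const_mul ((hP.fd_smooth _).differentiable (by simp) ξ)]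
    simp [mul_comm])
  ext j
  exact congrFun h0 j

lemma even (hP : PolyHyp n m Pf) (ξ : Eu n) : Pf (-ξ) = Pf ξ := by
  have h := hP.hom (-1) ξ
  rw [neg_one_smul] at h
  rcases Nat.even_or_odd m with hm | hm
  · rw [h, hm.neg_one_pow, one_mul]
  · rw [hm.neg_one_pow] at h
    by_cases hξ : ξ = 0
    · simp [hξ]
    · have h1 := hP.pos ξ hξ
      have h2 := hP.pos (-ξ) (neg_ne_zero.2 hξ)
      linarith

lemma zero (hP : PolyHyp n m Pf) : Pf 0 = 0 := by
  have h := hP.hom 0 0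
  have hm := hP.hm
  rw [zero_smul, zero_pow (by omega), zero_mul] at h
  exact h

lemma nonneg (hP : PolyHyp n m Pf) (ξ : Eu n) : 0 ≤ Pf ξ := by
  by_cases hξ : ξ = 0
  · rw [hξ, hP.zero]
  · exact (hP.pos ξ hξ).le

lemma lower (hP : PolyHyp n m Pf) : ∃ c : ℝ, 0 < c ∧ ∀ ξ, c * ‖ξ‖ ^ m ≤ Pf ξ := by
  have hne : (Metric.sphere (0 : Eu n) 1).Nonempty := by
    have hn := hP.hn
    refine ⟨EuclideanSpace.single ⟨0, by omega⟩ 1, by simp⟩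
  obtain ⟨x, hx, hmin⟩ := (isCompact_sphere (0 : Eu n) 1).exists_isMinOn hne
    hP.smooth.continuous.continuousOn
  have hx0 : x ≠ 0 := by
    rintro rfl; simp at hx
  refine ⟨Pf x, hP.pos x hx0, fun ξ => ?_⟩
  by_cases hξ : ξ = 0
  · have hm := hP.hm
    rw [hξ, norm_zero, zero_pow (by omega), mul_zero, hP.zero]
  · have h1 : 0 < ‖ξ‖ := norm_pos_iff.2 hξ
    have h2 : ξ = ‖ξ‖ • (‖ξ‖⁻¹ • ξ) := by rw [smul_smul, mul_inv_cancel₀ h1.ne', one_smul]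
    conv_rhs => rw [h2, hP.hom]
    rw [mul_comm]
    gcongr
    refine hmin ?_
    simp [norm_smul, h1.ne']

lemma compact_sub (hP : PolyHyp n m Pf) (B : ℝ) : ∃ R : ℝ, 0 < R ∧ ∀ ξ, Pf ξ ≤ B → ‖ξ‖ ≤ R := by
  obtain ⟨c, hc, h⟩ := hP.lower
  refine ⟨max 1 (B / c), by positivity, fun ξ hξ => ?_⟩
  by_contra hcon
  rw [not_le, max_lt_iff] at hcon
  have h1 : ‖ξ‖ ≤ ‖ξ‖ ^ m := le_self_pow₀ hcon.1.le (by have := hP.hm; omega)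
  have h2 := h ξ
  have h3 := (div_lt_iff₀ hc).1 hcon.2
  nlinarith

open scoped ContDiff in
theorem osc (hP : PolyHyp n m Pf) {η : ℝ → ℂ} (hη : ContDiff ℝ ∞ η) (hηc : HasCompactSupport η)
    (hη0 : (0 : ℝ) ∉ tsupport η) {χ : Eu n → ℂ} (hχ : ContDiff ℝ ∞ χ) (hχc : HasCompactSupport χ)
    (hχ0 : (0 : Eu n) ∉ tsupport χ) :
    ∃ C : ℝ, 0 ≤ C ∧ ∀ L : ℝ, 0 < L → ∀ (s : ℝ) (x : Eu n),
      ‖∫ z : ℝ × Eu n, Complex.exp (I * ((L * (z.1 * Pf z.2) + (s * z.1 + ⟪x, z.2⟫) : ℝ) : ℂ)) *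
        (η z.1 * χ z.2)‖ ≤ C * L ^ (-((n : ℝ) + 1) / 2) := by
  obtain ⟨Q, hQ, hQe⟩ := hP.quot
  have : (volume : Measure (ℝ × Eu n)).IsAddHaarMeasure :=
    inferInstanceAs ((volume : Measure ℝ).prod (volume : Measure (Eu n))).IsAddHaarMeasure
  set Φ : ℝ × Eu n → ℝ := fun z => z.1 * Pf z.2 with hΦ
  have hPs := hP.smooth
  have hΦs : ContDiff ℝ ∞ Φ := contDiff_fst.mul (hPs.comp contDiff_snd)
  set q : ℝ × (ℝ × Eu n) × (ℝ × Eu n) → ℝ := fun y =>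
    y.2.1.1 * Pf (y.2.2.2 + y.1 • y.2.1.2) + y.2.2.1 * Q (y.1, y.2.1.2, y.2.2.2) with hq
  have hqs : ContDiff ℝ ∞ q := by
    refine ContDiff.add (ContDiff.mul (by fun_prop) (hPs.comp (by fun_prop)))
      (ContDiff.mul (by fun_prop) (hQ.comp (f := fun y : ℝ × (ℝ × Eu n) × (ℝ × Eu n) =>
        (y.1, y.2.1.2, y.2.2.2)) (by fun_prop)))
  have hqe : ∀ ρ om z, Φ (z + ρ • om) - Φ z = ρ * q (ρ, om, z) := by
    rintro ρ ⟨σ, v⟩ ⟨τ, ξ⟩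
    have := hQe ρ v ξ
    simp only [hΦ, hq, Prod.smul_mk, Prod.mk_add_mk, smul_eq_mul]
    linear_combination τ * this
  have hQ0 : ∀ v ξ, Q (0, v, ξ) = fderiv ℝ Pf ξ v := by
    intro v ξ
    have h1 : HasDerivAt (fun ρ : ℝ => Pf (ξ + ρ • v)) (fderiv ℝ Pf ξ v) 0 := by
      have h2 : HasDerivAt (fun t : ℝ => ξ + t • v) ((1 : ℝ) • v) 0 :=
        ((hasDerivAt_id (0 : ℝ)).smul_const v).const_add ξ
      have h3 : HasFDerivAt Pf (fderiv ℝ Pf ξ) (ξ + (0 : ℝ) • v) := by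
        rw [zero_smul, add_zero]; exact (hP.diff ξ).hasFDerivAt
      have := h3.comp_hasDerivAt (0 : ℝ) h2
      rwa [one_smul] at this
    have hd : DifferentiableAt ℝ (fun ρ : ℝ => Q (ρ, v, ξ)) 0 := by
      have : ContDiff ℝ ∞ (fun ρ : ℝ => Q (ρ, v, ξ)) :=
        hQ.comp (f := fun ρ : ℝ => (ρ, v, ξ)) (by fun_prop)
      exact this.differentiable (by simp) 0
    have h4 : HasDerivAt (fun ρ : ℝ => Pf ξ + ρ * Q (ρ, v, ξ))
        (1 * Q (0, v, ξ) + 0 * deriv (fun ρ : ℝ => Q (ρ, v, ξ)) 0) 0 :=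
      ((hasDerivAt_id (0 : ℝ)).mul hd.hasDerivAt).const_add _
    have e : (fun ρ : ℝ => Pf (ξ + ρ • v)) = fun ρ : ℝ => Pf ξ + ρ * Q (ρ, v, ξ) := by
      ext ρ; linarith [hQe ρ v ξ]
    rw [e] at h1
    have := h1.unique h4
    simpa using this.symm
  set a : ℝ × Eu n → ℂ := fun z => η z.1 * χ z.2 with ha
  have has : ContDiff ℝ ∞ a := (hη.comp contDiff_fst).mul (hχ.comp contDiff_snd)
  have hasub : tsupport a ⊆ tsupport η ×ˢ tsupport χ := by
    refine closure_minimal ?_ ((isClosed_tsupport _).prod (isClosed_tsupport _))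
    intro z hz
    exact ⟨subset_tsupport _ (left_ne_zero_of_mul hz), subset_tsupport _ (right_ne_zero_of_mul hz)⟩
  have hac : HasCompactSupport a :=
    HasCompactSupport.of_support_subset_isCompact (hηc.isCompact.prod hχc.isCompact)
      ((subset_tsupport _).trans hasub)
  have hnd : ∀ z ∈ tsupport a, ∀ om : ℝ × Eu n, om ≠ 0 →
      ∃ v, fderiv ℝ q (0, om, z) (0, 0, v) ≠ 0 := by
    rintro ⟨τ, ξ⟩ hz ⟨σ, v⟩ hom
    by_contra hcon
    push Not at hcon
    have hz' := hasub hz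
    have hτ : τ ≠ 0 := by rintro rfl; exact hη0 hz'.1
    have hξ : ξ ≠ 0 := by rintro rfl; exact hχ0 hz'.2
    have key : ∀ τ' η', σ * fderiv ℝ Pf ξ η' + (τ' * fderiv ℝ Pf ξ v +
        τ * fderiv ℝ (fun y => fderiv ℝ Pf y v) ξ η') = 0 := by
      intro τ' η'
      have h1 := hcon (τ', η')
      have h5 := slice_fderiv (X := ℝ) (A := q) hqs 0 ((σ, v), (τ, ξ)) (0, (τ', η'))
      have h6 := slice_fderiv (A := fun u => q (0, u))
        (hqs.comp (f := fun u : (ℝ × Eu n) × (ℝ × Eu n) => ((0 : ℝ), u)) (by fun_prop))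
        (σ, v) (τ, ξ) (τ', η')
      rw [← h5, ← h6] at h1
      have e : (fun w : ℝ × Eu n => q (0, (σ, v), w)) =
          fun w => σ * Pf w.2 + w.1 * fderiv ℝ Pf w.2 v := by
        ext w; simp [hq, hQ0]
      rw [e] at h1
      have d1 : HasFDerivAt (fun w : ℝ × Eu n => Pf w.2)
          ((fderiv ℝ Pf ξ).comp (ContinuousLinearMap.snd ℝ ℝ (Eu n))) (τ, ξ) :=
        (hP.diff ξ).hasFDerivAt.comp (τ, ξ) hasFDerivAt_snd
      have d2 : HasFDerivAt (fun w : ℝ × Eu n => fderiv ℝ Pf w.2 v)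
          ((fderiv ℝ (fun y => fderiv ℝ Pf y v) ξ).comp (ContinuousLinearMap.snd ℝ ℝ (Eu n))) (τ, ξ) :=
        HasFDerivAt.comp (g := fun y => fderiv ℝ Pf y v) (τ, ξ)
          (((hP.fd_smooth v).differentiable (by simp) ξ).hasFDerivAt) hasFDerivAt_snd
      have d3 := (d1.const_mul σ).add ((hasFDerivAt_fst (𝕜 := ℝ) (p := (τ, ξ))).mul d2)
      rw [show (fun w : ℝ × Eu n => σ * Pf w.2 + w.1 * fderiv ℝ Pf w.2 v) =
        (fun w : ℝ × Eu n => σ * Pf w.2) + (Prod.fst * fun w : ℝ × Eu n => fderiv ℝ Pf w.2 v)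
        from rfl, d3.fderiv] at h1
      simp at h1
      linarith
    have k1 : fderiv ℝ Pf ξ v = 0 := by
      have := key 1 0
      simpa using this
    have k2 : σ = 0 := by
      have h := key 0 ξ
      rw [hP.euler1, hP.euler2, k1] at h
      have hp := hP.pos ξ hξ
      have hm : (m : ℝ) ≠ 0 := by have := hP.hm; positivity
      have : σ * (m * Pf ξ) = 0 := by linarith
      rcases mul_eq_zero.1 this with h | h
      · exact h
      · exact absurd h (mul_ne_zero hm hp.ne')
    have k3 : v = 0 := by
      refine hP.hess_inj hξ fun η' => ?_
      have h := key 0 η'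
      rw [k2] at h
      have : τ * fderiv ℝ (fun y => fderiv ℝ Pf y v) ξ η' = 0 := by linarith
      exact (mul_eq_zero.1 this).resolve_left hτ
    exact hom (by rw [k2, k3]; rfl)
  obtain ⟨C, hC0, hC⟩ := statphase volume hΦs hqs hqe has hac hnd
  have hfr : Module.finrank ℝ (ℝ × Eu n) = n + 1 := by
    rw [Module.finrank_prod]; simp [add_comm]
  refine ⟨C, hC0, fun L hL s x => ?_⟩
  have := hC L hL ((s • ContinuousLinearMap.fst ℝ ℝ (Eu n)) +
    (innerSL ℝ x).comp (ContinuousLinearMap.snd ℝ ℝ (Eu n)))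
  rw [hfr] at this
  push_cast at this
  simpa [hΦ, ha] using this

end PolyHyp

/-- one dimensional Fourier integral -/
def Wf (η : ℝ → ℂ) (u : ℝ) : ℂ := ∫ τ : ℝ, Complex.exp (I * ((2 * Real.pi * τ * u : ℝ) : ℂ)) * η τ

lemma Wf_integrand {η : ℝ → ℂ} (hη : Integrable η) (u : ℝ) :
    Integrable (fun τ : ℝ => Complex.exp (I * ((2 * Real.pi * τ * u : ℝ) : ℂ)) * η τ) := by
  refine hη.bdd_mul (c := 1) ?_ (Filter.Eventually.of_forall fun x => (norm_expI _).le)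
  exact Continuous.aestronglyMeasurable (by fun_prop)

lemma Wf_norm_le (η : ℝ → ℂ) (u : ℝ) : ‖Wf η u‖ ≤ ∫ τ, ‖η τ‖ := by
  unfold Wf
  refine (norm_integral_le_integral_norm _).trans (le_of_eq ?_)
  congr 1; funext τ; rw [norm_mul, norm_expI, one_mul]

lemma Wf_eq_schwartz (η : SchwartzMap ℝ ℂ) : Wf η = (FourierTransformInv.fourierInv η : SchwartzMap ℝ ℂ) := by
  funext u
  rw [SchwartzMap.fourierInv_coe, Real.fourierInv_eq']
  unfold Wf
  congr 1; funext τ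
  simp only [smul_eq_mul]
  congr 2
  simp
  ring

open scoped ContDiff in
lemma Wf_props {η : ℝ → ℂ} (hη : ContDiff ℝ ∞ η) (hηc : HasCompactSupport η) :
    Continuous (Wf η) ∧ Integrable (Wf η) ∧ ∫ u, Wf η u = η 0 := by
  have e : ∀ x, (hηc.toSchwartzMap hη) x = η x := fun x => rfl
  have := Wf_eq_schwartz (hηc.toSchwartzMap hη)
  have h2 : Wf (hηc.toSchwartzMap hη) = Wf η := rfl
  rw [h2] at this
  refine ⟨by rw [this]; exact SchwartzMap.continuous _, by rw [this]; exact SchwartzMap.integrable _, ?_⟩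
  have h3 : FourierTransform.fourier (FourierTransformInv.fourierInv (hηc.toSchwartzMap hη)) = hηc.toSchwartzMap hη :=
    FourierTransform.fourier_fourierInv_eq _
  have h4 := congrArg (fun g : SchwartzMap ℝ ℂ => g 0) h3
  simp only [e] at h4
  rw [← h4, SchwartzMap.fourier_coe, Real.fourier_eq', this]
  simp

lemma Wf_scale (η : ℝ → ℂ) (u : ℝ) : Wf (fun τ => η (2 * τ)) (2 * u) = (1 / 2) * Wf η u := by
  unfold Wf
  have := Measure.integral_comp_mul_left (fun τ : ℝ => Complex.exp (I * ((2 * Real.pi * τ * u : ℝ) : ℂ)) * η τ) 2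
  have e : ∀ τ : ℝ, 2 * Real.pi * τ * (2 * u) = 2 * Real.pi * (2 * τ) * u := fun τ => by ring
  simp only [e]
  rw [this]
  simp [abs_of_pos]

namespace PolyHyp
variable {n m : ℕ} {Pf : Eu n → ℝ}

open scoped ContDiff in
lemma kr_piece (hP : PolyHyp n m Pf) {η : ℝ → ℂ} (hη : ContDiff ℝ ∞ η) (hηc : HasCompactSupport η)
    (hη0 : 0 ∉ tsupport η) {χ : Eu n → ℂ} (hχ : ContDiff ℝ ∞ χ) (hχc : HasCompactSupport χ)
    (hχ0 : 0 ∉ tsupport χ) :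
    ∃ C : ℝ, 0 ≤ C ∧ ∀ L : ℝ, 0 < L → ∀ (s : ℝ) (x : Eu n),
      ‖Kr (fun ξ => χ ξ * Wf η (L * (Pf ξ - s))) x‖ ≤ C * L ^ (-((n : ℝ) + 1) / 2) := by
  obtain ⟨C, hC0, hC⟩ := hP.osc hη hηc hη0 hχ hχc hχ0
  refine ⟨C * (2 * Real.pi) ^ (-((n : ℝ) + 1) / 2), by positivity, fun L hL s x => ?_⟩
  have h1 := hC (2 * Real.pi * L) (by positivity) (-(2 * Real.pi * L * s)) x
  rw [Real.mul_rpow (by positivity) hL.le, ← mul_assoc] at h1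
  refine le_trans (le_of_eq ?_) h1
  congr 1
  have hi : Integrable (fun z : ℝ × Eu n => Complex.exp (I * ((2 * Real.pi * L * (z.1 * Pf z.2) + (-(2 * Real.pi * L * s) * z.1 + ⟪x, z.2⟫) : ℝ) : ℂ)) * (η z.1 * χ z.2)) (volume.prod volume) := by
    have h0 : Integrable (fun z : ℝ × Eu n => η z.1 * χ z.2) (volume.prod volume) :=
      (hη.continuous.integrable_of_hasCompactSupport hηc).mul_prod
        (hχ.continuous.integrable_of_hasCompactSupport hχc)
    refine h0.bdd_mul (c := 1) ?_ (Filter.Eventually.of_forall fun x => (norm_expI _).le)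
    have := hP.smooth.continuous
    exact Continuous.aestronglyMeasurable (by fun_prop)
  change _ = ∫ z, _ ∂(volume.prod volume)
  rw [integral_prod_symm _ hi]
  unfold Kr Wf
  congr 1; funext ξ
  dsimp only
  rw [← integral_const_mul, ← integral_const_mul]
  congr 1; funext τ
  have : Complex.exp (I * ((2 * Real.pi * L * (τ * Pf ξ) + (-(2 * Real.pi * L * s) * τ + ⟪x, ξ⟫) : ℝ) : ℂ))
     = Complex.exp (I * (⟪x, ξ⟫ : ℂ)) * Complex.exp (I * ((2 * Real.pi * τ * (L * (Pf ξ - s)) : ℝ) : ℂ)) := by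
    rw [← Complex.exp_add]; congr 1; push_cast; ring
  simp only [this]; ring

end PolyHyp

lemma restr_interp {n : ℕ} {M : Eu n → ℂ} (hM : Integrable M) (hMm : Measurable M) {S0 S1 p : ℝ}
    (hS0 : 0 ≤ S0) (hS1 : 0 ≤ S1) (h0 : ∀ u, ‖Kr M u‖ ≤ S0) (h1 : ∀ ξ, ‖M ξ‖ ≤ S1) (hp1 : 1 < p) (hp2 : p < 2)
    (f h : Eu n → ℂ) (hf : Good f) (hh : Good h) :
    ‖BM M f h‖ ≤ S0 ^ (1 - (2 - 2 / p)) * (S1 * (2 * Real.pi) ^ n) ^ (2 - 2 / p) * nrm p f * nrm p h := by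
  have hp0 : 0 < p := by linarith
  refine rt_BM hM 1 2 1 2 (2 - 2 / p) S0 (S1 * (2 * Real.pi) ^ n) p p le_rfl (by norm_num) le_rfl (by norm_num)
    ?_ ?_ hS0 (by positivity) hp1.le hp1.le (by field_simp; ring) (by field_simp; ring)
    (fun f h hf hh => BM_L1 hM hf hh h0) (fun f h hf hh => BM_L2 hf hh hMm hS1 h1) f h hf hh
  · have : 2 / p < 2 := by rw [div_lt_iff₀ hp0]; linarith
    linarith
  · have : 1 < 2 / p := by rw [lt_div_iff₀ hp0]; linarith
    linarith

lemma BM_add {n : ℕ} {M N f h : Eu n → ℂ} (hM : Integrable M) (hN : Integrable N) (hf : Good f) (hh : Good h) :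
    BM (fun ξ => M ξ + N ξ) f h = BM M f h + BM N f h := by
  unfold BM
  rw [← integral_add (BM_integrable hM hf.int hh.int) (BM_integrable hN hf.int hh.int)]
  congr 1; funext ξ; ring

open scoped ContDiff in
lemma exists_bump1 : ∃ η : ℝ → ℂ, ContDiff ℝ ∞ η ∧ HasCompactSupport η ∧ (∀ x, |x| ≤ 1 → η x = 1) := by
  let b : ContDiffBump (0 : ℝ) := ⟨1, 2, by norm_num, by norm_num⟩
  refine ⟨fun x => (b x : ℂ), ?_, ?_, ?_⟩
  · exact Complex.ofRealCLM.contDiff.comp b.contDiff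
  · exact b.hasCompactSupport.comp_left (g := fun x : ℝ => (x : ℂ)) (by simp)
  · intro x hx
    have : b x = 1 := b.one_of_mem_closedBall (by simpa [Metric.mem_closedBall] using hx)
    simp [this]

namespace PolyHyp
variable {n m : ℕ} {Pf : Eu n → ℝ}

lemma piece_int (hP : PolyHyp n m Pf) {W : ℝ → ℂ} (hW : Continuous W)
    {χ : Eu n → ℂ} (hχ : Continuous χ) (hχc : HasCompactSupport χ) (L s : ℝ) :
    Integrable (fun ξ => χ ξ * (L * W (L * (Pf ξ - s)))) := by
  have := hP.smooth.continuous
  refine Continuous.integrable_of_hasCompactSupport (by fun_prop) hχc.mul_right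

open scoped ContDiff in
lemma piece_bound (hP : PolyHyp n m Pf) {η : ℝ → ℂ} (hη : ContDiff ℝ ∞ η) (hηc : HasCompactSupport η)
    (hη0 : 0 ∉ tsupport η) {χ : Eu n → ℂ} (hχ : ContDiff ℝ ∞ χ) (hχc : HasCompactSupport χ)
    (hχ0 : 0 ∉ tsupport χ) {p : ℝ} (hp1 : 1 < p) (hp2 : p < 2) :
    ∃ C : ℝ, 0 ≤ C ∧ ∀ L : ℝ, 0 < L → ∀ (s : ℝ) (f h : Eu n → ℂ), Good f → Good h →
      ‖BM (fun ξ => χ ξ * (L * Wf η (L * (Pf ξ - s)))) f h‖ ≤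
        C * L ^ (1 - ((n : ℝ) + 1) / 2 * (2 / p - 1)) * nrm p f * nrm p h := by
  obtain ⟨C, hC0, hC⟩ := hP.kr_piece hη hηc hη0 hχ hχc hχ0
  obtain ⟨X, hX⟩ := hχ.continuous.bounded_above_of_compact_support hχc
  have hX0 : 0 ≤ X := (norm_nonneg _).trans (hX 0)
  set E := ∫ τ, ‖η τ‖ with hE
  have hE0 : 0 ≤ E := integral_nonneg fun _ => norm_nonneg _
  refine ⟨C ^ (1 - (2 - 2 / p)) * (X * E * (2 * Real.pi) ^ n) ^ (2 - 2 / p), by positivity,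
    fun L hL s f h hf hh => ?_⟩
  have hWc := (Wf_props hη hηc).1
  have hi := hP.piece_int hWc hχ.continuous hχc L s
  have hcont : Continuous (fun ξ => χ ξ * (L * Wf η (L * (Pf ξ - s)))) := by
    have := hP.smooth.continuous
    have := hχ.continuous
    fun_prop
  have k0 : ∀ u, ‖Kr (fun ξ => χ ξ * (L * Wf η (L * (Pf ξ - s)))) u‖ ≤ C * L ^ (1 - ((n : ℝ) + 1) / 2) := by
    intro u
    have e : Kr (fun ξ => χ ξ * (L * Wf η (L * (Pf ξ - s)))) u
        = L * Kr (fun ξ => χ ξ * Wf η (L * (Pf ξ - s))) u := by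
      unfold Kr
      rw [← integral_const_mul]
      congr 1; funext ξ; ring
    rw [e, norm_mul, Complex.norm_real, Real.norm_of_nonneg hL.le]
    have h2 := hC L hL s u
    have h3 : L ^ (1 - ((n : ℝ) + 1) / 2) = L * L ^ (-((n : ℝ) + 1) / 2) := by
      rw [show 1 - ((n : ℝ) + 1) / 2 = 1 + -((n : ℝ) + 1) / 2 by ring, Real.rpow_add hL, Real.rpow_one]
    rw [h3]
    calc L * _ ≤ L * (C * L ^ (-((n : ℝ) + 1) / 2)) := by gcongr
      _ = _ := by ring
  have k1 : ∀ ξ, ‖χ ξ * (L * Wf η (L * (Pf ξ - s)))‖ ≤ L * (X * E) := by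
    intro ξ
    rw [norm_mul, norm_mul, Complex.norm_real, Real.norm_of_nonneg hL.le]
    calc ‖χ ξ‖ * (L * ‖Wf η (L * (Pf ξ - s))‖) ≤ X * (L * E) := by
          gcongr
          · exact hX ξ
          · exact Wf_norm_le _ _
      _ = _ := by ring
  refine (restr_interp hi hcont.measurable (by positivity) (by positivity) k0 k1 hp1 hp2 f h hf hh).trans (le_of_eq ?_)
  congr 2
  rw [Real.mul_rpow hC0 (by positivity), ← Real.rpow_mul hL.le, show L * (X * E) * (2 * Real.pi) ^ n = L * (X * E * (2 * Real.pi) ^ n) by ring,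
    Real.mul_rpow hL.le (by positivity)]
  have : L ^ (1 - ((n : ℝ) + 1) / 2 * (2 / p - 1)) = L ^ ((1 - ((n : ℝ) + 1) / 2) * (1 - (2 - 2 / p))) * L ^ (2 - 2 / p) := by
    rw [← Real.rpow_add hL]; congr 1; ring
  rw [this]; ring

open scoped ContDiff in
lemma restr_uniform (hP : PolyHyp n m Pf) {η : ℝ → ℂ} (hη : ContDiff ℝ ∞ η) (hηc : HasCompactSupport η)
    (hη1 : ∀ x, |x| ≤ 1 → η x = 1) {χ : Eu n → ℂ} (hχ : ContDiff ℝ ∞ χ) (hχc : HasCompactSupport χ)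
    (hχ0 : 0 ∉ tsupport χ) {p : ℝ} (hp1 : 1 < p) (hp2 : p < 2 * ((n : ℝ) + 1) / ((n : ℝ) + 3)) :
    ∃ C : ℝ, 0 ≤ C ∧ ∀ (l : ℕ) (s : ℝ) (f h : Eu n → ℂ), Good f → Good h →
      ‖BM (fun ξ => χ ξ * (((2 ^ l : ℝ) : ℂ) * Wf η ((2 ^ l : ℝ) * (Pf ξ - s)))) f h‖ ≤
        C * nrm p f * nrm p h := by
  have hp0 : 0 < p := by linarith
  have hn0 : (0 : ℝ) ≤ n := Nat.cast_nonneg n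
  have hp2' : p * (n + 3) < 2 * ((n : ℝ) + 1) := by rwa [lt_div_iff₀ (by positivity)] at hp2
  have hlt2 : p < 2 := by nlinarith
  set κ := ((n : ℝ) + 1) / 2 * (2 / p - 1) - 1 with hκ
  have hκ0 : 0 < κ := by
    rw [hκ, show ((n : ℝ) + 1) / 2 * (2 / p - 1) - 1 = (2 * (n + 1) - p * (n + 3)) / (2 * p) by field_simp; ring]
    apply div_pos <;> nlinarith
  -- the annular piece
  set η' : ℝ → ℂ := fun τ => η τ - η (2 * τ) with hη'
  have hs : ContDiff ℝ ∞ (fun τ : ℝ => η (2 * τ)) := hη.comp (f := fun τ : ℝ => 2 * τ) (by fun_prop)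
  have hsc : HasCompactSupport (fun τ : ℝ => η (2 * τ)) :=
    hηc.comp_homeomorph (Homeomorph.mulLeft₀ (2 : ℝ) (by norm_num))
  have hη's : ContDiff ℝ ∞ η' := hη.sub hs
  have hη'c : HasCompactSupport η' := hηc.sub hsc
  have hη'0 : 0 ∉ tsupport η' := by
    rw [notMem_tsupport_iff_eventuallyEq]
    filter_upwards [Metric.ball_mem_nhds (0 : ℝ) (show (0 : ℝ) < 1 / 2 by norm_num)] with x hx
    have hx' : |x| < 1 / 2 := by simpa using hx
    have a1 := hη1 x (by linarith)
    have a2 := hη1 (2 * x) (by rw [abs_mul, abs_of_pos (by norm_num : (0 : ℝ) < 2)]; linarith)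
    simp [hη', a1, a2]
  obtain ⟨B, hB0, hB⟩ := hP.piece_bound hη's hη'c hη'0 hχ hχc hχ0 hp1 hlt2
  obtain ⟨X, hX⟩ := hχ.continuous.bounded_above_of_compact_support hχc
  have hX0 : 0 ≤ X := (norm_nonneg _).trans (hX 0)
  set E := ∫ τ, ‖η τ‖ with hE
  have hE0 : 0 ≤ E := integral_nonneg fun _ => norm_nonneg _
  have hWc := (Wf_props hη hηc).1
  have hWc' := (Wf_props hη's hη'c).1
  have hχi : Integrable χ := hχ.continuous.integrable_of_hasCompactSupport hχc
  set V := ∫ ξ, ‖χ ξ‖ with hV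
  have hV0 : 0 ≤ V := integral_nonneg fun _ => norm_nonneg _
  set A := (V * E) ^ (1 - (2 - 2 / p)) * (X * E * (2 * Real.pi) ^ n) ^ (2 - 2 / p) with hA
  have hA0 : 0 ≤ A := by positivity
  set q : ℝ := 2 ^ (-κ) with hq
  have hq0 : 0 ≤ q := by positivity
  have hq1 : q < 1 := Real.rpow_lt_one_of_one_lt_of_neg (by norm_num) (by linarith)
  have key : ∀ (l : ℕ) (s : ℝ) (f h : Eu n → ℂ), Good f → Good h →
      ‖BM (fun ξ => χ ξ * (((2 ^ l : ℝ) : ℂ) * Wf η ((2 ^ l : ℝ) * (Pf ξ - s)))) f h‖ ≤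
        (A + B * ∑ j ∈ Finset.range l, q ^ (j + 1)) * nrm p f * nrm p h := by
    intro l
    induction l with
    | zero =>
      intro s f h hf hh
      have hi := hP.piece_int hWc hχ.continuous hχc 1 s
      have hcont : Continuous (fun ξ => χ ξ * (((1 : ℝ) : ℂ) * Wf η (1 * (Pf ξ - s)))) := by
        have := hP.smooth.continuous
        have := hχ.continuous
        fun_prop
      have k1 : ∀ ξ, ‖χ ξ * (((1 : ℝ) : ℂ) * Wf η (1 * (Pf ξ - s)))‖ ≤ ‖χ ξ‖ * E := by
        intro ξ
        rw [norm_mul, norm_mul]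
        simp only [Complex.norm_real, norm_one, one_mul]
        gcongr; exact Wf_norm_le _ _
      have k0 : ∀ u, ‖Kr (fun ξ => χ ξ * (((1 : ℝ) : ℂ) * Wf η (1 * (Pf ξ - s)))) u‖ ≤ V * E := by
        intro u
        refine (Kr_norm_le _ _).trans ?_
        rw [hV, ← integral_mul_const]
        exact integral_mono hi.norm (hχi.norm.mul_const _) k1
      have := restr_interp hi hcont.measurable (by positivity) (show 0 ≤ X * E by positivity) k0
        (fun ξ => (k1 ξ).trans (by gcongr; exact hX ξ)) hp1 hlt2 f h hf hh
      simpa using this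
    | succ l ih =>
      intro s f h hf hh
      have hL : (0 : ℝ) < 2 ^ (l + 1) := by positivity
      have e : (fun ξ => χ ξ * (((2 ^ (l + 1) : ℝ) : ℂ) * Wf η ((2 ^ (l + 1) : ℝ) * (Pf ξ - s)))) =
          fun ξ => χ ξ * (((2 ^ l : ℝ) : ℂ) * Wf η ((2 ^ l : ℝ) * (Pf ξ - s))) +
            χ ξ * (((2 ^ (l + 1) : ℝ) : ℂ) * Wf η' ((2 ^ (l + 1) : ℝ) * (Pf ξ - s))) := by
        funext ξ
        have h1 : Wf η' ((2 ^ (l + 1) : ℝ) * (Pf ξ - s)) = Wf η ((2 ^ (l + 1) : ℝ) * (Pf ξ - s))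
            - (1 / 2) * Wf η ((2 ^ l : ℝ) * (Pf ξ - s)) := by
          rw [← Wf_scale, show (2 : ℝ) * (2 ^ l * (Pf ξ - s)) = 2 ^ (l + 1) * (Pf ξ - s) by ring]
          rw [hη']
          unfold Wf
          rw [← integral_sub (Wf_integrand (hη.continuous.integrable_of_hasCompactSupport hηc) _)
            (Wf_integrand (hs.continuous.integrable_of_hasCompactSupport hsc) _)]
          congr 1; funext τ; ring
        rw [h1]; push_cast; ring
      rw [e, BM_add (hP.piece_int hWc hχ.continuous hχc _ s) (hP.piece_int hWc' hχ.continuous hχc _ s) hf hh]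
      have h2 := hB _ hL s f h hf hh
      have h3 : ((2 : ℝ) ^ (l + 1)) ^ (1 - ((n : ℝ) + 1) / 2 * (2 / p - 1)) = q ^ (l + 1) := by
        rw [show 1 - ((n : ℝ) + 1) / 2 * (2 / p - 1) = -κ by rw [hκ]; ring, hq, ← Real.rpow_natCast,
          ← Real.rpow_mul (by norm_num), ← Real.rpow_natCast, ← Real.rpow_mul (by norm_num), mul_comm]
      rw [h3] at h2
      refine (norm_add_le _ _).trans ((add_le_add (ih s f h hf hh) h2).trans (le_of_eq ?_))
      rw [Finset.sum_range_succ]; ring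
  refine ⟨A + B * (1 - q)⁻¹, by have : 0 < 1 - q := by linarith
                                positivity, fun l s f h hf hh => (key l s f h hf hh).trans ?_⟩
  have hsum : ∑ j ∈ Finset.range l, q ^ (j + 1) ≤ (1 - q)⁻¹ := by
    rw [← tsum_geometric_of_lt_one hq0 hq1]
    refine le_trans ?_ ((summable_geometric_of_lt_one hq0 hq1).sum_le_tsum (Finset.range l) fun i _ => by positivity)
    refine Finset.sum_le_sum fun i _ => ?_
    rw [pow_succ]
    exact mul_le_of_le_one_right (by positivity) hq1.le
  have := nrm_nonneg p f
  have := nrm_nonneg p h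
  gcongr

end PolyHyp

lemma conv_subst (φ : ℝ → ℝ) (W : ℝ → ℂ) {L : ℝ} (hL : 0 < L) (u : ℝ) :
    ∫ s, (φ s : ℂ) * (L * W (L * (u - s))) = ∫ t, (φ (u - t / L) : ℂ) * W t := by
  have h1 := integral_sub_left_eq_self (fun s => (φ s : ℂ) * (L * W (L * (u - s)))) volume u
  rw [← h1]
  have h2 := Measure.integral_comp_mul_left (fun t : ℝ => (φ (u - t / L) : ℂ) * W t) L
  have h3 : (fun x => (φ (u - x) : ℂ) * (L * W (L * (u - (u - x))))) =
      fun x => (L : ℂ) * ((φ (u - (L * x) / L) : ℂ) * W (L * x)) := by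
    funext x
    rw [mul_div_cancel_left₀ _ hL.ne', sub_sub_cancel]; ring
  rw [h3, integral_const_mul, h2, abs_of_pos (by positivity)]
  rw [Complex.real_smul, ← mul_assoc, ← Complex.ofReal_mul, mul_inv_cancel₀ hL.ne']
  simp

lemma conv_norm (φ : ℝ → ℝ) {W : ℝ → ℂ} (hW : Integrable W) {S : ℝ} (hφ : ∀ t, |φ t| ≤ S) (L u : ℝ) :
    ‖∫ t, (φ (u - t / L) : ℂ) * W t‖ ≤ S * ∫ t, ‖W t‖ := by
  rw [← integral_const_mul]
  refine norm_integral_le_of_norm_le (hW.norm.const_mul _) (Filter.Eventually.of_forall fun t => ?_)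
  rw [norm_mul, Complex.norm_real]
  gcongr; exact hφ _

lemma conv_tendsto {φ : ℝ → ℝ} (hφc : Continuous φ) {W : ℝ → ℂ} (hW : Integrable W) (hW1 : ∫ t, W t = 1)
    {S : ℝ} (hφ : ∀ t, |φ t| ≤ S) (u : ℝ) :
    Filter.Tendsto (fun l : ℕ => ∫ t, (φ (u - t / (2 ^ l : ℝ)) : ℂ) * W t) Filter.atTop (nhds (φ u : ℂ)) := by
  have e : (φ u : ℂ) = ∫ t, (φ u : ℂ) * W t := by rw [integral_const_mul, hW1, mul_one]
  rw [e]
  refine tendsto_integral_of_dominated_convergence (fun t => S * ‖W t‖) (fun l => ?_) (hW.norm.const_mul _) ?_ ?_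
  · exact AEStronglyMeasurable.mul (Continuous.aestronglyMeasurable (by fun_prop)) hW.1
  · intro l
    refine Filter.Eventually.of_forall fun t => ?_
    rw [norm_mul, Complex.norm_real]
    gcongr; exact hφ _
  · refine Filter.Eventually.of_forall fun t => ?_
    refine Filter.Tendsto.mul_const _ ?_
    have h1 : Filter.Tendsto (fun l : ℕ => u - t / (2 ^ l : ℝ)) Filter.atTop (nhds (u - 0)) := by
      refine tendsto_const_nhds.sub ?_
      exact Filter.Tendsto.const_div_atTop (tendsto_pow_atTop_atTop_of_one_lt (by norm_num)) _
    rw [sub_zero] at h1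
    exact (Complex.continuous_ofReal.tendsto _).comp ((hφc.tendsto u).comp h1)

namespace PolyHyp
variable {n m : ℕ} {Pf : Eu n → ℝ}

open scoped ContDiff in
/-- Stein-Tomas type restriction estimate for the level sets of `P`. -/
theorem restriction (hP : PolyHyp n m Pf) {χ : Eu n → ℂ} (hχ : ContDiff ℝ ∞ χ) (hχc : HasCompactSupport χ)
    (hχ0 : 0 ∉ tsupport χ) {p : ℝ} (hp1 : 1 < p) (hp2 : p < 2 * ((n : ℝ) + 1) / ((n : ℝ) + 3)) :
    ∃ C : ℝ, 0 ≤ C ∧ ∀ φ : ℝ → ℝ, Continuous φ → HasCompactSupport φ → ∀ f : Eu n → ℂ, Good f →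
      ‖∫ ξ, (φ (Pf ξ) : ℂ) * χ ξ * ((‖FT f ξ‖ ^ 2 : ℝ) : ℂ)‖ ≤ C * (∫ s, |φ s|) * nrm p f ^ 2 := by
  obtain ⟨η, hη, hηc, hη1⟩ := exists_bump1
  obtain ⟨C, hC0, hC⟩ := hP.restr_uniform hη hηc hη1 hχ hχc hχ0 hp1 hp2
  refine ⟨C, hC0, fun φ hφ hφc f hf => ?_⟩
  obtain ⟨hWc, hWi, hW1⟩ := Wf_props hη hηc
  rw [hη1 0 (by simp)] at hW1
  obtain ⟨S, hS⟩ := hφ.bounded_above_of_compact_support hφc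
  have hS' : ∀ t, |φ t| ≤ S := hS
  have hPc := hP.smooth.continuous
  have hχi : Integrable χ := hχ.continuous.integrable_of_hasCompactSupport hχc
  have hφi : Integrable φ := hφ.integrable_of_hasCompactSupport hφc
  set h : Eu n → ℂ := fun x => (starRingEnd ℂ) (f x) with hh
  have hhg : Good h := hf.star
  set G : Eu n → ℂ := fun ξ => χ ξ * FT f ξ * FT h (-ξ) with hG
  have hGi : Integrable G := BM_integrable hχi hf.int hhg.int
  set a : ℕ → ℂ := fun l => ∫ s, (φ s : ℂ) * BM (fun ξ => χ ξ * (((2 ^ l : ℝ) : ℂ) * Wf η ((2 ^ l : ℝ) * (Pf ξ - s)))) f h with ha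
  have ha1 : ∀ l, ‖a l‖ ≤ C * (∫ s, |φ s|) * nrm p f ^ 2 := by
    intro l
    have e : C * (∫ s, |φ s|) * nrm p f ^ 2 = ∫ s, |φ s| * (C * nrm p f * nrm p h) := by
      rw [integral_mul_const, hh, nrm_star]; ring
    rw [e]
    refine norm_integral_le_of_norm_le (hφi.abs.mul_const _) (Filter.Eventually.of_forall fun t => ?_)
    rw [norm_mul, Complex.norm_real, Real.norm_eq_abs]
    gcongr
    exact hC l t f h hf hhg
  have ha2 : ∀ l, a l = ∫ ξ, G ξ * ∫ t, (φ (Pf ξ - t / (2 ^ l : ℝ)) : ℂ) * Wf η t := by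
    intro l
    have hL : (0 : ℝ) < 2 ^ l := by positivity
    have hi : Integrable (fun z : ℝ × Eu n => ((2 ^ l : ℝ) * Wf η ((2 ^ l : ℝ) * (Pf z.2 - z.1))) * ((φ z.1 : ℂ) * G z.2)) (volume.prod volume) := by
      have h0 : Integrable (fun z : ℝ × Eu n => (φ z.1 : ℂ) * G z.2) (volume.prod volume) :=
        hφi.ofReal.mul_prod hGi
      refine h0.bdd_mul (c := 2 ^ l * ∫ τ, ‖η τ‖) ?_ (Filter.Eventually.of_forall fun x => ?_)
      · exact Continuous.aestronglyMeasurable (by fun_prop)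
      · rw [norm_mul, Complex.norm_real, Real.norm_of_nonneg hL.le]
        gcongr; exact Wf_norm_le _ _
    have h1 : a l = ∫ s, ∫ ξ, ((2 ^ l : ℝ) * Wf η ((2 ^ l : ℝ) * (Pf ξ - s))) * ((φ s : ℂ) * G ξ) := by
      simp only [ha]
      congr 1; funext s
      unfold BM
      rw [← integral_const_mul]
      congr 1; funext ξ; simp only [hG]; ring
    rw [h1, integral_integral_swap hi]
    congr 1; funext ξ
    rw [← conv_subst φ (Wf η) hL, ← integral_const_mul]
    congr 1; funext s; ring
  have hlim : Filter.Tendsto a Filter.atTop (nhds (∫ ξ, G ξ * (φ (Pf ξ) : ℂ))) := by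
    rw [funext ha2]
    refine tendsto_integral_of_dominated_convergence (fun ξ => ‖G ξ‖ * (S * ∫ t, ‖Wf η t‖)) (fun l => ?_)
      (hGi.norm.mul_const _) ?_ ?_
    · refine hGi.1.mul ?_
      refine Continuous.aestronglyMeasurable ?_
      refine continuous_of_dominated (bound := fun t => S * ‖Wf η t‖) ?_ ?_ (hWi.norm.const_mul _) ?_
      · intro x
        exact Continuous.aestronglyMeasurable (by fun_prop)
      · intro x
        refine Filter.Eventually.of_forall fun t => ?_
        rw [norm_mul, Complex.norm_real]
        gcongr; exact hS' _
      · refine Filter.Eventually.of_forall fun t => ?_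
        fun_prop
    · intro l
      refine Filter.Eventually.of_forall fun ξ => ?_
      rw [norm_mul]
      gcongr
      exact conv_norm φ hWi hS' _ _
    · refine Filter.Eventually.of_forall fun ξ => ?_
      exact (conv_tendsto hφ hWi hW1 hS' (Pf ξ)).const_mul _
  have hfin := le_of_tendsto hlim.norm (Filter.Eventually.of_forall ha1)
  have e1 : (∫ ξ, G ξ * (φ (Pf ξ) : ℂ)) = ∫ ξ, (φ (Pf ξ) : ℂ) * χ ξ * ((‖FT f ξ‖ ^ 2 : ℝ) : ℂ) := by
    rw [show (∫ ξ, G ξ * (φ (Pf ξ) : ℂ)) = BM (fun ξ => (φ (Pf ξ) : ℂ) * χ ξ) f h by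
      unfold BM; congr 1; funext ξ; simp only [hG]; ring]
    rw [hh, BM_star]
  rwa [e1] at hfin

end PolyHyp

open scoped ContDiff in
lemma Kr_ibp {n : ℕ} {g : Eu n → ℂ} (hg : ContDiff ℝ ∞ g) (hgc : HasCompactSupport g) (v u : Eu n) :
    |⟪u, v⟫| * ‖Kr g u‖ = ‖Kr (fun ξ => fderiv ℝ g ξ v) u‖ := by
  have hd : Differentiable ℝ g := hg.differentiable (by simp)
  have hfc : Continuous (fun ξ => fderiv ℝ g ξ v) := (hg.continuous_fderiv (by simp)).clm_apply continuous_const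
  have hfs : HasCompactSupport (fun ξ => fderiv ℝ g ξ v) := by
    exact hgc.fderiv_apply (𝕜 := ℝ) v
  have hgi : Integrable g := hg.continuous.integrable_of_hasCompactSupport hgc
  have hfi : Integrable (fun ξ => fderiv ℝ g ξ v) := hfc.integrable_of_hasCompactSupport hfs
  have he : ∀ ξ, HasFDerivAt (fun ξ : Eu n => Complex.exp (I * ((⟪u, ξ⟫ : ℝ) : ℂ)))
      (Complex.exp (I * ((⟪u, ξ⟫ : ℝ) : ℂ)) • (I • (Complex.ofRealCLM.comp (innerSL ℝ u)))) ξ := by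
    intro ξ
    have h1 : HasFDerivAt (fun ξ : Eu n => ((⟪u, ξ⟫ : ℝ) : ℂ)) (Complex.ofRealCLM.comp (innerSL ℝ u)) ξ :=
      (Complex.ofRealCLM.comp (innerSL ℝ u)).hasFDerivAt
    exact (h1.const_mul I).cexp
  have h1 : ∀ ξ, fderiv ℝ (fun ξ : Eu n => Complex.exp (I * ((⟪u, ξ⟫ : ℝ) : ℂ))) ξ v =
      Complex.exp (I * ((⟪u, ξ⟫ : ℝ) : ℂ)) * (I * (⟪u, v⟫ : ℝ)) := by
    intro ξ; rw [(he ξ).fderiv]; simp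
  have key := integral_mul_fderiv_eq_neg_fderiv_mul_of_integrable (μ := (volume : Measure (Eu n)))
    (f := fun ξ : Eu n => Complex.exp (I * ((⟪u, ξ⟫ : ℝ) : ℂ))) (g := g) (v := v) (𝕜 := ℂ)
    (by simp only [h1]
        have := (Kr_integrand_int hgi u).const_mul (I * (⟪u, v⟫ : ℝ))
        refine this.congr (Filter.Eventually.of_forall fun ξ => ?_)
        simp only; ring)
    (Kr_integrand_int hfi u) (Kr_integrand_int hgi u) (fun ξ _ => (he ξ).differentiableAt) (fun ξ _ => hd ξ)
  simp only [h1] at key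
  have e2 : (∫ ξ, Complex.exp (I * ((⟪u, ξ⟫ : ℝ) : ℂ)) * (I * (⟪u, v⟫ : ℝ)) * g ξ) = (I * (⟪u, v⟫ : ℝ)) * Kr g u := by
    unfold Kr; rw [← integral_const_mul]; congr 1; funext ξ; ring
  rw [e2] at key
  have : Kr (fun ξ => fderiv ℝ g ξ v) u = -((I * (⟪u, v⟫ : ℝ)) * Kr g u) := key
  rw [this, norm_neg, norm_mul, norm_mul, Complex.norm_I, Complex.norm_real, Real.norm_eq_abs, one_mul]

lemma Kr_add {n : ℕ} {M N : Eu n → ℂ} (hM : Integrable M) (hN : Integrable N) (u : Eu n) :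
    Kr (fun ξ => M ξ + N ξ) u = Kr M u + Kr N u := by
  unfold Kr
  rw [← integral_add (Kr_integrand_int hM u) (Kr_integrand_int hN u)]
  congr 1; funext ξ; ring

lemma Kr_smul {n : ℕ} (c : ℂ) (M : Eu n → ℂ) (u : Eu n) :
    Kr (fun ξ => c * M ξ) u = c * Kr M u := by
  unfold Kr
  rw [← integral_const_mul]
  congr 1; funext ξ; ring

lemma exists_coord {n : ℕ} (hn : 0 < n) (u : Eu n) : ∃ i : Fin n, ‖u‖ ≤ n * |⟪u, EuclideanSpace.single i (1 : ℝ)⟫| := by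
  have h1 : ‖u‖ ≤ ∑ i, |⟪u, EuclideanSpace.single i (1 : ℝ)⟫| := by
    conv_lhs => rw [← (EuclideanSpace.basisFun (Fin n) ℝ).sum_repr u]
    refine (norm_sum_le _ _).trans (Finset.sum_le_sum fun i _ => ?_)
    rw [norm_smul]
    simp [EuclideanSpace.inner_single_right]
  have hn' : (0 : ℝ) < n := by exact_mod_cast hn
  have h2 : ∑ _i : Fin n, ‖u‖ / n ≤ ∑ i, |⟪u, EuclideanSpace.single i (1 : ℝ)⟫| := by
    simpa [mul_div_cancel₀ _ hn'.ne'] using h1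
  have : Nonempty (Fin n) := ⟨⟨0, hn⟩⟩
  obtain ⟨i, -, hi⟩ := Finset.exists_le_of_sum_le Finset.univ_nonempty h2
  exact ⟨i, by rwa [div_le_iff₀' hn'] at hi⟩

namespace PolyHyp
variable {n m : ℕ} {Pf : Eu n → ℝ}

open scoped ContDiff in
lemma ker_smooth (hP : PolyHyp n m Pf) {φ : ℝ → ℂ} (hφ : ContDiff ℝ ∞ φ) {a : Eu n → ℂ} (ha : ContDiff ℝ ∞ a)
    (Λ : ℝ) : ContDiff ℝ ∞ (fun ξ => φ (Λ * (1 - Pf ξ)) * a ξ) := by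
  have := hP.smooth
  exact (hφ.comp (f := fun ξ => Λ * (1 - Pf ξ)) (by fun_prop)).mul ha

open scoped ContDiff in
lemma ker_dir (hP : PolyHyp n m Pf) (v : Eu n) (N : ℕ) : ∀ {φ : ℝ → ℂ}, ContDiff ℝ ∞ φ → HasCompactSupport φ →
    ∀ {a : Eu n → ℂ}, ContDiff ℝ ∞ a → HasCompactSupport a →
    ∃ C : ℝ, 0 ≤ C ∧ ∀ Λ : ℝ, 1 ≤ Λ → ∀ u : Eu n,
      |⟪u, v⟫| ^ N * ‖Kr (fun ξ => φ (Λ * (1 - Pf ξ)) * a ξ) u‖ ≤ C * Λ ^ N := by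
  induction N with
  | zero =>
    intro φ hφ hφc a ha hac
    obtain ⟨S, hS⟩ := hφ.continuous.bounded_above_of_compact_support hφc
    have hS0 : 0 ≤ S := (norm_nonneg _).trans (hS 0)
    have hai : Integrable a := ha.continuous.integrable_of_hasCompactSupport hac
    refine ⟨S * ∫ ξ, ‖a ξ‖, by positivity, fun Λ _ u => ?_⟩
    rw [pow_zero, pow_zero, one_mul, mul_one]
    refine (Kr_norm_le _ _).trans ?_
    rw [← integral_const_mul]
    refine integral_mono_of_nonneg (Filter.Eventually.of_forall fun _ => norm_nonneg _) (hai.norm.const_mul _)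
      (Filter.Eventually.of_forall fun ξ => ?_)
    dsimp only
    rw [norm_mul]
    gcongr; exact hS _
  | succ N ih =>
    intro φ hφ hφc a ha hac
    have hφ' : ContDiff ℝ ∞ (deriv φ) := (contDiff_infty_iff_deriv.1 hφ).2
    have hφ'c : HasCompactSupport (deriv φ) := hφc.deriv
    have hPv := hP.fd_smooth v
    have ha1 : ContDiff ℝ ∞ (fun ξ => ((fderiv ℝ Pf ξ v : ℝ) : ℂ) * a ξ) :=
      (Complex.ofRealCLM.contDiff.comp hPv).mul ha
    have ha1c : HasCompactSupport (fun ξ => ((fderiv ℝ Pf ξ v : ℝ) : ℂ) * a ξ) := hac.mul_left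
    have ha2 : ContDiff ℝ ∞ (fun ξ => fderiv ℝ a ξ v) :=
      (contDiff_infty_iff_fderiv.1 ha).2.clm_apply contDiff_const
    have ha2c : HasCompactSupport (fun ξ => fderiv ℝ a ξ v) := hac.fderiv_apply (𝕜 := ℝ) v
    obtain ⟨C1, hC1, h1⟩ := ih hφ' hφ'c ha1 ha1c
    obtain ⟨C2, hC2, h2⟩ := ih hφ hφc ha2 ha2c
    refine ⟨C1 + C2, by positivity, fun Λ hΛ u => ?_⟩
    have hΛ0 : 0 < Λ := by linarith
    have hs := hP.ker_smooth hφ ha Λ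
    have hsc : HasCompactSupport (fun ξ => φ (Λ * (1 - Pf ξ)) * a ξ) := hac.mul_left
    have hi1 : Integrable (fun ξ => deriv φ (Λ * (1 - Pf ξ)) * (((fderiv ℝ Pf ξ v : ℝ) : ℂ) * a ξ)) :=
      (hP.ker_smooth hφ' ha1 Λ).continuous.integrable_of_hasCompactSupport ha1c.mul_left
    have hi2 : Integrable (fun ξ => φ (Λ * (1 - Pf ξ)) * fderiv ℝ a ξ v) :=
      (hP.ker_smooth hφ ha2 Λ).continuous.integrable_of_hasCompactSupport ha2c.mul_left
    have hder : (fun ξ => fderiv ℝ (fun ξ => φ (Λ * (1 - Pf ξ)) * a ξ) ξ v) =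
        fun ξ => (-(Λ : ℂ)) * (deriv φ (Λ * (1 - Pf ξ)) * (((fderiv ℝ Pf ξ v : ℝ) : ℂ) * a ξ)) +
          φ (Λ * (1 - Pf ξ)) * fderiv ℝ a ξ v := by
      funext ξ
      have d1 : HasFDerivAt (fun ξ => Λ * (1 - Pf ξ)) (Λ • (-(fderiv ℝ Pf ξ))) ξ :=
        ((hP.diff ξ).hasFDerivAt.const_sub 1).const_mul Λ
      have d2 : HasFDerivAt (fun ξ => φ (Λ * (1 - Pf ξ))) _ ξ :=
        ((hφ.differentiable (by simp) _).hasDerivAt (x := Λ * (1 - Pf ξ))).hasFDerivAt.comp ξ d1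
      have d3 := d2.mul ((ha.differentiable (by simp) ξ).hasFDerivAt)
      have d4 : fderiv ℝ (fun ξ => φ (Λ * (1 - Pf ξ)) * a ξ) ξ = _ := d3.fderiv
      rw [d4]
      simp
      ring
    have key := Kr_ibp hs hsc v u
    rw [hder, Kr_add (hi1.const_mul _) hi2, Kr_smul] at key
    calc |⟪u, v⟫| ^ (N + 1) * ‖Kr (fun ξ => φ (Λ * (1 - Pf ξ)) * a ξ) u‖
        = |⟪u, v⟫| ^ N * (|⟪u, v⟫| * ‖Kr (fun ξ => φ (Λ * (1 - Pf ξ)) * a ξ) u‖) := by ring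
      _ ≤ |⟪u, v⟫| ^ N * (Λ * ‖Kr (fun ξ => deriv φ (Λ * (1 - Pf ξ)) * (((fderiv ℝ Pf ξ v : ℝ) : ℂ) * a ξ)) u‖
            + ‖Kr (fun ξ => φ (Λ * (1 - Pf ξ)) * fderiv ℝ a ξ v) u‖) := by
          rw [key]
          gcongr
          refine (norm_add_le _ _).trans (le_of_eq ?_)
          rw [norm_mul, norm_neg, Complex.norm_real, Real.norm_of_nonneg hΛ0.le]
      _ = Λ * (|⟪u, v⟫| ^ N * ‖Kr (fun ξ => deriv φ (Λ * (1 - Pf ξ)) * (((fderiv ℝ Pf ξ v : ℝ) : ℂ) * a ξ)) u‖)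
            + |⟪u, v⟫| ^ N * ‖Kr (fun ξ => φ (Λ * (1 - Pf ξ)) * fderiv ℝ a ξ v) u‖ := by ring
      _ ≤ Λ * (C1 * Λ ^ N) + C2 * Λ ^ N := add_le_add (mul_le_mul_of_nonneg_left (h1 Λ hΛ u) hΛ0.le) (h2 Λ hΛ u)
      _ ≤ Λ * (C1 * Λ ^ N) + Λ * (C2 * Λ ^ N) := by
          have := le_mul_of_one_le_left (show 0 ≤ C2 * Λ ^ N by positivity) hΛ
          linarith
      _ = (C1 + C2) * Λ ^ (N + 1) := by ring

open scoped ContDiff in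
lemma ker_norm (hP : PolyHyp n m Pf) (N : ℕ) {φ : ℝ → ℂ} (hφ : ContDiff ℝ ∞ φ) (hφc : HasCompactSupport φ)
    {a : Eu n → ℂ} (ha : ContDiff ℝ ∞ a) (hac : HasCompactSupport a) :
    ∃ C : ℝ, 0 ≤ C ∧ ∀ Λ : ℝ, 1 ≤ Λ → ∀ u : Eu n,
      ‖u‖ ^ N * ‖Kr (fun ξ => φ (Λ * (1 - Pf ξ)) * a ξ) u‖ ≤ C * Λ ^ N := by
  choose C hC0 hC using fun i : Fin n => hP.ker_dir (EuclideanSpace.single i (1 : ℝ)) N hφ hφc ha hac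
  refine ⟨∑ i, (n : ℝ) ^ N * C i, Finset.sum_nonneg fun i _ => by have := hC0 i; positivity, fun Λ hΛ u => ?_⟩
  have hΛ0 : 0 < Λ := by linarith
  obtain ⟨i, hi⟩ := exists_coord (by have := hP.hn; omega) u
  calc ‖u‖ ^ N * ‖Kr (fun ξ => φ (Λ * (1 - Pf ξ)) * a ξ) u‖
      ≤ (n * |⟪u, EuclideanSpace.single i (1 : ℝ)⟫|) ^ N * ‖Kr (fun ξ => φ (Λ * (1 - Pf ξ)) * a ξ) u‖ := by gcongr
    _ = n ^ N * (|⟪u, EuclideanSpace.single i (1 : ℝ)⟫| ^ N * ‖Kr (fun ξ => φ (Λ * (1 - Pf ξ)) * a ξ) u‖) := by ring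
    _ ≤ n ^ N * (C i * Λ ^ N) := mul_le_mul_of_nonneg_left (hC i Λ hΛ u) (by positivity)
    _ = (n ^ N * C i) * Λ ^ N := by ring
    _ ≤ _ := by
      gcongr
      exact Finset.single_le_sum (f := fun i => (n : ℝ) ^ N * C i) (fun j _ => by have := hC0 j; positivity) (Finset.mem_univ i)

open scoped ContDiff in
lemma ker_one (hP : PolyHyp n m Pf) (N : ℕ) {φ : ℝ → ℂ} (hφ : ContDiff ℝ ∞ φ) (hφc : HasCompactSupport φ)
    {a : Eu n → ℂ} (ha : ContDiff ℝ ∞ a) (hac : HasCompactSupport a) :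
    ∃ C : ℝ, 0 ≤ C ∧ ∀ Λ : ℝ, 1 ≤ Λ → ∀ u : Eu n,
      (1 + ‖u‖) ^ N * ‖Kr (fun ξ => φ (Λ * (1 - Pf ξ)) * a ξ) u‖ ≤ C * Λ ^ N := by
  obtain ⟨C1, hC1, h1⟩ := hP.ker_norm 0 hφ hφc ha hac
  obtain ⟨C2, hC2, h2⟩ := hP.ker_norm N hφ hφc ha hac
  refine ⟨2 ^ N * (C1 + C2), by positivity, fun Λ hΛ u => ?_⟩
  have a1 := h1 Λ hΛ u
  have a2 := h2 Λ hΛ u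
  rw [pow_zero, pow_zero, one_mul, mul_one] at a1
  have hΛN : 1 ≤ Λ ^ N := one_le_pow₀ hΛ
  have h3 : (1 + ‖u‖) ^ N ≤ 2 ^ N * (1 + ‖u‖ ^ N) := by
    rcases le_total ‖u‖ 1 with h | h
    · calc (1 + ‖u‖) ^ N ≤ 2 ^ N := by gcongr; linarith
        _ ≤ _ := le_mul_of_one_le_right (by positivity) (by have : 0 ≤ ‖u‖ ^ N := by positivity
                                                            linarith)
    · calc (1 + ‖u‖) ^ N ≤ (2 * ‖u‖) ^ N := by gcongr; linarith
        _ = 2 ^ N * ‖u‖ ^ N := mul_pow _ _ _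
        _ ≤ _ := by gcongr; linarith
  set K := ‖Kr (fun ξ => φ (Λ * (1 - Pf ξ)) * a ξ) u‖
  calc (1 + ‖u‖) ^ N * K ≤ 2 ^ N * (1 + ‖u‖ ^ N) * K := by gcongr
    _ = 2 ^ N * (K + ‖u‖ ^ N * K) := by ring
    _ ≤ 2 ^ N * (C1 * Λ ^ N + C2 * Λ ^ N) := by
      gcongr
      exact a1.trans (le_mul_of_one_le_right hC1 hΛN)
    _ = _ := by ring

open scoped ContDiff in
theorem ker_tail (hP : PolyHyp n m Pf) {φ : ℝ → ℂ} (hφ : ContDiff ℝ ∞ φ) (hφc : HasCompactSupport φ)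
    {a : Eu n → ℂ} (ha : ContDiff ℝ ∞ a) (hac : HasCompactSupport a) {ε : ℝ} (hε : 0 < ε) :
    ∃ C : ℝ, 0 ≤ C ∧ ∀ Λ : ℝ, 1 ≤ Λ → Integrable (Kr (fun ξ => φ (Λ * (1 - Pf ξ)) * a ξ)) ∧
      ∫ u in (Metric.closedBall (0 : Eu n) (Λ ^ (1 + ε)))ᶜ, ‖Kr (fun ξ => φ (Λ * (1 - Pf ξ)) * a ξ) u‖ ≤ C := by
  obtain ⟨N, hN⟩ := exists_nat_gt (((n : ℝ) + 1) / ε)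
  have hN' : (n : ℝ) + 1 ≤ N * ε := by rw [div_lt_iff₀ hε] at hN; exact hN.le
  obtain ⟨C1, hC1, h1⟩ := hP.ker_one (n + 1) hφ hφc ha hac
  obtain ⟨C2, hC2, h2⟩ := hP.ker_one (N + (n + 1)) hφ hφc ha hac
  have hw : Integrable (fun u : Eu n => (1 + ‖u‖) ^ (-((n : ℝ) + 1))) := by
    apply integrable_one_add_norm
    simp
  have hw' : ∀ u : Eu n, (1 + ‖u‖) ^ (-((n : ℝ) + 1)) = ((1 + ‖u‖) ^ (n + 1))⁻¹ := by
    intro u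
    rw [Real.rpow_neg (by positivity), ← Real.rpow_natCast]; push_cast; rfl
  refine ⟨C2 * ∫ u : Eu n, (1 + ‖u‖) ^ (-((n : ℝ) + 1)), by positivity, fun Λ hΛ => ?_⟩
  have hΛ0 : 0 < Λ := by linarith
  have hgi : Integrable (fun ξ => φ (Λ * (1 - Pf ξ)) * a ξ) :=
    (hP.ker_smooth hφ ha Λ).continuous.integrable_of_hasCompactSupport hac.mul_left
  have hKc := Kr_cont hgi
  have hintg : Integrable (Kr (fun ξ => φ (Λ * (1 - Pf ξ)) * a ξ)) := by
    refine (hw.const_mul (C1 * Λ ^ (n + 1))).mono' hKc.aestronglyMeasurable (Filter.Eventually.of_forall fun u => ?_)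
    have := h1 Λ hΛ u
    rw [hw', ← div_eq_mul_inv, le_div_iff₀ (by positivity), mul_comm]
    exact this
  refine ⟨hintg, ?_⟩
  have hR0 : 0 < Λ ^ (1 + ε) := by positivity
  have hb : ∀ u ∈ (Metric.closedBall (0 : Eu n) (Λ ^ (1 + ε)))ᶜ, ‖Kr (fun ξ => φ (Λ * (1 - Pf ξ)) * a ξ) u‖
      ≤ C2 * (1 + ‖u‖) ^ (-((n : ℝ) + 1)) := by
    intro u hu
    have hu' : Λ ^ (1 + ε) < ‖u‖ := by simpa using hu
    have h3 := h2 Λ hΛ u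
    rw [hw', ← div_eq_mul_inv, le_div_iff₀ (by positivity), mul_comm]
    have h4 : Λ ^ (N + (n + 1)) ≤ (1 + ‖u‖) ^ N := by
      calc Λ ^ (N + (n + 1)) = Λ ^ ((N : ℝ) + ((n : ℝ) + 1)) := by
            rw [← Real.rpow_natCast]; push_cast; rfl
        _ ≤ Λ ^ ((1 + ε) * N) := Real.rpow_le_rpow_of_exponent_le hΛ (by nlinarith)
        _ = (Λ ^ (1 + ε)) ^ N := by rw [Real.rpow_mul hΛ0.le, Real.rpow_natCast]
        _ ≤ _ := by gcongr; linarith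
    have hpos : 0 < (1 + ‖u‖) ^ N := by positivity
    refine le_of_mul_le_mul_left ?_ hpos
    calc (1 + ‖u‖) ^ N * ((1 + ‖u‖) ^ (n + 1) * ‖Kr (fun ξ => φ (Λ * (1 - Pf ξ)) * a ξ) u‖)
        = (1 + ‖u‖) ^ (N + (n + 1)) * ‖Kr (fun ξ => φ (Λ * (1 - Pf ξ)) * a ξ) u‖ := by ring
      _ ≤ C2 * Λ ^ (N + (n + 1)) := h3
      _ ≤ C2 * (1 + ‖u‖) ^ N := by gcongr
      _ = _ := by ring
  calc _ ≤ ∫ u in (Metric.closedBall (0 : Eu n) (Λ ^ (1 + ε)))ᶜ, C2 * (1 + ‖u‖) ^ (-((n : ℝ) + 1)) :=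
        setIntegral_mono_on hintg.norm.integrableOn (hw.const_mul _).integrableOn Metric.isClosed_closedBall.measurableSet.compl hb
    _ ≤ ∫ u : Eu n, C2 * (1 + ‖u‖) ^ (-((n : ℝ) + 1)) :=
        setIntegral_le_integral (hw.const_mul _) (Filter.Eventually.of_forall fun u => by positivity)
    _ = _ := integral_const_mul _ _

end PolyHyp

lemma BM_symm {n : ℕ} {M : Eu n → ℂ} (hM : ∀ ξ, M (-ξ) = M ξ) (f h : Eu n → ℂ) : BM M f h = BM M h f := by
  unfold BM
  rw [← integral_neg_eq_self]
  congr 1; funext ξ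
  rw [hM, neg_neg]; ring

namespace PolyHyp
variable {n m : ℕ} {Pf : Eu n → ℝ}

open scoped ContDiff in
lemma piece_L2 (hP : PolyHyp n m Pf) {φ : ℝ → ℝ} (hφ : ContDiff ℝ ∞ φ) (hφc : HasCompactSupport φ)
    {χ : Eu n → ℝ} (hχ : ContDiff ℝ ∞ χ) (hχc : HasCompactSupport χ)
    (hχ0 : 0 ∉ tsupport χ) {p : ℝ} (hp1 : 1 < p) (hp2 : p < 2 * ((n : ℝ) + 1) / ((n : ℝ) + 3)) :
    ∃ A : ℝ, 0 ≤ A ∧ ∀ Λ : ℝ, 0 < Λ → ∀ f h : Eu n → ℂ, Good f → Good h →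
      ‖BM (fun ξ => (φ (Λ * (1 - Pf ξ)) : ℂ) * (χ ξ : ℂ)) f h‖ ≤ A * Λ ^ (-(1 / 2) : ℝ) * nrm p f * nrm 2 h := by
  have hχ2 : ContDiff ℝ ∞ (fun ξ => ((χ ξ ^ 2 : ℝ) : ℂ)) := Complex.ofRealCLM.contDiff.comp (hχ.pow 2)
  have hsub : tsupport (fun ξ => ((χ ξ ^ 2 : ℝ) : ℂ)) ⊆ tsupport χ := by
    refine closure_mono fun ξ hξ => ?_
    simp only [Function.mem_support] at hξ ⊢
    intro h0; apply hξ; simp [h0]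
  have hχ2c : HasCompactSupport (fun ξ => ((χ ξ ^ 2 : ℝ) : ℂ)) :=
    hχc.comp_left (g := fun t : ℝ => ((t ^ 2 : ℝ) : ℂ)) (by simp)
  obtain ⟨C, hC0, hC⟩ := hP.restriction hχ2 hχ2c (fun h => hχ0 (hsub h)) hp1 hp2
  have hPc := hP.smooth.continuous
  have hφk := hφ.continuous
  have hχk := hχ.continuous
  set J := ∫ t, φ t ^ 2 with hJ
  have hJ0 : 0 ≤ J := integral_nonneg fun _ => sq_nonneg _
  refine ⟨Real.sqrt (C * J) * (2 * Real.pi) ^ ((n : ℝ) / 2), by positivity, fun Λ hΛ f h hf hh => ?_⟩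
  have hnp := nrm_nonneg p f
  set M : Eu n → ℂ := fun ξ => (φ (Λ * (1 - Pf ξ)) : ℂ) * (χ ξ : ℂ) with hM
  have hMc : Continuous M := by simp only [hM]; fun_prop
  set ψ : ℝ → ℝ := fun s => φ (Λ * (1 - s)) ^ 2 with hψ
  have hψc : Continuous ψ := by simp only [hψ]; fun_prop
  have hψs : HasCompactSupport ψ := by
    have h1 : HasCompactSupport (fun s => φ (Λ * (1 - s))) := by
      have := hφc.comp_homeomorph ((Homeomorph.subLeft (1 : ℝ)).trans (Homeomorph.mulLeft₀ Λ hΛ.ne'))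
      exact this
    exact h1.comp_left (g := fun t : ℝ => t ^ 2) (by simp)
  have hψi : ∫ s, |ψ s| = Λ⁻¹ * J := by
    have e : ∀ s, |ψ s| = ψ s := fun s => abs_of_nonneg (sq_nonneg _)
    rw [integral_congr_ae (Filter.Eventually.of_forall e)]
    simp only [hψ]
    rw [integral_sub_left_eq_self (fun s => φ (Λ * s) ^ 2) volume 1,
      Measure.integral_comp_mul_left (fun s => φ s ^ 2) Λ, abs_of_pos (by positivity), smul_eq_mul]
  have hFc := FT_cont hf.int
  have hMsq : ∀ ξ, ‖M ξ‖ ^ 2 * ‖FT f ξ‖ ^ 2 = ψ (Pf ξ) * χ ξ ^ 2 * ‖FT f ξ‖ ^ 2 := by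
    intro ξ
    simp only [hM, hψ, norm_mul, Complex.norm_real, mul_pow, Real.norm_eq_abs, sq_abs]
  have hMs : HasCompactSupport M := by
    have : HasCompactSupport (fun ξ => (χ ξ : ℂ)) := hχc.comp_left (g := fun t : ℝ => (t : ℂ)) (by simp)
    exact this.mul_left
  have hMi : Integrable (fun ξ => ‖M ξ‖ ^ 2 * ‖FT f ξ‖ ^ 2) := by
    refine Continuous.integrable_of_hasCompactSupport (by fun_prop) ?_
    exact (hMs.comp_left (g := fun z : ℂ => ‖z‖ ^ 2) (by simp)).mul_right
  set D := Real.sqrt (C * J) * Λ ^ (-(1 / 2) : ℝ) * nrm p f with hD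
  have hD0 : 0 ≤ D := by positivity
  have hDle : ∫ ξ, ‖M ξ‖ ^ 2 * ‖FT f ξ‖ ^ 2 ≤ D ^ 2 := by
    have h1 := hC ψ hψc hψs f hf
    rw [hψi] at h1
    have e1 : (∫ ξ, (ψ (Pf ξ) : ℂ) * ((χ ξ ^ 2 : ℝ) : ℂ) * ((‖FT f ξ‖ ^ 2 : ℝ) : ℂ)) =
        ((∫ ξ, ‖M ξ‖ ^ 2 * ‖FT f ξ‖ ^ 2 : ℝ) : ℂ) := by
      rw [← integral_complex_ofReal]
      congr 1; funext ξ
      rw [hMsq]; push_cast; ring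
    rw [e1, Complex.norm_real] at h1
    refine (le_abs_self _).trans (h1.trans (le_of_eq ?_))
    rw [hD, mul_pow, mul_pow, Real.sq_sqrt (by positivity), ← Real.rpow_natCast (Λ ^ (-(1 / 2) : ℝ)), ← Real.rpow_mul hΛ.le]
    rw [show (-(1 / 2) : ℝ) * ((2 : ℕ) : ℝ) = -1 by norm_num, Real.rpow_neg_one]; ring
  refine (BM_cs hf hh hMc.measurable hD0 hMi hDle).trans (le_of_eq ?_)
  rw [hD]; ring

open scoped ContDiff in
lemma piece_Lp (hP : PolyHyp n m Pf) {φ : ℝ → ℝ} (hφ : ContDiff ℝ ∞ φ) (hφc : HasCompactSupport φ)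
    {χ : Eu n → ℝ} (hχ : ContDiff ℝ ∞ χ) (hχc : HasCompactSupport χ)
    (hχ0 : 0 ∉ tsupport χ) {p : ℝ} (hp1 : 1 < p) (hp2 : p < 2 * ((n : ℝ) + 1) / ((n : ℝ) + 3))
    {q : ℝ} (hpq : p.HolderConjugate q) {ε : ℝ} (hε : 0 < ε) :
    ∃ A : ℝ, 0 ≤ A ∧ ∀ Λ : ℝ, 1 ≤ Λ → ∀ f h : Eu n → ℂ, Good f → Good h →
      ‖BM (fun ξ => (φ (Λ * (1 - Pf ξ)) : ℂ) * (χ ξ : ℂ)) f h‖ ≤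
        A * (Λ ^ ((1 + ε) * (n * (1 / p - 1 / 2)) - 1 / 2) + 1) * nrm p f * nrm q h := by
  have hn0 : (0 : ℝ) ≤ n := Nat.cast_nonneg n
  have hp2' : p * (n + 3) < 2 * ((n : ℝ) + 1) := by rwa [lt_div_iff₀ (by positivity)] at hp2
  have hlt2 : p < 2 := by nlinarith
  obtain ⟨A, hA0, hA⟩ := hP.piece_L2 hφ hφc hχ hχc hχ0 hp1 hp2
  have hφ' : ContDiff ℝ ∞ (fun t => (φ t : ℂ)) := Complex.ofRealCLM.contDiff.comp hφ
  have hφ'c : HasCompactSupport (fun t => (φ t : ℂ)) := hφc.comp_left (g := fun t : ℝ => (t : ℂ)) (by simp)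
  have hχ' : ContDiff ℝ ∞ (fun t => (χ t : ℂ)) := Complex.ofRealCLM.contDiff.comp hχ
  have hχ'c : HasCompactSupport (fun t => (χ t : ℂ)) := hχc.comp_left (g := fun t : ℝ => (t : ℂ)) (by simp)
  obtain ⟨T, hT0, hT⟩ := hP.ker_tail hφ' hφ'c hχ' hχ'c hε
  set γ := 1 / p - 1 / 2 with hγ
  set c := (volume (Metric.ball (0 : Eu n) 1)).toReal with hc
  have hc0 : 0 ≤ c := ENNReal.toReal_nonneg
  refine ⟨2 ^ n * (A * c ^ γ + T) + T, by positivity, fun Λ hΛ f h hf hh => ?_⟩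
  have hΛ0 : 0 < Λ := by linarith
  have hnf := nrm_nonneg p f
  have hnh := nrm_nonneg q h
  have hMi : Integrable (fun ξ => (φ (Λ * (1 - Pf ξ)) : ℂ) * (χ ξ : ℂ)) :=
    (hP.ker_smooth hφ' hχ' Λ).continuous.integrable_of_hasCompactSupport hχ'c.mul_left
  obtain ⟨hKi, hKt⟩ := hT Λ hΛ
  have h1 := localization hMi hKi hf hh hpq hlt2.le (show 0 < Λ ^ (1 + ε) by positivity)
    (show 0 ≤ A * Λ ^ (-(1 / 2) : ℝ) by positivity) (fun F H hF hH => hA Λ hΛ0 F H hF hH) hKt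
  refine h1.trans ?_
  have hvol : (volume (Metric.closedBall (0 : Eu n) (Λ ^ (1 + ε)))).toReal = (Λ ^ (1 + ε)) ^ n * c := by
    rw [Measure.addHaar_closedBall _ _ (by positivity), ENNReal.toReal_mul, ENNReal.toReal_ofReal (by positivity)]
    simp [hc]
  rw [hvol, Real.mul_rpow (by positivity) hc0, ← Real.rpow_natCast (Λ ^ (1 + ε)), ← Real.rpow_mul hΛ0.le, ← Real.rpow_mul hΛ0.le]
  have e1 : Λ ^ ((1 + ε) * (n * γ) - 1 / 2) = Λ ^ (-(1 / 2) : ℝ) * Λ ^ ((1 + ε) * n * γ) := by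
    rw [← Real.rpow_add hΛ0]; congr 1; ring
  have e2 : A * Λ ^ (-(1 / 2) : ℝ) * (Λ ^ ((1 + ε) * n * γ) * c ^ γ) = A * c ^ γ * Λ ^ ((1 + ε) * (n * γ) - 1 / 2) := by
    rw [e1]; ring
  rw [e2]
  set X := Λ ^ ((1 + ε) * (n * γ) - 1 / 2) with hX
  have hX0 : 0 ≤ X := by positivity
  have hB : 0 ≤ A * c ^ γ := by positivity
  gcongr
  have : (0 : ℝ) ≤ 2 ^ n * (A * c ^ γ) := by positivity
  have t1 : 0 ≤ 2 ^ n * T * X := by positivity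
  have t2 : 0 ≤ T * X := by positivity
  nlinarith

open scoped ContDiff in
lemma piece_Lr (hP : PolyHyp n m Pf) {φ : ℝ → ℝ} (hφ : ContDiff ℝ ∞ φ) (hφc : HasCompactSupport φ)
    {χ : Eu n → ℝ} (hχ : ContDiff ℝ ∞ χ) (hχc : HasCompactSupport χ)
    (hχ0 : 0 ∉ tsupport χ) (hχe : ∀ ξ, χ (-ξ) = χ ξ) {p : ℝ} (hp1 : 1 < p) (hp2 : p < 2 * ((n : ℝ) + 1) / ((n : ℝ) + 3))
    {r r' : ℝ} (hr : r.HolderConjugate r') (hr1 : p < r) (hr2 : 1 - 1 / p < 1 / r) {ε : ℝ} (hε : 0 < ε) :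
    ∃ A : ℝ, 0 ≤ A ∧ ∀ Λ : ℝ, 1 ≤ Λ → ∀ f h : Eu n → ℂ, Good f → Good h →
      ‖BM (fun ξ => (φ (Λ * (1 - Pf ξ)) : ℂ) * (χ ξ : ℂ)) f h‖ ≤
        A * (Λ ^ ((1 + ε) * (n * (1 / p - 1 / 2)) - 1 / 2) + 1) * nrm r f * nrm r' h := by
  have hpq : p.HolderConjugate (p.conjExponent) := Real.HolderConjugate.conjExponent hp1
  set q := p.conjExponent with hq
  obtain ⟨A, hA0, hA⟩ := hP.piece_Lp hφ hφc hχ hχc hχ0 hp1 hp2 hpq hε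
  have hφ' : ContDiff ℝ ∞ (fun t => (φ t : ℂ)) := Complex.ofRealCLM.contDiff.comp hφ
  have hχ' : ContDiff ℝ ∞ (fun t => (χ t : ℂ)) := Complex.ofRealCLM.contDiff.comp hχ
  have hχ'c : HasCompactSupport (fun t => (χ t : ℂ)) := hχc.comp_left (g := fun t : ℝ => (t : ℂ)) (by simp)
  refine ⟨A, hA0, fun Λ hΛ f h hf hh => ?_⟩
  have hΛ0 : 0 < Λ := by linarith
  have hMi : Integrable (fun ξ => (φ (Λ * (1 - Pf ξ)) : ℂ) * (χ ξ : ℂ)) :=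
    (hP.ker_smooth hφ' hχ' Λ).continuous.integrable_of_hasCompactSupport hχ'c.mul_left
  set B := A * (Λ ^ ((1 + ε) * (n * (1 / p - 1 / 2)) - 1 / 2) + 1) with hB
  have hB0 : 0 ≤ B := by positivity
  have hsy := BM_symm (M := fun ξ => (φ (Λ * (1 - Pf ξ)) : ℂ) * (χ ξ : ℂ)) (fun ξ => by simp only [hP.even, hχe])
  have hp0 : 0 < p := by linarith
  have hq1 : 1 / q = 1 - 1 / p := by have := hpq.inv_add_inv_eq_one; simp only [one_div]; linarith
  have hr'1 : 1 / r' = 1 - 1 / r := by have := hr.inv_add_inv_eq_one; simp only [one_div]; linarith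
  have hip : 1 / r < 1 / p := one_div_lt_one_div_of_lt hp0 hr1
  have hden : 0 < 2 * (1 / p) - 1 := by linarith
  set θ := (1 / p - 1 / r) / (2 * (1 / p) - 1) with hθ
  have hθm : θ * (2 * (1 / p) - 1) = 1 / p - 1 / r := div_mul_cancel₀ _ hden.ne'
  have h2 := rt_BM hMi p q q p θ B B r r' hp1.le hpq.symm.lt.le hpq.symm.lt.le hp1.le
    (div_pos (by linarith) hden) (by rw [hθ, div_lt_one hden]; linarith) hB0 hB0 hr.lt.le hr.symm.lt.le
    (by rw [hq1]; linarith) (by rw [hq1, hr'1]; linarith)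
    (fun F H hF hH => hA Λ hΛ F H hF hH)
    (fun F H hF hH => by rw [hsy]; refine (hA Λ hΛ H F hH hF).trans (le_of_eq (by ring))) f h hf hh
  have e : B ^ (1 - θ) * B ^ θ = B := by
    rcases eq_or_lt_of_le hB0 with h0 | h0
    · rw [← h0, Real.zero_rpow (x := θ) (by have : 0 < θ := div_pos (by linarith) hden
                                            exact this.ne'), mul_zero]
    · rw [← Real.rpow_add h0]; simp
  rwa [e] at h2

end PolyHyp

lemma geo_sum_le {q : ℝ} (hq0 : 0 ≤ q) (hq1 : q < 1) (l : ℕ) :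
    ∑ j ∈ Finset.range l, q ^ (j + 1) ≤ (1 - q)⁻¹ := by
  rw [← tsum_geometric_of_lt_one hq0 hq1]
  refine le_trans ?_ ((summable_geometric_of_lt_one hq0 hq1).sum_le_tsum (Finset.range l) fun i _ => by positivity)
  refine Finset.sum_le_sum fun i _ => ?_
  rw [pow_succ]
  exact mul_le_of_le_one_right (by positivity) hq1.le

/-- smooth cutoff, `0` on `u ≤ 1/4`, `1` on `u ≥ 1/2` -/
def th (u : ℝ) : ℝ := Real.smoothTransition (4 * u - 1)

open scoped ContDiff in
lemma th_smooth : ContDiff ℝ ∞ th := Real.smoothTransition.contDiff.comp (f := fun u : ℝ => 4 * u - 1) (by fun_prop)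
lemma th_zero {u : ℝ} (h : u ≤ 1 / 4) : th u = 0 := Real.smoothTransition.zero_of_nonpos (by linarith)
lemma th_one {u : ℝ} (h : 1 / 2 ≤ u) : th u = 1 := Real.smoothTransition.one_of_one_le (by linarith)
lemma th_nonneg (u : ℝ) : 0 ≤ th u := Real.smoothTransition.nonneg _
lemma th_le_one (u : ℝ) : th u ≤ 1 := Real.smoothTransition.le_one _

open scoped ContDiff in
lemma rpow_cut_smooth {g : ℝ → ℝ} (hg : ContDiff ℝ ∞ g) (hg0 : ∀ u, u ≤ 1 / 4 → g u = 0) (α : ℝ) :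
    ContDiff ℝ ∞ (fun v => v ^ α * g v) := by
  rw [contDiff_iff_contDiffAt]
  intro v
  rcases lt_or_ge v (1 / 4) with h | h
  · have : (fun v => v ^ α * g v) =ᶠ[nhds v] fun _ => 0 := by
      filter_upwards [Iio_mem_nhds h] with x hx
      rw [hg0 x (le_of_lt hx), mul_zero]
    exact contDiffAt_const.congr_of_eventuallyEq this
  · have hv : v ≠ 0 := by intro h0; rw [h0] at h; norm_num at h
    exact (Real.contDiffAt_rpow_const_of_ne hv).mul hg.contDiffAt

/-- The Bochner-Riesz profile. -/
def brm {n : ℕ} (Pf : Eu n → ℝ) (α : ℝ) (ξ : Eu n) : ℝ := if 0 < 1 - Pf ξ then (1 - Pf ξ) ^ α else 0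

lemma BM_smul {n : ℕ} (c : ℂ) (M f h : Eu n → ℂ) : BM (fun ξ => c * M ξ) f h = c * BM M f h := by
  unfold BM
  rw [← integral_const_mul]
  congr 1; funext ξ; ring

namespace PolyHyp
variable {n m : ℕ} {Pf : Eu n → ℝ}

lemma cut_compact (hP : PolyHyp n m Pf) {g : ℝ → ℝ} {B : ℝ} (hg : ∀ t, B ≤ t → g t = 0) :
    HasCompactSupport (fun ξ => g (Pf ξ)) := by
  obtain ⟨R, hR, h⟩ := hP.compact_sub B
  refine HasCompactSupport.intro (isCompact_closedBall (0 : Eu n) R) fun ξ hξ => ?_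
  apply hg
  by_contra hlt
  push Not at hlt
  exact hξ (by simpa using h ξ hlt.le)

lemma cut_zero (hP : PolyHyp n m Pf) {g : ℝ → ℝ} (hg : ∀ t, t ≤ 1 / 4 → g t = 0) :
    0 ∉ tsupport (fun ξ => g (Pf ξ)) := by
  rw [notMem_tsupport_iff_eventuallyEq]
  have h1 : Pf 0 < 1 / 4 := by rw [hP.zero]; norm_num
  filter_upwards [hP.smooth.continuous.continuousAt.eventually (Iio_mem_nhds h1)] with ξ hξ
  exact hg _ (le_of_lt hξ)

lemma brm_bound (hP : PolyHyp n m Pf) {α : ℝ} (hα : 0 ≤ α) (ξ : Eu n) : |brm Pf α ξ| ≤ 1 := by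
  unfold brm
  split_ifs with h
  · rw [abs_of_nonneg (by positivity)]
    exact Real.rpow_le_one h.le (by have := hP.nonneg ξ; linarith) hα
  · simp

lemma brm_meas (hP : PolyHyp n m Pf) (α : ℝ) : Measurable (brm Pf α) := by
  have := hP.smooth.continuous.measurable
  unfold brm
  refine Measurable.ite (measurableSet_lt measurable_const (by fun_prop)) ?_ measurable_const
  exact (measurable_const.sub this).pow_const α

lemma brm_int (hP : PolyHyp n m Pf) {α : ℝ} (hα : 0 ≤ α) : Integrable (fun ξ => (brm Pf α ξ : ℂ)) := by
  obtain ⟨R, hR, h⟩ := hP.compact_sub 1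
  have hi : Integrable ((Metric.closedBall (0 : Eu n) R).indicator (fun _ => (1 : ℝ))) := by
    rw [integrable_indicator_iff Metric.isClosed_closedBall.measurableSet]
    exact integrableOn_const (isCompact_closedBall _ _).measure_lt_top.ne
  refine hi.mono' (Complex.continuous_ofReal.measurable.comp (hP.brm_meas α)).aestronglyMeasurable
    (Filter.Eventually.of_forall fun ξ => ?_)
  rw [Complex.norm_real, Real.norm_eq_abs]
  by_cases hξ : ξ ∈ Metric.closedBall (0 : Eu n) R
  · rw [Set.indicator_of_mem hξ]; exact hP.brm_bound hα ξ
  · rw [Set.indicator_of_notMem hξ]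
    have : ¬ 0 < 1 - Pf ξ := fun h0 => hξ (by simpa using h ξ (by linarith))
    simp [brm, this]

open scoped ContDiff in
/-- The case `R = 1` in bilinear form. -/
theorem br_one (hP : PolyHyp n m Pf) {p : ℝ} (hp1 : 1 < p) (hp2 : p < 2 * ((n : ℝ) + 1) / ((n : ℝ) + 3))
    {α : ℝ} (hα : (n : ℝ) * (1 / p - 1 / 2) - 1 / 2 < α)
    {r r' : ℝ} (hr : r.HolderConjugate r') (hr1 : p < r) (hr2 : 1 - 1 / p < 1 / r) :
    0 < α ∧ ∃ C : ℝ, 0 ≤ C ∧ ∀ f h : Eu n → ℂ, Good f → Good h →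
      ‖BM (fun ξ => (brm Pf α ξ : ℂ)) f h‖ ≤ C * nrm r f * nrm r' h := by
  have hn2 : (2 : ℝ) ≤ n := by exact_mod_cast hP.hn
  have hp0 : 0 < p := by linarith
  have hg : 1 / 2 < (n : ℝ) * (1 / p - 1 / 2) := by
    have hp2' : p * (n + 3) < 2 * ((n : ℝ) + 1) := by rwa [lt_div_iff₀ (by positivity)] at hp2
    have h1 : ((n : ℝ) + 3) / (2 * (n + 1)) < 1 / p := by
      rw [div_lt_div_iff₀ (by positivity) hp0]; linarith
    have h2 : ((n : ℝ) + 3) / (2 * (n + 1)) - 1 / 2 = 1 / (n + 1) := by field_simp; ring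
    have h3 : 1 / ((n : ℝ) + 1) < 1 / p - 1 / 2 := by linarith
    have h4 : (n : ℝ) * (1 / (n + 1)) < n * (1 / p - 1 / 2) := by gcongr
    have h5 : (1 : ℝ) / 2 < n * (1 / (n + 1)) := by
      rw [mul_one_div, div_lt_div_iff₀ (by norm_num) (by positivity)]; linarith
    linarith
  have hα0 : 0 < α := by linarith
  refine ⟨hα0, ?_⟩
  set γ := (n : ℝ) * (1 / p - 1 / 2) with hγ
  have hγ0 : 0 < γ := by linarith
  set ε := (α + 1 / 2 - γ) / (2 * γ) with hε
  have hε0 : 0 < ε := div_pos (by linarith) (by linarith)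
  have hεγ : ε * γ = (α + 1 / 2 - γ) / 2 := by rw [hε]; field_simp
  set e := (1 + ε) * γ - 1 / 2 with he
  have heα : e < α := by rw [he, add_mul, one_mul, hεγ]; linarith
  -- cutoffs
  set χ1 : ℝ → ℝ := fun t => Real.smoothTransition (4 * t - 1) * Real.smoothTransition (3 - t) with hχ1
  have hst : ContDiff ℝ ∞ Real.smoothTransition := Real.smoothTransition.contDiff
  have hs3 : ContDiff ℝ ∞ (fun t : ℝ => Real.smoothTransition (3 - t)) := hst.comp (f := fun t : ℝ => 3 - t) (by fun_prop)
  have hs2 : ContDiff ℝ ∞ (fun t : ℝ => Real.smoothTransition (2 - t)) := hst.comp (f := fun t : ℝ => 2 - t) (by fun_prop)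
  have hχ1s : ContDiff ℝ ∞ χ1 := (hst.comp (f := fun t : ℝ => 4 * t - 1) (by fun_prop)).mul hs3
  have hχs : ContDiff ℝ ∞ (fun ξ => χ1 (Pf ξ)) := hχ1s.comp hP.smooth
  have hχc : HasCompactSupport (fun ξ => χ1 (Pf ξ)) := hP.cut_compact (g := χ1) (B := 3) fun t ht => by
    simp only [hχ1]; rw [Real.smoothTransition.zero_of_nonpos (x := 3 - t) (by linarith), mul_zero]
  have hχ0 : 0 ∉ tsupport (fun ξ => χ1 (Pf ξ)) := hP.cut_zero (g := χ1) fun t ht => by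
    simp only [hχ1]; rw [Real.smoothTransition.zero_of_nonpos (x := 4 * t - 1) (by linarith), zero_mul]
  have hχone : ∀ t, 1 / 2 ≤ t → t ≤ 1 → χ1 t = 1 := fun t h1 h2 => by
    simp only [hχ1]
    rw [Real.smoothTransition.one_of_one_le (by linarith), Real.smoothTransition.one_of_one_le (by linarith), mul_one]
  set φ : ℝ → ℝ := fun v => v ^ α * (th v - th (v / 2)) with hφ
  have hφs : ContDiff ℝ ∞ φ := by
    refine rpow_cut_smooth (th_smooth.sub (th_smooth.comp (f := fun v : ℝ => v / 2) (by fun_prop))) (fun u hu => ?_) α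
    change th u - th (u / 2) = 0
    rcases le_total u 0 with h | h
    · rw [th_zero (by linarith), th_zero (by linarith), sub_zero]
    · rw [th_zero hu, th_zero (by linarith), sub_zero]
  have hφc : HasCompactSupport φ := by
    refine HasCompactSupport.intro (isCompact_Icc (a := (0 : ℝ)) (b := 1)) fun v hv => ?_
    simp only [Set.mem_Icc, not_and_or, not_le] at hv
    simp only [hφ]
    rcases hv with h | h
    · rw [th_zero (by linarith), th_zero (by linarith), sub_zero, mul_zero]
    · rw [th_one (by linarith), th_one (by linarith), sub_self, mul_zero]
  obtain ⟨A, hA0, hA⟩ := hP.piece_Lr hφs hφc hχs hχc hχ0 (fun ξ => by rw [hP.even]) hp1 hp2 hr hr1 hr2 hε0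
  -- the low frequency part
  set φ0 : ℝ → ℂ := fun v => ((v ^ α * (th v * Real.smoothTransition (2 - v)) : ℝ) : ℂ) with hφ0
  have hφ0s : ContDiff ℝ ∞ φ0 := Complex.ofRealCLM.contDiff.comp
    (rpow_cut_smooth (th_smooth.mul hs2) (fun u hu => by rw [th_zero hu, zero_mul]) α)
  have hφ0c : HasCompactSupport φ0 := by
    refine HasCompactSupport.intro (isCompact_Icc (a := (0 : ℝ)) (b := 2)) fun v hv => ?_
    simp only [Set.mem_Icc, not_and_or, not_le] at hv
    simp only [hφ0]
    rcases hv with h | h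
    · rw [th_zero (by linarith)]; simp
    · rw [Real.smoothTransition.zero_of_nonpos (x := 2 - v) (by linarith)]; simp
  set a : Eu n → ℂ := fun ξ => ((Real.smoothTransition (3 - Pf ξ) : ℝ) : ℂ) with ha
  have has : ContDiff ℝ ∞ a := Complex.ofRealCLM.contDiff.comp (hs3.comp hP.smooth)
  have hac : HasCompactSupport a :=
    (hP.cut_compact (g := fun t => Real.smoothTransition (3 - t)) (B := 3) fun t ht =>
      Real.smoothTransition.zero_of_nonpos (by linarith)).comp_left (g := fun t : ℝ => (t : ℂ)) (by simp)
  obtain ⟨C0, hC00, hlow⟩ := hP.ker_tail hφ0s hφ0c has hac (ε := 1) one_pos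
  have hKi := (hlow 1 le_rfl).1
  set B := ∫ u, ‖Kr (fun ξ => φ0 (1 * (1 - Pf ξ)) * a ξ) u‖ with hB
  have hB0 : 0 ≤ B := integral_nonneg fun _ => norm_nonneg _
  have hlowi : Integrable (fun ξ => φ0 (1 * (1 - Pf ξ)) * a ξ) :=
    (hP.ker_smooth hφ0s has 1).continuous.integrable_of_hasCompactSupport hac.mul_left
  -- partial sums
  set MK : ℕ → Eu n → ℂ := fun K ξ => (((1 - Pf ξ) ^ α * th (2 ^ K * (1 - Pf ξ)) : ℝ) : ℂ) with hMK
  have hM0 : MK 0 = fun ξ => φ0 (1 * (1 - Pf ξ)) * a ξ := by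
    funext ξ
    simp only [hMK, hφ0, ha, pow_zero, one_mul]
    have hPn := hP.nonneg ξ
    rw [Real.smoothTransition.one_of_one_le (x := 2 - (1 - Pf ξ)) (by linarith), mul_one, ← Complex.ofReal_mul]
    congr 1
    rcases le_total (1 - Pf ξ) 0 with h | h
    · rw [th_zero (by linarith)]; simp
    · rw [Real.smoothTransition.one_of_one_le (x := 3 - Pf ξ) (by linarith), mul_one]
  have hMS : ∀ K, MK (K + 1) = fun ξ => MK K ξ + (((((2 : ℝ) ^ (K + 1)) ^ α)⁻¹ : ℝ) : ℂ) *
      ((φ ((2 : ℝ) ^ (K + 1) * (1 - Pf ξ)) : ℂ) * (χ1 (Pf ξ) : ℂ)) := by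
    intro K
    funext ξ
    simp only [hMK, hφ]
    rw [← Complex.ofReal_mul, ← Complex.ofReal_mul, ← Complex.ofReal_add]
    congr 1
    set u := 1 - Pf ξ with hu
    have h2 : (2 : ℝ) ^ (K + 1) * u / 2 = 2 ^ K * u := by ring
    rw [h2]
    have hK1 : (1 : ℝ) ≤ 2 ^ K := one_le_pow₀ (by norm_num)
    rcases le_or_gt u 0 with h | h
    · have b1 : (2 : ℝ) ^ (K + 1) * u ≤ 0 := mul_nonpos_of_nonneg_of_nonpos (by positivity) h
      have b2 : (2 : ℝ) ^ K * u ≤ 0 := mul_nonpos_of_nonneg_of_nonpos (by positivity) h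
      rw [th_zero (by linarith), th_zero (by linarith)]; simp
    · rcases le_or_gt (1 / 2) u with h' | h'
      · have b2 : 1 / 2 ≤ (2 : ℝ) ^ K * u := by nlinarith
        have b1 : 1 / 2 ≤ (2 : ℝ) ^ (K + 1) * u := by rw [pow_succ]; nlinarith
        rw [th_one b1, th_one b2]; simp
      · rw [hχone (Pf ξ) (by linarith) (by linarith), mul_one, Real.mul_rpow (by positivity) h.le]
        have : (((2 : ℝ) ^ (K + 1)) ^ α) ≠ 0 := by positivity
        field_simp
        ring
  set q1 : ℝ := 2 ^ (e - α) with hq1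
  set q2 : ℝ := 2 ^ (-α) with hq2
  have hq1l : q1 < 1 := Real.rpow_lt_one_of_one_lt_of_neg (by norm_num) (by linarith)
  have hq2l : q2 < 1 := Real.rpow_lt_one_of_one_lt_of_neg (by norm_num) (by linarith)
  have hq10 : 0 ≤ q1 := by positivity
  have hq20 : 0 ≤ q2 := by positivity
  have hφ' : ContDiff ℝ ∞ (fun t => (φ t : ℂ)) := Complex.ofRealCLM.contDiff.comp hφs
  have hχ' : ContDiff ℝ ∞ (fun ξ => (χ1 (Pf ξ) : ℂ)) := Complex.ofRealCLM.contDiff.comp hχs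
  have hχ'c : HasCompactSupport (fun ξ => (χ1 (Pf ξ) : ℂ)) := hχc.comp_left (g := fun t : ℝ => (t : ℂ)) (by simp)
  have hpi : ∀ Λ : ℝ, Integrable (fun ξ => (φ (Λ * (1 - Pf ξ)) : ℂ) * (χ1 (Pf ξ) : ℂ)) := fun Λ =>
    (hP.ker_smooth hφ' hχ' Λ).continuous.integrable_of_hasCompactSupport hχ'c.mul_left
  have hMKi : ∀ K, Integrable (MK K) := by
    intro K
    induction K with
    | zero => rw [hM0]; exact hlowi
    | succ K ih => rw [hMS]; exact ih.add ((hpi _).const_mul _)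
  have key : ∀ (K : ℕ) (f h : Eu n → ℂ), Good f → Good h → ‖BM (MK K) f h‖ ≤
      (B + A * (∑ j ∈ Finset.range K, q1 ^ (j + 1) + ∑ j ∈ Finset.range K, q2 ^ (j + 1))) * nrm r f * nrm r' h := by
    intro K f h hf hh
    induction K with
    | zero =>
      rw [hM0, BM_kernel hlowi hf.int hh.int]
      simp only [Finset.range_zero, Finset.sum_empty, add_zero, mul_zero]
      exact KB_young (Kr_cont hlowi).measurable hKi hf hh hr
    | succ K ih =>
      set Λ : ℝ := 2 ^ (K + 1) with hΛ
      have hΛ1 : 1 ≤ Λ := one_le_pow₀ (by norm_num)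
      have hΛ0 : 0 < Λ := by linarith
      rw [hMS, BM_add (hMKi K) ((hpi _).const_mul _) hf hh, BM_smul]
      have h1 := hA Λ hΛ1 f h hf hh
      have h2 : ‖(((Λ ^ α)⁻¹ : ℝ) : ℂ) * BM (fun ξ => (φ (Λ * (1 - Pf ξ)) : ℂ) * (χ1 (Pf ξ) : ℂ)) f h‖
          ≤ A * (q1 ^ (K + 1) + q2 ^ (K + 1)) * nrm r f * nrm r' h := by
        rw [norm_mul, Complex.norm_real, Real.norm_of_nonneg (by positivity)]
        have e1 : q1 ^ (K + 1) = (Λ ^ α)⁻¹ * Λ ^ e := by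
          rw [← Real.rpow_neg hΛ0.le, ← Real.rpow_add hΛ0, hq1, hΛ, ← Real.rpow_natCast, ← Real.rpow_natCast,
            ← Real.rpow_mul (by norm_num), ← Real.rpow_mul (by norm_num)]
          congr 1; ring
        have e2 : q2 ^ (K + 1) = (Λ ^ α)⁻¹ := by
          rw [← Real.rpow_neg hΛ0.le, hq2, hΛ, ← Real.rpow_natCast, ← Real.rpow_natCast,
            ← Real.rpow_mul (by norm_num), ← Real.rpow_mul (by norm_num)]
          congr 1; ring
        rw [e1, e2]
        refine (mul_le_mul_of_nonneg_left h1 (by positivity)).trans (le_of_eq (by ring))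
      refine (norm_add_le _ _).trans ((add_le_add ih h2).trans (le_of_eq ?_))
      rw [Finset.sum_range_succ, Finset.sum_range_succ]; ring
  have i1 : 0 < 1 - q1 := by linarith
  have i2 : 0 < 1 - q2 := by linarith
  refine ⟨B + A * ((1 - q1)⁻¹ + (1 - q2)⁻¹), by positivity, fun f h hf hh => ?_⟩
  have hnf := nrm_nonneg r f
  have hnh := nrm_nonneg r' h
  have hbd : ∀ K, ‖BM (MK K) f h‖ ≤ (B + A * ((1 - q1)⁻¹ + (1 - q2)⁻¹)) * nrm r f * nrm r' h := fun K =>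
    (key K f h hf hh).trans (by
      have := geo_sum_le hq10 hq1l K
      have := geo_sum_le hq20 hq2l K
      gcongr)
  have hbi := hP.brm_int hα0.le
  have hlim : Filter.Tendsto (fun K => BM (MK K) f h) Filter.atTop (nhds (BM (fun ξ => (brm Pf α ξ : ℂ)) f h)) := by
    unfold BM
    refine tendsto_integral_of_dominated_convergence (fun ξ => ‖(brm Pf α ξ : ℂ) * FT f ξ * FT h (-ξ)‖)
      (fun K => (BM_integrable (hMKi K) hf.int hh.int).1) (BM_integrable hbi hf.int hh.int).norm ?_ ?_
    · intro K
      refine Filter.Eventually.of_forall fun ξ => ?_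
      rw [norm_mul, norm_mul, norm_mul, norm_mul]
      gcongr
      simp only [hMK, Complex.norm_real, brm, Real.norm_eq_abs]
      split_ifs with h0
      · rw [abs_mul, abs_of_nonneg (th_nonneg _)]
        exact mul_le_of_le_one_right (abs_nonneg _) (th_le_one _)
      · rw [th_zero (u := 2 ^ K * (1 - Pf ξ)) (by
          have : (2 : ℝ) ^ K * (1 - Pf ξ) ≤ 0 := mul_nonpos_of_nonneg_of_nonpos (by positivity) (by linarith)
          linarith)]
        simp
    · refine Filter.Eventually.of_forall fun ξ => ?_
      refine Filter.Tendsto.mul_const _ (Filter.Tendsto.mul_const _ ?_)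
      refine tendsto_const_nhds.congr' ?_
      by_cases h0 : 0 < 1 - Pf ξ
      · have ht : Filter.Tendsto (fun K : ℕ => (2 : ℝ) ^ K * (1 - Pf ξ)) Filter.atTop Filter.atTop :=
          (tendsto_pow_atTop_atTop_of_one_lt (by norm_num)).atTop_mul_const h0
        filter_upwards [ht.eventually_ge_atTop (1 / 2)] with K hK
        simp only [hMK, brm, if_pos h0]
        rw [th_one hK, mul_one]
      · refine Filter.Eventually.of_forall fun K => ?_
        simp only [hMK, brm, if_neg h0]
        rw [th_zero (u := 2 ^ K * (1 - Pf ξ)) (by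
          have : (2 : ℝ) ^ K * (1 - Pf ξ) ≤ 0 := mul_nonpos_of_nonneg_of_nonpos (by positivity) (by linarith)
          linarith), mul_zero]
  exact le_of_tendsto hlim.norm (Filter.Eventually.of_forall hbd)

end PolyHyp

lemma FT_dil {n : ℕ} (f : Eu n → ℂ) {δ : ℝ} (hδ : 0 < δ) (ξ : Eu n) :
    FT (fun x => f (δ • x)) ξ = (((δ ^ n)⁻¹ : ℝ) : ℂ) * FT f (δ⁻¹ • ξ) := by
  unfold FT
  have := Measure.integral_comp_smul (volume : Measure (Eu n))
    (fun x => Complex.exp (-I * (⟪x, δ⁻¹ • ξ⟫ : ℂ)) * f x) δ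
  rw [finrank_euclideanSpace_fin, abs_of_pos (by positivity), Complex.real_smul] at this
  rw [← this]
  congr 1; ext x
  rw [inner_smul_left, inner_smul_right]
  simp only [conj_trivial]
  rw [mul_inv_cancel_left₀ hδ.ne']

lemma nrm_dil {n : ℕ} (f : Eu n → ℂ) {δ : ℝ} (hδ : 0 < δ) (p : ℝ) :
    nrm p (fun x => f (δ • x)) = ((δ ^ n)⁻¹) ^ (1 / p) * nrm p f := by
  unfold nrm
  have := Measure.integral_comp_smul (volume : Measure (Eu n)) (fun x => ‖f x‖ ^ p) δ
  rw [finrank_euclideanSpace_fin, abs_of_pos (by positivity), smul_eq_mul] at this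
  rw [this, Real.mul_rpow (by positivity) (by positivity)]

lemma Good.dil {n : ℕ} {f : Eu n → ℂ} (hf : Good f) {δ : ℝ} (hδ : 0 < δ) :
    Good (fun x => f (δ • x)) := by
  obtain ⟨C, hC⟩ := hf.bdd
  exact ⟨hf.meas.comp (measurable_const_smul δ), hf.int.comp_smul hδ.ne', C, fun x => hC _⟩

lemma BM_dil {n : ℕ} (M f h : Eu n → ℂ) {δ : ℝ} (hδ : 0 < δ) :
    BM (fun ξ => M (δ • ξ)) f h = ((δ ^ n : ℝ) : ℂ) * BM M (fun x => f (δ • x)) (fun x => h (δ • x)) := by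
  unfold BM
  have := Measure.integral_comp_smul (volume : Measure (Eu n))
    (fun ξ => M ξ * FT (fun x => f (δ • x)) ξ * FT (fun x => h (δ • x)) (-ξ)) δ
  rw [finrank_euclideanSpace_fin, abs_of_pos (by positivity), Complex.real_smul] at this
  have hd : ((δ ^ n : ℝ) : ℂ) ≠ 0 := by exact_mod_cast (pow_pos hδ n).ne'
  have h2 : ∀ c : ℂ, c = ((δ ^ n : ℝ) : ℂ) * (((δ ^ n : ℝ) : ℂ) * ((((δ ^ n)⁻¹ : ℝ) : ℂ) * (((δ ^ n)⁻¹ : ℝ) : ℂ) * c)) := by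
    intro c
    push_cast at hd ⊢
    field_simp
  rw [h2 (∫ ξ, M (δ • ξ) * FT f ξ * FT h (-ξ)), ← integral_const_mul]
  congr 1
  have h3 : ∀ c d : ℂ, (((δ ^ n)⁻¹ : ℝ) : ℂ) * c = d → c = ((δ ^ n : ℝ) : ℂ) * d := by
    rintro c d rfl
    push_cast at hd ⊢
    field_simp
  refine (h3 _ _ this.symm).symm ▸ ?_
  congr 2
  ext ξ
  simp only [FT_dil _ hδ, smul_neg, inv_smul_smul₀ hδ.ne']
  ring

lemma holder_dil {n : ℕ} {M : Eu n → ℂ} {C r r' : ℝ} (hr : r.HolderConjugate r')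
    (hM : ∀ f h : Eu n → ℂ, Good f → Good h → ‖BM M f h‖ ≤ C * nrm r f * nrm r' h) {δ : ℝ} (hδ : 0 < δ)
    {f h : Eu n → ℂ} (hf : Good f) (hh : Good h) :
    ‖BM (fun ξ => M (δ • ξ)) f h‖ ≤ C * nrm r f * nrm r' h := by
  rw [BM_dil _ _ _ hδ, norm_mul, Complex.norm_real, Real.norm_of_nonneg (by positivity)]
  refine (mul_le_mul_of_nonneg_left (hM _ _ (hf.dil hδ) (hh.dil hδ)) (by positivity)).trans (le_of_eq ?_)
  rw [nrm_dil _ hδ, nrm_dil _ hδ]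
  have hpos : 0 < (δ ^ n)⁻¹ := by positivity
  have h1 : ((δ ^ n)⁻¹) ^ (1 / r) * ((δ ^ n)⁻¹) ^ (1 / r') = (δ ^ n)⁻¹ := by
    rw [← Real.rpow_add hpos, one_div, one_div, hr.inv_add_inv_eq_one, Real.rpow_one]
  calc _ = δ ^ n * (((δ ^ n)⁻¹) ^ (1 / r) * ((δ ^ n)⁻¹) ^ (1 / r')) * (C * nrm r f * nrm r' h) := by ring
    _ = _ := by rw [h1, mul_inv_cancel₀ (by positivity), one_mul]

lemma IFT_pair {n : ℕ} {M f h : Eu n → ℂ} (hM : Integrable M) (hf : Good f) (hh : Good h) :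
    ∫ x, IFT (fun ξ => M ξ * FT f ξ) x * h x = (((2 * Real.pi) ^ n : ℝ) : ℂ)⁻¹ * BM M f h := by
  unfold IFT BM
  have hg : Integrable (fun ξ => M ξ * FT f ξ) :=
    hM.mul_bdd (c := ∫ x, ‖f x‖) (FT_cont hf.int).aestronglyMeasurable
      (Filter.Eventually.of_forall fun ξ => FT_norm_le f ξ)
  simp_rw [mul_assoc (((2 * Real.pi) ^ n : ℝ) : ℂ)⁻¹]
  rw [integral_const_mul]
  congr 1
  simp_rw [← integral_mul_const]
  rw [integral_integral_swap]
  · congr 1; ext ξ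
    have e : FT h (-ξ) = ∫ x, Complex.exp (-I * (⟪x, -ξ⟫ : ℂ)) * h x := rfl
    rw [e, ← integral_const_mul]
    congr 1; ext x
    rw [inner_neg_right]
    have : -I * ((-⟪x, ξ⟫ : ℝ) : ℂ) = I * (⟪x, ξ⟫ : ℂ) := by push_cast; ring
    rw [this]; ring
  · have h1 : Integrable (fun w : Eu n × Eu n => h w.1 * (M w.2 * FT f w.2)) (volume.prod volume) :=
      hh.int.mul_prod hg
    have h2 := h1.bdd_mul (c := 1)
      (f := fun w : Eu n × Eu n => Complex.exp (I * (⟪w.1, w.2⟫ : ℂ)))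
      (Continuous.aestronglyMeasurable (by fun_prop))
      (Filter.Eventually.of_forall fun x => (norm_expI _).le)
    refine h2.congr (Filter.Eventually.of_forall fun w => ?_)
    simp only [Function.uncurry]; ring

/-- Converse Hölder. -/
lemma conv_holder {n : ℕ} {u : Eu n → ℂ} (hu : Continuous u) {B : ℝ} (hB : ∀ x, ‖u x‖ ≤ B)
    {r r' : ℝ} (hr : r.HolderConjugate r') {D : ℝ} (hD : 0 ≤ D)
    (H : ∀ h : Eu n → ℂ, Good h → ‖∫ x, u x * h x‖ ≤ D * nrm r' h) :
    ∫⁻ x, ‖u x‖ₑ ^ r ≤ ENNReal.ofReal (D ^ r) := by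
  have hr1 := hr.lt
  have hr0 : 0 < r := by linarith
  have hr'0 : 0 < r' := hr.symm.pos
  have hB0 : 0 ≤ B := (norm_nonneg _).trans (hB 0)
  have hcr : Continuous (fun x => ‖u x‖ ^ r) := hu.norm.rpow_const fun x => Or.inr hr0.le
  have main : ∀ j : ℕ, ∫⁻ x in Metric.ball (0 : Eu n) j, ‖u x‖ₑ ^ r ≤ ENNReal.ofReal (D ^ r) := by
    intro j
    set S := Metric.ball (0 : Eu n) j
    have hS : MeasurableSet S := Metric.isOpen_ball.measurableSet
    have hSf : volume S ≠ ⊤ := measure_ball_lt_top.ne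
    have hmeas : Measurable (fun x => (starRingEnd ℂ) (u x) * ((‖u x‖ ^ (r - 2) : ℝ) : ℂ)) := by
      refine (Complex.continuous_conj.measurable.comp hu.measurable).mul ?_
      exact Complex.measurable_ofReal.comp (hu.measurable.norm.pow_const _)
    have hnorm : ∀ x, ‖(starRingEnd ℂ) (u x) * ((‖u x‖ ^ (r - 2) : ℝ) : ℂ)‖ = ‖u x‖ ^ (r - 1) := by
      intro x
      rw [norm_mul, RCLike.norm_conj, Complex.norm_real, Real.norm_of_nonneg (by positivity)]
      rcases eq_or_lt_of_le (norm_nonneg (u x)) with h | h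
      · rw [← h, zero_mul, Real.zero_rpow (by linarith)]
      · rw [← Real.rpow_one_add' h.le (by linarith)]; congr 1; ring
    set h : Eu n → ℂ := S.indicator (fun x => (starRingEnd ℂ) (u x) * ((‖u x‖ ^ (r - 2) : ℝ) : ℂ)) with hh
    have hbd : ∀ x, ‖h x‖ ≤ B ^ (r - 1) := fun x =>
      (norm_indicator_le_norm_self _ x).trans (by
        rw [hnorm]; exact Real.rpow_le_rpow (norm_nonneg _) (hB x) (by linarith))
    have hgood : Good h := by
      refine ⟨hmeas.indicator hS, ?_, B ^ (r - 1), hbd⟩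
      rw [hh, integrable_indicator_iff hS]
      refine Measure.integrableOn_of_bounded (M := B ^ (r - 1)) hSf hmeas.aestronglyMeasurable ?_
      filter_upwards with x
      rw [hnorm]; exact Real.rpow_le_rpow (norm_nonneg _) (hB x) (by linarith)
    set J := ∫ x in S, ‖u x‖ ^ r with hJ
    have hJ0 : 0 ≤ J := integral_nonneg fun x => by positivity
    have e1 : ∫ x, u x * h x = (J : ℂ) := by
      rw [hJ, ← integral_complex_ofReal, ← integral_indicator hS]
      congr 1; ext x
      by_cases hx : x ∈ S
      · simp only [hh, Set.indicator_of_mem hx]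
        rw [← mul_assoc, Complex.mul_conj, Complex.normSq_eq_norm_sq, ← Complex.ofReal_mul]
        congr 1
        rcases eq_or_lt_of_le (norm_nonneg (u x)) with h | h
        · rw [← h, Real.zero_rpow hr0.ne']; simp
        · rw [← Real.rpow_natCast, ← Real.rpow_add h]; congr 1; push_cast; ring
      · simp [hh, Set.indicator_of_notMem hx]
    have e2 : nrm r' h = J ^ (1 / r') := by
      unfold nrm
      congr 1
      rw [hJ, ← integral_indicator hS]
      congr 1; ext x
      by_cases hx : x ∈ S
      · simp only [hh, Set.indicator_of_mem hx]
        rw [hnorm, ← Real.rpow_mul (norm_nonneg _)]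
        congr 1
        have := hr.sub_one_mul_conj
        linarith
      · simp only [hh, Set.indicator_of_notMem hx, norm_zero]
        rw [Real.zero_rpow hr'0.ne']
    have e3 := H h hgood
    rw [e1, e2, Complex.norm_real, Real.norm_of_nonneg hJ0] at e3
    have e4 : J ≤ D ^ r := by
      rcases eq_or_lt_of_le hJ0 with h | h
      · rw [← h]; positivity
      · have : J ^ (1 / r) ≤ D := by
          have h5 : J ^ (1 / r) * J ^ (1 / r') = J := by
            rw [← Real.rpow_add h, one_div, one_div, hr.inv_add_inv_eq_one, Real.rpow_one]
          have h6 : 0 < J ^ (1 / r') := by positivity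
          nth_rewrite 1 [← h5] at e3
          exact le_of_mul_le_mul_right e3 h6
        calc J = (J ^ (1 / r)) ^ r := by rw [← Real.rpow_mul hJ0, one_div_mul_cancel hr0.ne', Real.rpow_one]
          _ ≤ D ^ r := Real.rpow_le_rpow (by positivity) this hr0.le
    have hintg : IntegrableOn (fun x => ‖u x‖ ^ r) S := by
      refine Measure.integrableOn_of_bounded (M := B ^ r) hSf hcr.aestronglyMeasurable ?_
      filter_upwards with x
      rw [Real.norm_of_nonneg (by positivity)]; exact Real.rpow_le_rpow (norm_nonneg _) (hB x) hr0.le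
    have e5 : ∫⁻ x in S, ‖u x‖ₑ ^ r = ENNReal.ofReal J := by
      rw [hJ, ofReal_integral_eq_lintegral_ofReal hintg (Filter.Eventually.of_forall fun x => by positivity)]
      congr 1; ext x
      rw [← ENNReal.ofReal_rpow_of_nonneg (norm_nonneg _) hr0.le, ofReal_norm]
    rw [e5]; exact ENNReal.ofReal_le_ofReal e4
  have hdir : Directed (· ⊆ ·) (fun j : ℕ => Metric.ball (0 : Eu n) j) :=
    Monotone.directed_le fun i j hij => Metric.ball_subset_ball (by exact_mod_cast hij)
  have := setLIntegral_iUnion_of_directed (μ := volume) (fun x => ‖u x‖ₑ ^ r) hdir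
  rw [Metric.iUnion_ball_nat, setLIntegral_univ] at this
  rw [this]
  exact iSup_le main

lemma schwartz_good {n : ℕ} (f : SchwartzMap (Eu n) ℂ) : Good (⇑f) := by
  refine ⟨f.continuous.measurable, f.integrable, ?_⟩
  obtain ⟨C, hC⟩ := f.decay 0 0
  exact ⟨C, fun x => by simpa using hC.2 x⟩

lemma eLp_en {n : ℕ} (f : Eu n → ℂ) {r : ℝ} (hr : 0 < r) :
    eLpNorm f (ENNReal.ofReal r) volume = en r f := by
  rw [eLpNorm_eq_lintegral_rpow_enorm_toReal (by simpa using hr) ENNReal.ofReal_ne_top,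
    ENNReal.toReal_ofReal hr.le]
  rfl

lemma exists_p {n : ℕ} {p a b α : ℝ} (hp : 1 ≤ p) (ha : p < a) (hb : 1 - 1 / p < b) (N : ℝ)
    (hα : (n : ℝ) * (1 / p - 1 / 2) - 1 / 2 < α) (hN : p < N) :
    ∃ q, 1 < q ∧ q < a ∧ q < N ∧ 1 - 1 / q < b ∧ (n : ℝ) * (1 / q - 1 / 2) - 1 / 2 < α := by
  have hp0 : p ≠ 0 := by positivity
  have c1 : ContinuousAt (fun q : ℝ => 1 - 1 / q) p := by fun_prop (disch := assumption)
  have c2 : ContinuousAt (fun q : ℝ => (n : ℝ) * (1 / q - 1 / 2) - 1 / 2) p := by fun_prop (disch := assumption)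
  have h1 := (c1.eventually (gt_mem_nhds hb)).filter_mono (nhdsWithin_le_nhds (s := Set.Ioi p))
  have h2 := (c2.eventually (gt_mem_nhds hα)).filter_mono (nhdsWithin_le_nhds (s := Set.Ioi p))
  have h3 : ∀ᶠ q in nhdsWithin p (Set.Ioi p), q < a := (gt_mem_nhds ha).filter_mono nhdsWithin_le_nhds
  have h4 : ∀ᶠ q in nhdsWithin p (Set.Ioi p), q < N := (gt_mem_nhds hN).filter_mono nhdsWithin_le_nhds
  obtain ⟨q, g1, g2, g3, g4, g5⟩ := (h1.and (h2.and (h3.and (h4.and self_mem_nhdsWithin)))).exists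
  exact ⟨q, hp.trans_lt g5, g3, g4, g1, g2⟩

theorem br_final (n m : ℕ) (Pf : Eu n → ℝ) (hP : PolyHyp n m Pf)
    (p : ℝ) (hp1 : 1 ≤ p) (hp2 : p < 2 * ((n : ℝ) + 1) / ((n : ℝ) + 3))
    (α : ℝ) (hα : (n : ℝ) * (1/p - 1/2) - 1/2 < α)
    (r : ℝ) (hr1 : p < r) (hr2 : 1 - 1/p < 1/r) :
    ∃ C : ℝ, 0 < C ∧ ∀ R : ℝ, 0 < R →
      ∀ f : SchwartzMap (Eu n) ℂ,
        eLpNorm (IFT (fun ξ =>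
            ((if 0 < 1 - Pf ξ / R then (1 - Pf ξ / R) ^ α else 0 : ℝ) : ℂ) *
            FT (⇑f) ξ)) (ENNReal.ofReal r) volume ≤
          ENNReal.ofReal C * eLpNorm (⇑f) (ENNReal.ofReal r) volume := by
  obtain ⟨q, hq1, hqr, hq2, hq3, hq4⟩ := exists_p hp1 hr1 hr2 _ hα hp2
  have hr : r.HolderConjugate r.conjExponent := Real.HolderConjugate.conjExponent (by linarith)
  have hr0 : 0 < r := hr.pos
  obtain ⟨hα0, C, hC0, hC⟩ := hP.br_one hq1 hq2 hq4 hr hqr hq3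
  set c : ℝ := ((2 * Real.pi) ^ n)⁻¹ with hc
  have hc0 : 0 < c := by positivity
  refine ⟨c * C + 1, by positivity, fun R hR f => ?_⟩
  have hf := schwartz_good f
  have hm0 : (m : ℝ) ≠ 0 := by have := hP.hm; positivity
  set δ : ℝ := R⁻¹ ^ (1 / (m : ℝ)) with hδ
  have hδ0 : 0 < δ := by positivity
  have hδm : δ ^ m = R⁻¹ := by
    rw [hδ, ← Real.rpow_natCast, ← Real.rpow_mul (by positivity), one_div_mul_cancel hm0, Real.rpow_one]
  set M : Eu n → ℂ := fun ξ => (brm Pf α (δ • ξ) : ℂ) with hM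
  have hMe : (fun ξ => ((if 0 < 1 - Pf ξ / R then (1 - Pf ξ / R) ^ α else 0 : ℝ) : ℂ) * FT (⇑f) ξ)
      = fun ξ => M ξ * FT (⇑f) ξ := by
    funext ξ
    simp only [hM, brm, hP.hom, hδm, div_eq_inv_mul]
  rw [hMe]
  have hMi : Integrable M := (hP.brm_int hα0.le).comp_smul hδ0.ne'
  have hg : Integrable (fun ξ => M ξ * FT f ξ) :=
    hMi.mul_bdd (c := ∫ x, ‖f x‖) (FT_cont hf.int).aestronglyMeasurable
      (Filter.Eventually.of_forall fun ξ => FT_norm_le f ξ)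
  set u := IFT (fun ξ => M ξ * FT (⇑f) ξ) with hu
  have hue : ∀ x, u x = (((2 * Real.pi) ^ n : ℝ) : ℂ)⁻¹ * Kr (fun ξ => M ξ * FT (⇑f) ξ) x := fun x => rfl
  have huc : Continuous u := by
    rw [funext hue]; exact continuous_const.mul (Kr_cont hg)
  have hub : ∀ x, ‖u x‖ ≤ c * ∫ ξ, ‖M ξ * FT f ξ‖ := fun x => by
    rw [hue, ← Complex.ofReal_inv, norm_mul, Complex.norm_real, Real.norm_of_nonneg (by positivity)]
    exact mul_le_mul_of_nonneg_left (Kr_norm_le _ _) (by positivity)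
  have hD : 0 ≤ c * C * nrm r f := mul_nonneg (by positivity) (nrm_nonneg _ _)
  have key := conv_holder huc hub hr hD (fun h hh => by
    rw [hu, IFT_pair hMi hf hh, ← Complex.ofReal_inv, norm_mul, Complex.norm_real,
      Real.norm_of_nonneg (by positivity)]
    refine (mul_le_mul_of_nonneg_left (holder_dil hr hC hδ0 hf hh) hc0.le).trans (le_of_eq (by ring)))
  rw [eLp_en _ hr0, eLp_en _ hr0, en_eq hf hr.lt.le, ← ENNReal.ofReal_mul (by positivity)]
  calc en r u ≤ (ENNReal.ofReal ((c * C * nrm r f) ^ r)) ^ (1 / r) := by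
        unfold en; exact ENNReal.rpow_le_rpow key (by positivity)
    _ = ENNReal.ofReal (c * C * nrm r f) := by
        rw [ENNReal.ofReal_rpow_of_nonneg (by positivity) (by positivity), ← Real.rpow_mul hD,
          mul_one_div_cancel hr0.ne', Real.rpow_one]
    _ ≤ _ := ENNReal.ofReal_le_ofReal (mul_le_mul_of_nonneg_right (by linarith) (nrm_nonneg _ _))

/-- Bochner–Riesz summability for `P(D)`: for `1 ≤ p < min(2(n+1)/(n+3), n/m)`,
`α > n(1/p − 1/2) − 1/2` and `p < r < p'`, the Bochner–Riesz means of order `α` are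
uniformly bounded on `L^r`. -/
theorem statement19
    (n m : ℕ) (hn : 2 ≤ n) (hm : 2 ≤ m) (hnm : m < n)
    (P : MvPolynomial (Fin n) ℝ) (hhom : P.IsHomogeneous m)
    (Pf : EuclideanSpace ℝ (Fin n) → ℝ)
    (hPf : ∀ ξ, Pf ξ = MvPolynomial.eval (fun i => ξ i) P)
    (hell : ∀ ξ : EuclideanSpace ℝ (Fin n), ξ ≠ 0 → 0 < Pf ξ)
    (hnd : ∀ ξ : EuclideanSpace ℝ (Fin n), ξ ≠ 0 → HessDet Pf ξ ≠ 0)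
    (p : ℝ) (hp1 : 1 ≤ p)
    (hp2 : p < min (2*((n : ℝ)+1)/((n : ℝ)+3)) ((n : ℝ)/(m : ℝ)))
    (α : ℝ) (hα : (n : ℝ) * (1/p - 1/2) - 1/2 < α)
    (r : ℝ) (hr1 : p < r) (hr2 : 1 - 1/p < 1/r) :
    ∃ C : ℝ, 0 < C ∧ ∀ R : ℝ, 0 < R →
      ∀ f : SchwartzMap (EuclideanSpace ℝ (Fin n)) ℂ,
        eLpNorm (IFT (fun ξ =>
            ((if 0 < 1 - Pf ξ / R then (1 - Pf ξ / R) ^ α else 0 : ℝ) : ℂ) *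
            FT (⇑f) ξ)) (ENNReal.ofReal r) volume ≤
          ENNReal.ofReal C * eLpNorm (⇑f) (ENNReal.ofReal r) volume := by
  exact br_final n m Pf (polyHyp_of hn hm P hhom Pf hPf hell hnd) p hp1
    (hp2.trans_le (min_le_left _ _)) α hα r hr1 hr2
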